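/- arXiv:1909.09127 — 4 statements merged into one kernel-verified Lean document; each statement's English description precedes it below -/
import Mathlib

section
/- Let d ≥ 1, let S_1 ⊊ S_2 ⊊ ⋯ ⊊ S_k be a chain in B̄, and let 1 ≤ l ≤ k. With the conventions S_0 = ∅ and S_{k+1} = {1,…,d+1}, the following holds in A_d: x_{S_1}⋯x_{S_{l-1}}·x_{S_l}²·x_{S_{l+1}}⋯x_{S_k} = −∑_{T : S_{l-1}⊊T⊊S_l} (|T∖S_{l-1}|/|S_l∖S_{l-1}|)·x_{S_1}⋯x_{S_{l-1}}·x_T·x_{S_l}⋯x_{S_k} − ∑_{T : S_l⊊T⊊S_{l+1}} (|S_{l+1}∖T|/|S_{l+1}∖S_l|)·x_{S_1}⋯x_{S_l}·x_T·x_{S_{l+1}}⋯x_{S_k}, where both sums are over subsets T strictly between the indicated sets (and the coefficients are ratios of cardinalities of set differences). -/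
open MvPolynomial

/-- Subsets of the ground set `{1, …, d+1}` (modeled as `Fin (d+1)`). -/
abbrev Subs (d : ℕ) := Finset (Fin (d + 1))

/-- The polynomial ring `R_d` with one variable `x_S` for each subset `S`
(only the variables indexed by proper nonempty subsets are ever used). -/
abbrev Rd (d : ℕ) := MvPolynomial (Subs d) ℚ

/-- `S ∈ B̄`, i.e. `S ≠ ∅` and `S ≠ {1,…,d+1}`. -/
def isProper (d : ℕ) (S : Subs d) : Prop := S ≠ ∅ ∧ S ≠ Finset.univ

instance (d : ℕ) (S : Subs d) : Decidable (isProper d S) := by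
  unfold isProper; infer_instance

/-- The ideal `I₁` generated by products of variables indexed by incomparable
members of `B̄`. -/
noncomputable def I1 (d : ℕ) : Ideal (Rd d) :=
  Ideal.span {p | ∃ S S' : Subs d, isProper d S ∧ isProper d S' ∧
    ¬ S ⊆ S' ∧ ¬ S' ⊆ S ∧ p = X S * X S'}

/-- `ℓ_a = ∑_{S ∈ B̄, a ∈ S} x_S`. -/
noncomputable def ell (d : ℕ) (a : Fin (d + 1)) : Rd d :=
  ∑ S ∈ Finset.univ.filter (fun S : Subs d => isProper d S ∧ a ∈ S), X S

/-- The ideal `I₂` generated by the differences `ℓ_a - ℓ_b`. -/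
noncomputable def I2 (d : ℕ) : Ideal (Rd d) :=
  Ideal.span {p | ∃ a b : Fin (d + 1), p = ell d a - ell d b}

/-- The ideal `I₁ + I₂`; the Chow ring of the permutohedral variety is
`A_d = R_d/(I₁+I₂)`, and an identity holds "in `A_d`" iff the difference of
the two sides lies in `Itot d`. -/
noncomputable def Itot (d : ℕ) : Ideal (Rd d) := I1 d + I2 d

lemma avg_mem (d : ℕ) (A : Subs d) (hA : A.Nonempty) (b : Fin (d + 1)) :
    (∑ T ∈ Finset.univ.filter (fun T : Subs d => isProper d T),
      C (((T ∩ A).card : ℚ) / (A.card : ℚ)) * X T : Rd d) - ell d b ∈ Itot d := by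
  have hc : (A.card : ℚ) ≠ 0 := by
    have := hA.card_pos
    positivity
  have key : (∑ T ∈ Finset.univ.filter (fun T : Subs d => isProper d T),
      C (((T ∩ A).card : ℚ) / (A.card : ℚ)) * X T : Rd d) - ell d b
      = C ((A.card : ℚ)⁻¹) * ∑ a ∈ A, (ell d a - ell d b) := by
    have h1 : (∑ a ∈ A, ell d a : Rd d) =
        ∑ T ∈ Finset.univ.filter (fun T : Subs d => isProper d T),
          C ((T ∩ A).card : ℚ) * X T := by
      simp only [ell, Finset.filter_and]
      simp only [← Finset.filter_and, Finset.sum_filter, ite_and]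
      rw [Finset.sum_comm]
      refine Finset.sum_congr rfl fun T _ => ?_
      by_cases hT : isProper d T
      · simp only [hT, if_true]
        rw [← Finset.sum_filter, Finset.sum_const, Finset.filter_mem_eq_inter,
          Finset.inter_comm, nsmul_eq_mul]
        simp
      · simp [hT]
    rw [Finset.sum_sub_distrib, h1, mul_sub, Finset.mul_sum]
    congr 1
    · refine Finset.sum_congr rfl fun T _ => ?_
      rw [← mul_assoc, ← C_mul]
      congr 2
      field_simp
    · rw [Finset.sum_const, nsmul_eq_mul, ← mul_assoc]
      have : ((A.card : ℕ) : Rd d) = C (A.card : ℚ) := by simp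
      rw [this, ← C_mul, inv_mul_cancel₀ hc]
      simp
  rw [key]
  refine Ideal.mul_mem_left _ _ (Ideal.sum_mem _ fun a _ => ?_)
  exact Ideal.mem_sup_right (Ideal.subset_span ⟨a, b, rfl⟩)

lemma incomp_mem (d k : ℕ) (S : Fin k → Subs d) (hproper : ∀ i, isProper d (S i))
    (T : Subs d) (hT : isProper d T) (i : Fin k) (h : ¬ (T ⊆ S i ∨ S i ⊆ T)) :
    (X T * ∏ i, X (S i) : Rd d) ∈ Itot d := by
  push Not at h
  rw [← Finset.mul_prod_erase _ _ (Finset.mem_univ i), ← mul_assoc]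
  exact Ideal.mul_mem_right _ _ (Ideal.mem_sup_left
    (Ideal.subset_span ⟨T, S i, hT, hproper i, h.1, h.2, rfl⟩))

set_option maxHeartbeats 2000000 in
/-- Lemma `lem:squares`: for a chain `S₁ ⊊ ⋯ ⊊ S_k` in `B̄` and an index
`l`, with the conventions `S₀ = ∅`, `S_{k+1} = {1,…,d+1}`, in `A_d`:
`x_{S₁}⋯x_{S_{l-1}}·x_{S_l}²·x_{S_{l+1}}⋯x_{S_k}
  = −∑_{S_{l-1}⊊T⊊S_l} (|T∖S_{l-1}|/|S_l∖S_{l-1}|)·x_{S₁}⋯x_{S_{l-1}}·x_T·x_{S_l}⋯x_{S_k}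
    −∑_{S_l⊊T⊊S_{l+1}} (|S_{l+1}∖T|/|S_{l+1}∖S_l|)·x_{S₁}⋯x_{S_l}·x_T·x_{S_{l+1}}⋯x_{S_k}`. -/
theorem stmt1 (d k : ℕ) (hd : 1 ≤ d)
    (S : Fin k → Subs d) (hproper : ∀ i, isProper d (S i)) (hmono : StrictMono S)
    (l : Fin k) (Sprev Snext : Subs d)
    (hprev : Sprev = if 0 < (l : ℕ) then
        S ⟨(l : ℕ) - 1, Nat.lt_of_le_of_lt (Nat.sub_le _ _) l.isLt⟩ else ∅)
    (hnext : Snext = if h : (l : ℕ) + 1 < k then S ⟨(l : ℕ) + 1, h⟩ else Finset.univ) :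
    ((∏ i, X (S i)) * X (S l) : Rd d) -
      (-(∑ T ∈ Finset.univ.filter (fun T : Subs d => Sprev ⊂ T ∧ T ⊂ S l),
            C (((T \ Sprev).card : ℚ) / ((S l \ Sprev).card : ℚ)) * (X T * ∏ i, X (S i)))
        - ∑ T ∈ Finset.univ.filter (fun T : Subs d => S l ⊂ T ∧ T ⊂ Snext),
            C (((Snext \ T).card : ℚ) / ((Snext \ S l).card : ℚ)) * (X T * ∏ i, X (S i)))
      ∈ Itot d := by
  have hp : Sprev ⊂ S l ∧ (Sprev = ∅ ∨ ∃ i, Sprev = S i) := by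
    split_ifs at hprev with h
    · refine ⟨?_, Or.inr ⟨_, hprev⟩⟩
      rw [hprev]
      exact hmono (by simp [Fin.lt_def]; omega)
    · refine ⟨?_, Or.inl hprev⟩
      rw [hprev]
      exact Finset.empty_ssubset.2 (Finset.nonempty_iff_ne_empty.2 (hproper l).1)
  have hn : S l ⊂ Snext ∧ (Snext = Finset.univ ∨ ∃ i, Snext = S i) := by
    split_ifs at hnext with h
    · refine ⟨?_, Or.inr ⟨_, hnext⟩⟩
      rw [hnext]
      exact hmono (by simp [Fin.lt_def])
    · refine ⟨?_, Or.inl hnext⟩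
      rw [hnext]
      exact Finset.ssubset_univ_iff.2 (hproper l).2
  clear hprev hnext hmono
  obtain ⟨hp1, hp2⟩ := hp
  obtain ⟨hn1, hn2⟩ := hn
  set Q : Rd d := ∏ i, X (S i) with hQ
  have hA : (S l \ Sprev).Nonempty := Finset.sdiff_nonempty.2 hp1.2
  have hB : (Snext \ S l).Nonempty := Finset.sdiff_nonempty.2 hn1.2
  have hAc : ((S l \ Sprev).card : ℚ) ≠ 0 := by
    have := hA.card_pos
    positivity
  have hBc : ((Snext \ S l).card : ℚ) ≠ 0 := by
    have := hB.card_pos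
    positivity
  have m0 := Ideal.mul_mem_left _ Q (sub_mem (avg_mem d _ hA 0) (avg_mem d _ hB 0))
  rw [sub_sub_sub_cancel_right, ← Finset.sum_sub_distrib, Finset.mul_sum, Finset.sum_filter] at m0
  refine (Submodule.sub_mem_iff_left _ m0).1 ?_
  have e1 : Q * X (S l) = ∑ T : Subs d, if T = S l then X T * Q else 0 := by
    rw [Finset.sum_ite_eq' Finset.univ (S l)]
    simp [mul_comm]
  rw [e1, Finset.sum_filter, Finset.sum_filter, ← Finset.sum_neg_distrib,
    ← Finset.sum_sub_distrib, ← Finset.sum_sub_distrib, ← Finset.sum_sub_distrib]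
  refine Ideal.sum_mem _ fun T _ => ?_
  have hbig : ∀ (hT : isProper d T), ¬ (X T * Q ∈ Itot d) →
      (T ⊆ S l ∨ S l ⊆ T) ∧ (T ⊆ Sprev ∨ Sprev ⊆ T) ∧ (T ⊆ Snext ∨ Snext ⊆ T) := by
    intro hT hm
    have hc : ∀ i, T ⊆ S i ∨ S i ⊆ T := fun i => by
      by_contra h
      exact hm (incomp_mem d k S hproper T hT i h)
    refine ⟨hc l, ?_, ?_⟩
    · rcases hp2 with h | ⟨i, h⟩
      · simp [h]
      · rw [h]; exact hc i
    · rcases hn2 with h | ⟨i, h⟩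
      · simp [h]
      · rw [h]; exact hc i
  by_cases hT : isProper d T
  swap
  · have n1 : ¬ T = S l := fun h => hT (h ▸ hproper l)
    have n2 : ¬ (Sprev ⊂ T ∧ T ⊂ S l) := fun h => hT
      ⟨fun h0 => by simp [h0] at h, fun h0 => h.2.2 (h0 ▸ Finset.subset_univ _)⟩
    have n3 : ¬ (S l ⊂ T ∧ T ⊂ Snext) := fun h => hT
      ⟨fun h0 => by simp [h0] at h, fun h0 => h.2.2 (h0 ▸ Finset.subset_univ _)⟩
    simp [hT, n1, n2, n3]
  by_cases hm : X T * Q ∈ Itot d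
  · have hz : ∀ q : ℚ, C q * (X T * Q) ∈ Itot d := fun q => Ideal.mul_mem_left _ _ hm
    have hz' : Q * (C (((T ∩ (S l \ Sprev)).card : ℚ) / ((S l \ Sprev).card : ℚ)) * X T -
        C (((T ∩ (Snext \ S l)).card : ℚ) / ((Snext \ S l).card : ℚ)) * X T) ∈ Itot d := by
      convert sub_mem (hz (((T ∩ (S l \ Sprev)).card : ℚ) / ((S l \ Sprev).card : ℚ)))
        (hz (((T ∩ (Snext \ S l)).card : ℚ) / ((Snext \ S l).card : ℚ))) using 1
      ring
    simp only [hT, if_true]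
    have y : ∀ (p : Prop) [Decidable p] (r : Rd d), r ∈ Itot d →
        (if p then r else 0) ∈ Itot d := by
      intro p _ r hr
      split_ifs
      · exact hr
      · exact zero_mem _
    exact Submodule.sub_mem _ (Submodule.sub_mem _ (y _ _ hm)
      (Submodule.sub_mem _ (Submodule.neg_mem _ (y _ _ (hz _))) (y _ _ (hz _)))) hz'
  obtain ⟨c1, c2, c3⟩ := hbig hT hm
  simp only [hT, if_true]
  convert zero_mem (Itot d)
  rcases c1 with c1 | c1
  · have z2 : T ∩ (Snext \ S l) = ∅ := by
      ext x; have := @c1 x; simp; tauto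
    have n3 : ¬ (S l ⊂ T ∧ T ⊂ Snext) := fun h => h.1.2 c1
    by_cases hTl : T = S l
    · subst hTl
      have z1 : S l ∩ (S l \ Sprev) = S l \ Sprev := by
        ext x; simp
      rw [z1, z2]
      simp [div_self hAc]
      ring
    · have ss : T ⊂ S l := lt_of_le_of_ne c1 hTl
      by_cases hs : T ⊆ Sprev
      · have z1 : T ∩ (S l \ Sprev) = ∅ := by
          ext x; have := @hs x; simp; tauto
        have n2 : ¬ (Sprev ⊂ T ∧ T ⊂ S l) := fun h => h.1.2 hs
        simp [z1, z2, n2, n3, hTl]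
      · have hs2 : Sprev ⊂ T := ⟨c2.resolve_left hs, hs⟩
        have z1 : T ∩ (S l \ Sprev) = T \ Sprev := by
          ext x; have := @c1 x; simp; tauto
        rw [z1, z2, if_neg hTl, if_pos ⟨hs2, ss⟩, if_neg n3]
        simp
        ring
  · have z1 : T ∩ (S l \ Sprev) = S l \ Sprev := by
      ext x; have := @c1 x; simp; tauto
    have n2 : ¬ (Sprev ⊂ T ∧ T ⊂ S l) := fun h => h.2.2 c1
    by_cases hTl : T = S l
    · subst hTl
      have z2 : S l ∩ (Snext \ S l) = ∅ := by
        ext x; simp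
      rw [z1, z2]
      simp [div_self hAc]
      ring
    · have ss : S l ⊂ T := lt_of_le_of_ne c1 (Ne.symm hTl)
      by_cases hs : Snext ⊆ T
      · have z2 : T ∩ (Snext \ S l) = Snext \ S l := by
          ext x; have := @hs x; simp; tauto
        have n3 : ¬ (S l ⊂ T ∧ T ⊂ Snext) := fun h => h.2.2 hs
        rw [z1, z2, if_neg hTl, if_neg n2, if_neg n3, div_self hAc, div_self hBc]
        simp
      · have hs2 : T ⊂ Snext := ⟨c3.resolve_right hs, hs⟩
        have hcard : (Snext \ S l).card = (T ∩ (Snext \ S l)).card + (Snext \ T).card := by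
          rw [← Finset.card_inter_add_card_sdiff (Snext \ S l) T, Finset.inter_comm]
          congr 2
          ext x; have := @c1 x; simp; tauto
        have hq : ((Snext \ T).card : ℚ) / ((Snext \ S l).card : ℚ) =
            1 - ((T ∩ (Snext \ S l)).card : ℚ) / ((Snext \ S l).card : ℚ) := by
          rw [eq_sub_iff_add_eq, ← add_div, div_eq_one_iff_eq hBc, hcard]
          push_cast
          ring
        rw [z1, if_neg hTl, if_neg n2, if_pos ⟨ss, hs2⟩, hq, div_self hAc, C_sub]
        simp only [C_1]
        ring
end

section
/- Let d ≥ 1, let S_• = (S_1 ⊊ ⋯ ⊊ S_k) be a k-chain in B̄, and let m_1,…,m_k ≥ 1 be integers. Then in A_d one has ∏_{i=1}^k x_{S_i}^{m_i} = ∑_D Binom(D)·sgn(D)·wt(D)·x_{T_•(D)}, where the sum ranges over all spider diagrams D with head chain S_• whose i-th block has exactly m_i elements for each i = 1,…,k, and where x_{T_•(D)} = ∏_{j=1}^n x_{T_j} is the square-free monomial of the underlying chain T_•(D) = (T_1 ⊊ ⋯ ⊊ T_n), n = m_1+⋯+m_k. -/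
open MvPolynomial

/-- `τ_m = B'_m/m!`, the coefficients of `x/(1-e^{-x})` (with `B'₁ = +1/2`). -/
noncomputable def tau (m : ℕ) : ℚ := bernoulli' m / m.factorial

/-- The Todd polynomial `Td_d = ∏_{S ∈ B̄} (∑_{m=0}^{d} τ_m x_S^m)`. -/
noncomputable def Td (d : ℕ) : Rd d :=
  ∏ S ∈ Finset.univ.filter (fun S : Subs d => isProper d S),
    ∑ m ∈ Finset.range (d + 1), C (tau m) * X S ^ m

/-- A finite set of subsets is a (proper) chain in `B̄` if all its members are
proper and any two of its members are comparable. -/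
def IsProperChain (d : ℕ) (H : Finset (Subs d)) : Prop :=
  (∀ T ∈ H, isProper d T) ∧ ∀ T ∈ H, ∀ T' ∈ H, T ⊆ T' ∨ T' ⊆ T

instance (d : ℕ) (H : Finset (Subs d)) : Decidable (IsProperChain d H) := by
  unfold IsProperChain; infer_instance

/-- The square-free monomial `x_{S_•} = ∏_{T ∈ S_•} x_T` of a chain. -/
noncomputable def chainMon (d : ℕ) (H : Finset (Subs d)) : Rd d := ∏ T ∈ H, X T

/-! ### Spider diagrams

A spider diagram with head chain `S₁ ⊊ ⋯ ⊊ S_k` is encoded as a pair `(Ch, g)`: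
`Ch` is the underlying chain (a finite chain of proper subsets) and
`g : Subs d → Fin (d+2)` assigns to each member of `Ch` the (1-based) number of
the block (spider) containing it, and `0` to everything outside `Ch`.  The
blocks are automatically consecutive nonempty intervals, block `i` containing
the head `S_i`.  The extended head function `Sh : ℕ → Subs d` has `Sh 0 = ∅`,
`Sh j = S_j` for `1 ≤ j ≤ k` and `Sh j = univ` for `j > k` (the extremal
trivial spiders). -/

/-- `(Ch, g)` is a spider diagram with `k` blocks and (extended) head chain `Sh`. -/
def IsDiagram (d k : ℕ) (Sh : ℕ → Subs d) (Ch : Finset (Subs d))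
    (g : Subs d → Fin (d + 2)) : Prop :=
  (∀ T ∈ Ch, isProper d T) ∧
  (∀ T ∈ Ch, ∀ T' ∈ Ch, T ⊆ T' ∨ T' ⊆ T) ∧
  (∀ T, T ∉ Ch → g T = 0) ∧
  (∀ T ∈ Ch, 1 ≤ (g T : ℕ) ∧ (g T : ℕ) ≤ k) ∧
  (∀ T ∈ Ch, ∀ T' ∈ Ch, T ⊆ T' → (g T : ℕ) ≤ (g T' : ℕ)) ∧
  (∀ j ∈ Finset.Icc 1 k, Sh j ∈ Ch ∧ (g (Sh j) : ℕ) = j)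

set_option synthInstance.maxSize 1000 in
instance (d k : ℕ) (Sh : ℕ → Subs d) (Ch : Finset (Subs d)) (g : Subs d → Fin (d + 2)) :
    Decidable (IsDiagram d k Sh Ch g) := by
  unfold IsDiagram; infer_instance

/-- The `j`-th block (spider) of a diagram. -/
def blkF (d : ℕ) (Ch : Finset (Subs d)) (g : Subs d → Fin (d + 2)) (j : ℕ) :
    Finset (Subs d) := Ch.filter (fun T => (g T : ℕ) = j)

/-- The left legs of the `j`-th block: its members strictly below the head `Sh j`. -/
def legsL (d : ℕ) (Sh : ℕ → Subs d) (Ch : Finset (Subs d)) (g : Subs d → Fin (d + 2))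
    (j : ℕ) : Finset (Subs d) := Ch.filter (fun T => (g T : ℕ) = j ∧ T ⊂ Sh j)

/-- The right legs of the `j`-th block: its members strictly above the head `Sh j`. -/
def legsR (d : ℕ) (Sh : ℕ → Subs d) (Ch : Finset (Subs d)) (g : Subs d → Fin (d + 2))
    (j : ℕ) : Finset (Subs d) := Ch.filter (fun T => (g T : ℕ) = j ∧ Sh j ⊂ T)

/-- The internal weight `wt(Sp_j)` of the `j`-th spider:
`(∏_{j'>1} |T^L_{j'}∖T^L_{j'-1}|/|S∖T^L_{j'-1}|)·(∏_{j'>1} |T^R_{j'-1}∖T^R_{j'}|/|T^R_{j'-1}∖S|)`,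
expressed via predecessors/successors inside the leg chains (the predecessor of a
left leg `T` is the largest left leg strictly below `T`, i.e. the `sup` of those legs;
dually for right legs). -/
noncomputable def intwt (d : ℕ) (Sh : ℕ → Subs d) (Ch : Finset (Subs d))
    (g : Subs d → Fin (d + 2)) (j : ℕ) : ℚ :=
  (∏ T ∈ legsL d Sh Ch g j,
    if ((legsL d Sh Ch g j).filter (fun T' => T' ⊂ T)) = ∅ then 1
    else ((T \ ((legsL d Sh Ch g j).filter (fun T' => T' ⊂ T)).sup id).card : ℚ) /
      ((Sh j \ ((legsL d Sh Ch g j).filter (fun T' => T' ⊂ T)).sup id).card : ℚ)) *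
  (∏ T ∈ legsR d Sh Ch g j,
    if ((legsR d Sh Ch g j).filter (fun T' => T ⊂ T')) = ∅ then 1
    else (((((legsR d Sh Ch g j).filter (fun T' => T ⊂ T')).inf id) \ T).card : ℚ) /
      (((((legsR d Sh Ch g j).filter (fun T' => T ⊂ T')).inf id) \ Sh j).card : ℚ))

/-- `T^L_{j,1}`: the smallest left leg of block `j`, or the head `Sh j` if there are
no left legs (for the extremal block `k+1` this is `univ = Sh (k+1)`). -/
noncomputable def fL (d : ℕ) (Sh : ℕ → Subs d) (Ch : Finset (Subs d))
    (g : Subs d → Fin (d + 2)) (j : ℕ) : Subs d :=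
  if legsL d Sh Ch g j = ∅ then Sh j else (legsL d Sh Ch g j).inf id

/-- `T^R_{j,1}`: the largest right leg of block `j`, or the head `Sh j` if there are
no right legs (for the extremal block `0` this is `∅ = Sh 0`). -/
noncomputable def lR (d : ℕ) (Sh : ℕ → Subs d) (Ch : Finset (Subs d))
    (g : Subs d → Fin (d + 2)) (j : ℕ) : Subs d :=
  if legsR d Sh Ch g j = ∅ then Sh j else (legsR d Sh Ch g j).sup id

/-- The boundary weight `bdwt(D) = ∏_{i=1}^{k+1} |T^L_{i,1}∖T^R_{i-1,1}|/|S_i∖S_{i-1}|`. -/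
noncomputable def bdwt (d k : ℕ) (Sh : ℕ → Subs d) (Ch : Finset (Subs d))
    (g : Subs d → Fin (d + 2)) : ℚ :=
  ∏ j ∈ Finset.range (k + 1),
    (((fL d Sh Ch g (j + 1)) \ (lR d Sh Ch g j)).card : ℚ) /
      (((Sh (j + 1)) \ (Sh j)).card : ℚ)

/-- The total weight `wt(D) = bdwt(D)·∏_{i=1}^k wt(Sp_i)`. -/
noncomputable def wtD (d k : ℕ) (Sh : ℕ → Subs d) (Ch : Finset (Subs d))
    (g : Subs d → Fin (d + 2)) : ℚ :=
  bdwt d k Sh Ch g * ∏ j ∈ Finset.range k, intwt d Sh Ch g (j + 1)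

/-- The sign `sgn(D) = (-1)^{n-k}` (`(-1)` to the total number of legs). -/
def sgnD (d k : ℕ) (Ch : Finset (Subs d)) : ℚ := (-1) ^ (Ch.card - k)

/-- The binomial factor `Binom(D) = ∏_{i=1}^k (|I_i|-1)!/(L_i!·R_i!)`. -/
noncomputable def binomD (d k : ℕ) (Sh : ℕ → Subs d) (Ch : Finset (Subs d))
    (g : Subs d → Fin (d + 2)) : ℚ :=
  ∏ j ∈ Finset.range k,
    ((((blkF d Ch g (j + 1)).card - 1).factorial : ℚ)) /
      (((legsL d Sh Ch g (j + 1)).card.factorial : ℚ) *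
        ((legsR d Sh Ch g (j + 1)).card.factorial : ℚ))

/-- The Todd coefficient `Tdcoeff(D) = ∏_{i=1}^k τ_{|I_i|}`. -/
noncomputable def tdcoeffD (d k : ℕ) (Ch : Finset (Subs d))
    (g : Subs d → Fin (d + 2)) : ℚ :=
  ∏ j ∈ Finset.range k, tau (blkF d Ch g (j + 1)).card

/-- The (finite) set of all spider diagrams with `k` blocks and extended head
function `Sh`. -/
noncomputable def diagrams (d k : ℕ) (Sh : ℕ → Subs d) :
    Finset (Finset (Subs d) × (Subs d → Fin (d + 2))) :=
  Finset.univ.filter (fun Dg => IsDiagram d k Sh Dg.1 Dg.2)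

/-- The extension `Ŝ` of a head chain `S : Fin k → Subs d`:
`Ŝ 0 = ∅`, `Ŝ j = S_j` for `1 ≤ j ≤ k`, and `Ŝ j = {1,…,d+1}` for `j > k`. -/
def Shat (d k : ℕ) (S : Fin k → Subs d) (j : ℕ) : Subs d :=
  if h : 1 ≤ j ∧ j ≤ k then S ⟨j - 1, by omega⟩
  else if j = 0 then ∅ else Finset.univ


/-! ### The Chow ring relation -/

noncomputable def phiA (d : ℕ) : Rd d →ₐ[ℚ] (Rd d ⧸ Itot d) := Ideal.Quotient.mkₐ ℚ (Itot d)

lemma phiA_eq_zero {d : ℕ} {p : Rd d} : phiA d p = 0 ↔ p ∈ Itot d := by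
  simp [phiA, Ideal.Quotient.eq_zero_iff_mem]

def pred (d : ℕ) (Ch : Finset (Subs d)) (S : Subs d) : Subs d :=
  (Ch.filter (fun T => T ⊂ S)).sup id

def succS (d : ℕ) (Ch : Finset (Subs d)) (S : Subs d) : Subs d :=
  (Ch.filter (fun T => S ⊂ T)).inf id

lemma sup_mem_chain {d : ℕ} (H : Finset (Subs d)) (hH : H.Nonempty)
    (hc : ∀ T ∈ H, ∀ T' ∈ H, T ⊆ T' ∨ T' ⊆ T) : H.sup id ∈ H := by
  obtain ⟨M, hM, hmax⟩ := H.exists_maximal hH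
  have : H.sup id = M := by
    apply le_antisymm
    · apply Finset.sup_le
      intro T hT
      rcases hc T hT M hM with h | h
      · exact h
      · exact hmax hT h
    · exact Finset.le_sup (f := id) hM
  rw [this]; exact hM

lemma inf_mem_chain {d : ℕ} (H : Finset (Subs d)) (hH : H.Nonempty)
    (hc : ∀ T ∈ H, ∀ T' ∈ H, T ⊆ T' ∨ T' ⊆ T) : H.inf id ∈ H := by
  obtain ⟨M, hM, hmax⟩ := H.exists_minimal hH
  have : H.inf id = M := by
    apply le_antisymm
    · exact Finset.inf_le (f := id) hM
    · apply Finset.le_inf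
      intro T hT
      rcases hc T hT M hM with h | h
      · exact hmax hT h
      · exact h
  rw [this]; exact hM

lemma pred_cases {d : ℕ} (Ch : Finset (Subs d)) (S : Subs d)
    (hc : ∀ T ∈ Ch, ∀ T' ∈ Ch, T ⊆ T' ∨ T' ⊆ T) :
    pred d Ch S = ∅ ∨ (pred d Ch S ∈ Ch ∧ pred d Ch S ⊂ S) := by
  by_cases h : (Ch.filter (fun T => T ⊂ S)).Nonempty
  · right
    have := sup_mem_chain _ h (fun T hT T' hT' =>
      hc T (Finset.mem_filter.1 hT).1 T' (Finset.mem_filter.1 hT').1)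
    exact Finset.mem_filter.1 this
  · left
    rw [Finset.not_nonempty_iff_eq_empty] at h
    rw [pred, h]; rfl

lemma succS_cases {d : ℕ} (Ch : Finset (Subs d)) (S : Subs d)
    (hc : ∀ T ∈ Ch, ∀ T' ∈ Ch, T ⊆ T' ∨ T' ⊆ T) :
    succS d Ch S = Finset.univ ∨ (succS d Ch S ∈ Ch ∧ S ⊂ succS d Ch S) := by
  by_cases h : (Ch.filter (fun T => S ⊂ T)).Nonempty
  · right
    have := inf_mem_chain _ h (fun T hT T' hT' =>
      hc T (Finset.mem_filter.1 hT).1 T' (Finset.mem_filter.1 hT').1)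
    exact Finset.mem_filter.1 this
  · left
    rw [Finset.not_nonempty_iff_eq_empty] at h
    rw [succS, h]; rfl

lemma le_pred {d : ℕ} {Ch : Finset (Subs d)} {S T : Subs d} (hT : T ∈ Ch) (h : T ⊂ S) :
    T ⊆ pred d Ch S :=
  Finset.le_sup (f := id) (Finset.mem_filter.2 ⟨hT, h⟩)

lemma succS_le {d : ℕ} {Ch : Finset (Subs d)} {S T : Subs d} (hT : T ∈ Ch) (h : S ⊂ T) :
    succS d Ch S ⊆ T :=
  Finset.inf_le (f := id) (Finset.mem_filter.2 ⟨hT, h⟩)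

lemma pred_ssubset {d : ℕ} (Ch : Finset (Subs d)) (S : Subs d) (hS : isProper d S)
    (hc : ∀ T ∈ Ch, ∀ T' ∈ Ch, T ⊆ T' ∨ T' ⊆ T) : pred d Ch S ⊂ S := by
  rcases pred_cases Ch S hc with h | h
  · rw [h]; exact Finset.empty_ssubset.2 (Finset.nonempty_iff_ne_empty.2 hS.1)
  · exact h.2

lemma ssubset_succS {d : ℕ} (Ch : Finset (Subs d)) (S : Subs d) (hS : isProper d S)
    (hc : ∀ T ∈ Ch, ∀ T' ∈ Ch, T ⊆ T' ∨ T' ⊆ T) : S ⊂ succS d Ch S := by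
  rcases succS_cases Ch S hc with h | h
  · rw [h]; exact Finset.ssubset_univ_iff.2 hS.2
  · exact h.2

lemma chow_zero {d : ℕ} (Ch : Finset (Subs d)) (hp : ∀ T ∈ Ch, isProper d T)
    (T : Subs d) (hT : isProper d T) (T' : Subs d) (hT' : T' ∈ Ch) (h1 : ¬ T ⊆ T')
    (h2 : ¬ T' ⊆ T) : phiA d (X T * chainMon d Ch) = 0 := by
  rw [phiA_eq_zero]
  apply Ideal.mem_sup_left
  rw [chainMon, ← Finset.mul_prod_erase Ch _ hT', ← mul_assoc]
  apply Ideal.mul_mem_right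
  exact Ideal.subset_span ⟨T, T', hT, hp _ hT', h1, h2, rfl⟩

lemma chow_ell {d : ℕ} (a b : Fin (d + 1)) : phiA d (ell d a) = phiA d (ell d b) := by
  rw [← sub_eq_zero, ← map_sub, phiA_eq_zero]
  exact Ideal.mem_sup_right (Ideal.subset_span ⟨a, b, rfl⟩)

noncomputable def yy (d : ℕ) (Ch : Finset (Subs d)) (T : Subs d) : Rd d ⧸ Itot d :=
  if isProper d T then phiA d (X T * chainMon d Ch) else 0

lemma chow_avg {d : ℕ} (Ch : Finset (Subs d)) (U : Subs d) (hU : U.Nonempty) :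
    ∑ T, (((T ∩ U).card : ℚ) / (U.card : ℚ)) • yy d Ch T =
      phiA d (ell d 0 * chainMon d Ch) := by
  have h0 : (U.card : ℚ) ≠ 0 := by
    have := hU.card_pos
    positivity
  have key : ∀ a, phiA d (ell d a * chainMon d Ch) = ∑ T, if a ∈ T then yy d Ch T else 0 := by
    intro a
    rw [ell, Finset.sum_mul, map_sum, Finset.sum_filter]
    apply Finset.sum_congr rfl
    intro T _
    unfold yy
    by_cases h1 : isProper d T <;> by_cases h2 : a ∈ T <;> simp [h1, h2]
  have h1 : ∑ a ∈ U, phiA d (ell d a * chainMon d Ch) =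
      (U.card : ℚ) • phiA d (ell d 0 * chainMon d Ch) := by
    rw [Finset.sum_congr rfl (g := fun _ => phiA d (ell d 0 * chainMon d Ch))]
    · rw [Finset.sum_const, Nat.cast_smul_eq_nsmul]
    · intro a _
      rw [map_mul, map_mul, chow_ell a 0]
  have h2 : ∑ a ∈ U, phiA d (ell d a * chainMon d Ch) =
      ∑ T, ((T ∩ U).card : ℚ) • yy d Ch T := by
    simp_rw [key]
    rw [Finset.sum_comm]
    apply Finset.sum_congr rfl
    intro T _
    rw [← Finset.sum_filter, Finset.sum_const, Nat.cast_smul_eq_nsmul]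
    congr 2
    ext a; simp [and_comm]
  have h3 : ∑ T, (((T ∩ U).card : ℚ) / (U.card : ℚ)) • yy d Ch T =
      (U.card : ℚ)⁻¹ • ∑ T, ((T ∩ U).card : ℚ) • yy d Ch T := by
    rw [Finset.smul_sum]
    apply Finset.sum_congr rfl
    intro T _
    rw [smul_smul, div_eq_inv_mul]
  rw [h3, ← h2, h1, smul_smul, inv_mul_cancel₀ h0, one_smul]

lemma chow_rel {d : ℕ} (Ch : Finset (Subs d)) (hp : ∀ T ∈ Ch, isProper d T)
    (hc : ∀ T ∈ Ch, ∀ T' ∈ Ch, T ⊆ T' ∨ T' ⊆ T) (S : Subs d) (hS : S ∈ Ch) :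
    phiA d (X S * chainMon d Ch) =
      ∑ T ∈ Finset.univ.filter (fun T => pred d Ch S ⊂ T ∧ T ⊂ S),
        (-(((T \ pred d Ch S).card : ℚ) / ((S \ pred d Ch S).card : ℚ))) •
          phiA d (chainMon d (insert T Ch)) +
      ∑ T ∈ Finset.univ.filter (fun T => S ⊂ T ∧ T ⊂ succS d Ch S),
        (-(((succS d Ch S \ T).card : ℚ) / ((succS d Ch S \ S).card : ℚ))) •
          phiA d (chainMon d (insert T Ch)) := by
  have hPS := pred_ssubset Ch S (hp S hS) hc
  have hSQ := ssubset_succS Ch S (hp S hS) hc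
  have hPc := pred_cases Ch S hc
  have hQc := succS_cases Ch S hc
  have hlP : ∀ T ∈ Ch, T ⊂ S → T ⊆ pred d Ch S := fun T h h' => le_pred h h'
  have hQl : ∀ T ∈ Ch, S ⊂ T → succS d Ch S ⊆ T := fun T h h' => succS_le h h'
  generalize pred d Ch S = P at *
  generalize succS d Ch S = Q at *
  have hU : (S \ P).Nonempty := Finset.sdiff_nonempty.2 hPS.2
  have hV : (Q \ S).Nonempty := Finset.sdiff_nonempty.2 hSQ.2
  have hU0 : ((S \ P).card : ℚ) ≠ 0 := by have := hU.card_pos; positivity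
  have hV0 : ((Q \ S).card : ℚ) ≠ 0 := by have := hV.card_pos; positivity
  have h2 : ∑ T, (((T ∩ (S \ P)).card : ℚ) / ((S \ P).card : ℚ) -
      ((T ∩ (Q \ S)).card : ℚ) / ((Q \ S).card : ℚ)) • yy d Ch T = 0 := by
    simp_rw [sub_smul]
    rw [Finset.sum_sub_distrib, chow_avg Ch _ hU, chow_avg Ch _ hV, sub_self]
  have h3 : ∀ T, (((T ∩ (S \ P)).card : ℚ) / ((S \ P).card : ℚ) -
      ((T ∩ (Q \ S)).card : ℚ) / ((Q \ S).card : ℚ)) • yy d Ch T =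
      (if T = S then yy d Ch S else 0) +
      (if P ⊂ T ∧ T ⊂ S then (((T \ P).card : ℚ) / ((S \ P).card : ℚ)) •
          phiA d (chainMon d (insert T Ch)) else 0) +
      (if S ⊂ T ∧ T ⊂ Q then (((Q \ T).card : ℚ) / ((Q \ S).card : ℚ)) •
          phiA d (chainMon d (insert T Ch)) else 0) := by
    intro T
    by_cases hTS : T = S
    · subst hTS
      have e1 : T ∩ (T \ P) = T \ P := by ext; simp
      have e2 : T ∩ (Q \ T) = ∅ := by ext; simp
      rw [e1, e2, div_self hU0]
      simp
    rw [if_neg hTS]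
    by_cases hA : P ⊂ T ∧ T ⊂ S
    · have hB : ¬ (S ⊂ T ∧ T ⊂ Q) := fun h => hA.2.2 h.1.1
      rw [if_pos hA, if_neg hB, zero_add, add_zero]
      have e1 : T ∩ (S \ P) = T \ P := by
        ext a; simp; intro h; intro; exact hA.2.1 h
      have e2 : T ∩ (Q \ S) = ∅ := by
        ext a; simp; intro h _; exact hA.2.1 h
      have hn : T ∉ Ch := fun h => hA.1.2 (hlP T h hA.2)
      have hpr : isProper d T := by
        refine ⟨?_, ?_⟩
        · rintro rfl; exact Finset.not_ssubset_empty _ hA.1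
        · rintro rfl; exact hA.2.2 (Finset.subset_univ _)
      rw [e1, e2, yy, if_pos hpr, chainMon, chainMon, Finset.prod_insert hn]
      simp
    rw [if_neg hA]
    by_cases hB : S ⊂ T ∧ T ⊂ Q
    · rw [if_pos hB, zero_add, zero_add]
      have e1 : T ∩ (S \ P) = S \ P := by
        ext a; simp; intro h; intro; exact hB.1.1 h
      have e2 : T ∩ (Q \ S) = T \ S := by
        ext a; simp; intro h _; exact hB.2.1 h
      have hn : T ∉ Ch := fun h => hB.2.2 (hQl T h hB.1)
      have hpr : isProper d T := by
        refine ⟨?_, ?_⟩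
        · rintro rfl; exact Finset.not_ssubset_empty _ hB.1
        · rintro rfl; exact hB.2.2 (Finset.subset_univ _)
      rw [e1, e2, yy, if_pos hpr, chainMon, chainMon, Finset.prod_insert hn, div_self hU0]
      congr 1
      have c1 := Finset.card_sdiff_add_card_eq_card hB.1.1
      have c2 := Finset.card_sdiff_add_card_eq_card hB.2.1
      have c3 := Finset.card_sdiff_add_card_eq_card hSQ.1
      have c4 : ((Q \ S).card : ℚ) = (T \ S).card + (Q \ T).card := by
        have : (Q \ S).card = (T \ S).card + (Q \ T).card := by omega
        rw [this]; push_cast; ring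
      field_simp
      rw [c4]; ring
    rw [if_neg hB]
    simp only [add_zero]
    -- now the coefficient or the class is zero
    by_cases hpr : isProper d T
    swap
    · simp [yy, hpr]
    by_cases hcomp : ∀ T' ∈ Ch, T ⊆ T' ∨ T' ⊆ T
    swap
    · push Not at hcomp
      obtain ⟨T', hT', h1, h2⟩ := hcomp
      rw [yy, if_pos hpr, chow_zero Ch hp T hpr T' hT' h1 h2, smul_zero]
    rcases hcomp S hS with h | h
    · have hss : T ⊂ S := lt_of_le_of_ne h hTS
      have hTP : T ⊆ P := by
        have : T ⊆ P ∨ P ⊆ T := by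
          rcases hPc with h' | h'
          · right; rw [h']; simp
          · exact hcomp P h'.1
        rcases this with h' | h'
        · exact h'
        · by_contra hne
          exact hA ⟨⟨h', hne⟩, hss⟩
      have e1 : T ∩ (S \ P) = ∅ := by
        ext a; simp; intro h _; exact hTP h
      have e2 : T ∩ (Q \ S) = ∅ := by
        ext a; simp; intro h' _; exact h h'
      rw [e1, e2]; simp
    · have hss : S ⊂ T := lt_of_le_of_ne h (Ne.symm hTS)
      have hTP : Q ⊆ T := by
        have : T ⊆ Q ∨ Q ⊆ T := by
          rcases hQc with h' | h'
          · left; rw [h']; simp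
          · exact hcomp Q h'.1
        rcases this with h' | h'
        · by_contra hne
          exact hB ⟨hss, ⟨h', hne⟩⟩
        · exact h'
      have e1 : T ∩ (S \ P) = S \ P := by
        ext a; simp; intro h' _; exact h h'
      have e2 : T ∩ (Q \ S) = Q \ S := by
        ext a; simp; intro h' _; exact hTP h'
      rw [e1, e2, div_self hU0, div_self hV0]; simp
  rw [Finset.sum_congr rfl (fun T _ => h3 T), Finset.sum_add_distrib, Finset.sum_add_distrib,
    Finset.sum_ite_eq' Finset.univ S, if_pos (Finset.mem_univ _), ← Finset.sum_filter,
    ← Finset.sum_filter, yy, if_pos (hp S hS)] at h2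
  simp_rw [neg_smul]
  rw [Finset.sum_neg_distrib, Finset.sum_neg_distrib]
  linear_combination h2

/-! ### Diagram combinatorics -/

structure GoodHead (d k : ℕ) (Sh : ℕ → Subs d) : Prop where
  zero : Sh 0 = ∅
  top : Sh (k + 1) = Finset.univ
  strict : ∀ i j, i < j → j ≤ k + 1 → Sh i ⊂ Sh j

section diag

variable {d k : ℕ} {Sh : ℕ → Subs d} {Ch : Finset (Subs d)} {g : Subs d → Fin (d + 2)}

lemma diag_lt (h : IsDiagram d k Sh Ch g) {T T' : Subs d} (hT : T ∈ Ch) (hT' : T' ∈ Ch)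
    (hlt : (g T : ℕ) < (g T' : ℕ)) : T ⊂ T' := by
  obtain ⟨h1, h2, h3, h4, h5, h6⟩ := h
  have hn : ¬ T' ⊆ T := fun hh => by have := h5 T' hT' T hT hh; omega
  rcases h2 T hT T' hT' with hh | hh
  · exact ⟨hh, hn⟩
  · exact absurd hh hn

lemma diag_insert (h : IsDiagram d k Sh Ch g) {T : Subs d} (hT : T ∉ Ch) (hp : isProper d T)
    (hc : ∀ T' ∈ Ch, T' ⊆ T ∨ T ⊆ T') {v : Fin (d + 2)} (hv1 : 1 ≤ (v : ℕ)) (hvk : (v : ℕ) ≤ k)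
    (hm1 : ∀ T' ∈ Ch, T' ⊆ T → (g T' : ℕ) ≤ v) (hm2 : ∀ T' ∈ Ch, T ⊆ T' → (v : ℕ) ≤ g T') :
    IsDiagram d k Sh (insert T Ch) (Function.update g T v) := by
  obtain ⟨h1, h2, h3, h4, h5, h6⟩ := h
  have hne : ∀ T' ∈ Ch, T' ≠ T := fun T' hT' e => hT (e ▸ hT')
  have hu : ∀ T' ∈ Ch, Function.update g T v T' = g T' :=
    fun T' hT' => Function.update_of_ne (hne T' hT') _ _
  refine ⟨?_, ?_, ?_, ?_, ?_, ?_⟩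
  · intro T' hT'
    rcases Finset.mem_insert.1 hT' with rfl | h'
    · exact hp
    · exact h1 _ h'
  · intro A hA B hB
    rcases Finset.mem_insert.1 hA with rfl | hA' <;> rcases Finset.mem_insert.1 hB with rfl | hB'
    · left; exact subset_rfl
    · exact (hc B hB').symm
    · exact hc A hA'
    · exact h2 A hA' B hB'
  · intro A hA
    rw [Finset.mem_insert, not_or] at hA
    rw [Function.update_of_ne hA.1]
    exact h3 A hA.2
  · intro A hA
    rcases Finset.mem_insert.1 hA with rfl | hA'
    · simp [hv1, hvk]
    · rw [hu A hA']; exact h4 A hA'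
  · intro A hA B hB hAB
    rcases Finset.mem_insert.1 hA with rfl | hA' <;> rcases Finset.mem_insert.1 hB with rfl | hB'
    · exact le_rfl
    · rw [hu B hB', Function.update_self]; exact hm2 B hB' hAB
    · rw [hu A hA', Function.update_self]; exact hm1 A hA' hAB
    · rw [hu A hA', hu B hB']; exact h5 A hA' B hB' hAB
  · intro j hj
    obtain ⟨ha, hb⟩ := h6 j hj
    exact ⟨Finset.mem_insert_of_mem ha, by rw [hu _ ha, hb]⟩

lemma diag_erase (h : IsDiagram d k Sh Ch g) {T : Subs d}
    (hne : ∀ j ∈ Finset.Icc 1 k, Sh j ≠ T) :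
    IsDiagram d k Sh (Ch.erase T) (Function.update g T 0) := by
  obtain ⟨h1, h2, h3, h4, h5, h6⟩ := h
  have hu : ∀ T' ∈ Ch.erase T, Function.update g T 0 T' = g T' :=
    fun T' hT' => Function.update_of_ne (Finset.mem_erase.1 hT').1 _ _
  refine ⟨?_, ?_, ?_, ?_, ?_, ?_⟩
  · intro A hA; exact h1 A (Finset.mem_of_mem_erase hA)
  · intro A hA B hB; exact h2 A (Finset.mem_of_mem_erase hA) B (Finset.mem_of_mem_erase hB)
  · intro A hA
    by_cases e : A = T
    · subst e; simp
    · rw [Function.update_of_ne e]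
      exact h3 A (fun hh => hA (Finset.mem_erase.2 ⟨e, hh⟩))
  · intro A hA; rw [hu A hA]; exact h4 A (Finset.mem_of_mem_erase hA)
  · intro A hA B hB; rw [hu A hA, hu B hB]
    exact h5 A (Finset.mem_of_mem_erase hA) B (Finset.mem_of_mem_erase hB)
  · intro j hj
    obtain ⟨ha, hb⟩ := h6 j hj
    have : Sh j ∈ Ch.erase T := Finset.mem_erase.2 ⟨hne j hj, ha⟩
    exact ⟨this, by rw [hu _ this, hb]⟩

lemma filter_insert_update {T : Subs d} (hT : T ∉ Ch) (v : Fin (d + 2)) (j : ℕ)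
    (q : Subs d → Prop) [DecidablePred q] :
    (insert T Ch).filter (fun A => (Function.update g T v A : ℕ) = j ∧ q A) =
      if (v : ℕ) = j ∧ q T then insert T (Ch.filter (fun A => (g A : ℕ) = j ∧ q A))
      else Ch.filter (fun A => (g A : ℕ) = j ∧ q A) := by
  rw [Finset.filter_insert, Function.update_self]
  have : Ch.filter (fun A => (Function.update g T v A : ℕ) = j ∧ q A) =
      Ch.filter (fun A => (g A : ℕ) = j ∧ q A) := by
    apply Finset.filter_congr
    intro A hA
    have hne : A ≠ T := fun e => hT (e ▸ hA)
    rw [Function.update_of_ne hne]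
  rw [this]

lemma legsL_insert {T : Subs d} (hT : T ∉ Ch) (v : Fin (d + 2)) (j : ℕ) :
    legsL d Sh (insert T Ch) (Function.update g T v) j =
      if (v : ℕ) = j ∧ T ⊂ Sh j then insert T (legsL d Sh Ch g j) else legsL d Sh Ch g j :=
  filter_insert_update hT v j (fun A => A ⊂ Sh j)

lemma legsR_insert {T : Subs d} (hT : T ∉ Ch) (v : Fin (d + 2)) (j : ℕ) :
    legsR d Sh (insert T Ch) (Function.update g T v) j =
      if (v : ℕ) = j ∧ Sh j ⊂ T then insert T (legsR d Sh Ch g j) else legsR d Sh Ch g j :=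
  filter_insert_update hT v j (fun A => Sh j ⊂ A)

lemma blkF_insert {T : Subs d} (hT : T ∉ Ch) (v : Fin (d + 2)) (j : ℕ) :
    blkF d (insert T Ch) (Function.update g T v) j =
      if (v : ℕ) = j then insert T (blkF d Ch g j) else blkF d Ch g j := by
  have := filter_insert_update (g := g) hT v j (fun _ => True)
  simpa [blkF] using this

lemma card_blk (h : IsDiagram d k Sh Ch g) {j : ℕ} (hj : j ∈ Finset.Icc 1 k) :
    (blkF d Ch g j).card = (legsL d Sh Ch g j).card + (legsR d Sh Ch g j).card + 1 := by
  obtain ⟨h1, h2, h3, h4, h5, h6⟩ := h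
  obtain ⟨ha, hb⟩ := h6 j hj
  have e : blkF d Ch g j = insert (Sh j) (legsL d Sh Ch g j ∪ legsR d Sh Ch g j) := by
    ext T
    simp only [blkF, legsL, legsR, Finset.mem_filter, Finset.mem_insert, Finset.mem_union]
    constructor
    · rintro ⟨hT, hg⟩
      by_cases e : T = Sh j
      · left; exact e
      · right
        rcases h2 T hT _ ha with hh | hh
        · left; exact ⟨hT, hg, lt_of_le_of_ne hh e⟩
        · right; exact ⟨hT, hg, lt_of_le_of_ne hh (Ne.symm e)⟩
    · rintro (rfl | h | h)
      · exact ⟨ha, hb⟩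
      · exact ⟨h.1, h.2.1⟩
      · exact ⟨h.1, h.2.1⟩
  rw [e, Finset.card_insert_of_notMem, Finset.card_union_of_disjoint]
  · rw [Finset.disjoint_left]
    intro T hT hT'
    simp only [legsL, legsR, Finset.mem_filter] at hT hT'
    exact hT.2.2.2 hT'.2.2.1
  · simp [legsL, legsR]

lemma k_le_card (h : IsDiagram d k Sh Ch g) : k ≤ Ch.card := by
  obtain ⟨h1, h2, h3, h4, h5, h6⟩ := h
  have : (Finset.Icc 1 k).card ≤ Ch.card := by
    apply Finset.card_le_card_of_injOn Sh
    · intro j hj; exact (h6 j hj).1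
    · intro i hi j hj e
      rw [← (h6 i hi).2, ← (h6 j hj).2, e]
  simpa using this

lemma sgn_insert (h : IsDiagram d k Sh Ch g) {T : Subs d} (hT : T ∉ Ch) :
    sgnD d k (insert T Ch) = - sgnD d k Ch := by
  have := k_le_card h
  rw [sgnD, sgnD, Finset.card_insert_of_notMem hT, Nat.sub_add_comm this, pow_succ]
  ring

lemma g_range (h : IsDiagram d k Sh Ch g) {T : Subs d} (hT : T ∈ Ch) :
    1 ≤ (g T : ℕ) ∧ (g T : ℕ) ≤ k := h.2.2.2.1 T hT

lemma legs_out (h : IsDiagram d k Sh Ch g) {j : ℕ} (hj : j ∉ Finset.Icc 1 k) :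
    legsL d Sh Ch g j = ∅ ∧ legsR d Sh Ch g j = ∅ := by
  constructor
  · apply Finset.filter_eq_empty_iff.2
    rintro T hT ⟨hg, -⟩
    have := g_range h hT
    exact hj (Finset.mem_Icc.2 (by omega))
  · apply Finset.filter_eq_empty_iff.2
    rintro T hT ⟨hg, -⟩
    have := g_range h hT
    exact hj (Finset.mem_Icc.2 (by omega))

/-- if block `j` has left legs, the predecessor of the head is the top left leg -/
lemma pred_of_legsL (h : IsDiagram d k Sh Ch g) {j : ℕ} (hj : j ∈ Finset.Icc 1 k)
    (hne : (legsL d Sh Ch g j).Nonempty) :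
    pred d Ch (Sh j) = (legsL d Sh Ch g j).sup id := by
  obtain ⟨L, hL⟩ := hne
  have hL' := Finset.mem_filter.1 hL
  apply le_antisymm
  · apply Finset.sup_le
    intro T hT
    obtain ⟨hT, hTS⟩ := Finset.mem_filter.1 hT
    have hle := h.2.2.2.2.1 T hT _ (h.2.2.2.2.2 j hj).1 hTS.1
    rw [(h.2.2.2.2.2 j hj).2] at hle
    rcases hle.lt_or_eq with hlt | heq
    · have : T ⊂ L := diag_lt h hT hL'.1 (by rw [hL'.2.1]; exact hlt)
      exact this.1.trans (Finset.le_sup (f := id) hL)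
    · exact Finset.le_sup (f := id) (Finset.mem_filter.2 ⟨hT, heq, hTS⟩)
  · apply Finset.sup_mono
    intro T hT
    obtain ⟨hT, _, hTS⟩ := Finset.mem_filter.1 hT
    exact Finset.mem_filter.2 ⟨hT, hTS⟩

lemma succ_of_legsR (h : IsDiagram d k Sh Ch g) {j : ℕ} (hj : j ∈ Finset.Icc 1 k)
    (hne : (legsR d Sh Ch g j).Nonempty) :
    succS d Ch (Sh j) = (legsR d Sh Ch g j).inf id := by
  obtain ⟨L, hL⟩ := hne
  have hL' := Finset.mem_filter.1 hL
  apply le_antisymm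
  · apply Finset.inf_mono
    intro T hT
    obtain ⟨hT, _, hTS⟩ := Finset.mem_filter.1 hT
    exact Finset.mem_filter.2 ⟨hT, hTS⟩
  · apply Finset.le_inf
    intro T hT
    obtain ⟨hT, hTS⟩ := Finset.mem_filter.1 hT
    have hle := h.2.2.2.2.1 _ (h.2.2.2.2.2 j hj).1 T hT hTS.1
    rw [(h.2.2.2.2.2 j hj).2] at hle
    rcases hle.lt_or_eq with hlt | heq
    · have : L ⊂ T := diag_lt h hL'.1 hT (by rw [hL'.2.1]; exact hlt)
      exact le_trans (Finset.inf_le (f := id) hL) this.1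
    · exact Finset.inf_le (f := id) (Finset.mem_filter.2 ⟨hT, heq.symm, hTS⟩)

lemma lR_mem (h : IsDiagram d k Sh Ch g) {j : ℕ} (hj : j ∈ Finset.Icc 1 k) :
    lR d Sh Ch g j ∈ Ch ∧ (g (lR d Sh Ch g j) : ℕ) = j := by
  unfold lR
  split_ifs with he
  · exact h.2.2.2.2.2 j hj
  · have := sup_mem_chain (legsR d Sh Ch g j) (Finset.nonempty_iff_ne_empty.2 he)
      (fun A hA B hB => h.2.1 A (Finset.mem_filter.1 hA).1 B (Finset.mem_filter.1 hB).1)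
    have := Finset.mem_filter.1 this
    exact ⟨this.1, this.2.1⟩

lemma fL_mem (h : IsDiagram d k Sh Ch g) {j : ℕ} (hj : j ∈ Finset.Icc 1 k) :
    fL d Sh Ch g j ∈ Ch ∧ (g (fL d Sh Ch g j) : ℕ) = j := by
  unfold fL
  split_ifs with he
  · exact h.2.2.2.2.2 j hj
  · have := inf_mem_chain (legsL d Sh Ch g j) (Finset.nonempty_iff_ne_empty.2 he)
      (fun A hA B hB => h.2.1 A (Finset.mem_filter.1 hA).1 B (Finset.mem_filter.1 hB).1)
    have := Finset.mem_filter.1 this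
    exact ⟨this.1, this.2.1⟩

lemma le_lR (h : IsDiagram d k Sh Ch g) {j : ℕ} (hj : j ∈ Finset.Icc 1 k) {T : Subs d}
    (hT : T ∈ Ch) (hg : (g T : ℕ) = j) : T ⊆ lR d Sh Ch g j := by
  have hS := h.2.2.2.2.2 j hj
  unfold lR
  split_ifs with he
  · rcases h.2.1 T hT _ hS.1 with hh | hh
    · exact hh
    · by_contra hn
      have : T ∈ legsR d Sh Ch g j := Finset.mem_filter.2 ⟨hT, hg, hh, hn⟩
      rw [he] at this; simp at this
  · by_cases hh : Sh j ⊂ T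
    · exact Finset.le_sup (f := id) (Finset.mem_filter.2 ⟨hT, hg, hh⟩)
    · obtain ⟨L, hL⟩ := Finset.nonempty_iff_ne_empty.2 he
      have hTS : T ⊆ Sh j := by
        rcases h.2.1 T hT _ hS.1 with h' | h'
        · exact h'
        · by_contra hn; exact hh ⟨h', hn⟩
      exact (hTS.trans (Finset.mem_filter.1 hL).2.2.1).trans (Finset.le_sup (f := id) hL)

lemma fL_le (h : IsDiagram d k Sh Ch g) {j : ℕ} (hj : j ∈ Finset.Icc 1 k) {T : Subs d}
    (hT : T ∈ Ch) (hg : (g T : ℕ) = j) : fL d Sh Ch g j ⊆ T := by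
  have hS := h.2.2.2.2.2 j hj
  unfold fL
  split_ifs with he
  · rcases h.2.1 T hT _ hS.1 with hh | hh
    · by_contra hn
      have : T ∈ legsL d Sh Ch g j := Finset.mem_filter.2 ⟨hT, hg, hh, hn⟩
      rw [he] at this; simp at this
    · exact hh
  · by_cases hh : T ⊂ Sh j
    · exact Finset.inf_le (f := id) (Finset.mem_filter.2 ⟨hT, hg, hh⟩)
    · obtain ⟨L, hL⟩ := Finset.nonempty_iff_ne_empty.2 he
      have hTS : Sh j ⊆ T := by
        rcases h.2.1 T hT _ hS.1 with h' | h'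
        · by_contra hn; exact hh ⟨h', hn⟩
        · exact h'
      exact le_trans (Finset.inf_le (f := id) hL) ((Finset.mem_filter.1 hL).2.2.1.trans hTS)

/-- if block `j+1` has no left legs, the predecessor of its head is `lR j` -/
lemma pred_of_no_legsL (hg : GoodHead d k Sh) (h : IsDiagram d k Sh Ch g) {j : ℕ}
    (hj : j + 1 ∈ Finset.Icc 1 k) (he : legsL d Sh Ch g (j + 1) = ∅) :
    pred d Ch (Sh (j + 1)) = lR d Sh Ch g j := by
  have hS := h.2.2.2.2.2 _ hj
  have hlt : ∀ T ∈ Ch, T ⊂ Sh (j + 1) → (g T : ℕ) ≤ j := by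
    intro T hT hTS
    have hle := h.2.2.2.2.1 T hT _ hS.1 hTS.1
    rw [hS.2] at hle
    by_contra hcon
    have : T ∈ legsL d Sh Ch g (j + 1) := Finset.mem_filter.2 ⟨hT, by omega, hTS⟩
    rw [he] at this; simp at this
  by_cases hj0 : j = 0
  · subst hj0
    have e1 : Ch.filter (fun T => T ⊂ Sh (0 + 1)) = ∅ := by
      apply Finset.filter_eq_empty_iff.2
      intro T hT hTS
      have := hlt T hT hTS
      have := g_range h hT
      omega
    rw [pred, e1, lR, if_pos (legs_out h (by simp)).2, hg.zero]
    rfl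
  · have hj' : j ∈ Finset.Icc 1 k := by rw [Finset.mem_Icc] at *; omega
    have hm := lR_mem h hj'
    apply le_antisymm
    · apply Finset.sup_le
      intro T hT
      obtain ⟨hT, hTS⟩ := Finset.mem_filter.1 hT
      rcases (hlt T hT hTS).lt_or_eq with h' | h'
      · exact (diag_lt h hT hm.1 (by rw [hm.2]; exact h')).1
      · exact le_lR h hj' hT h'
    · exact le_pred hm.1 (diag_lt h hm.1 hS.1 (by rw [hm.2, hS.2]; omega))

/-- if block `j` has no right legs, the successor of its head is `fL (j+1)` -/
lemma succ_of_no_legsR (hg : GoodHead d k Sh) (h : IsDiagram d k Sh Ch g) {j : ℕ}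
    (hj : j ∈ Finset.Icc 1 k) (he : legsR d Sh Ch g j = ∅) :
    succS d Ch (Sh j) = fL d Sh Ch g (j + 1) := by
  have hS := h.2.2.2.2.2 _ hj
  have hlt : ∀ T ∈ Ch, Sh j ⊂ T → j + 1 ≤ (g T : ℕ) := by
    intro T hT hTS
    have hle := h.2.2.2.2.1 _ hS.1 T hT hTS.1
    rw [hS.2] at hle
    by_contra hcon
    have : T ∈ legsR d Sh Ch g j := Finset.mem_filter.2 ⟨hT, by omega, hTS⟩
    rw [he] at this; simp at this
  by_cases hj0 : j = k
  · subst hj0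
    have e1 : Ch.filter (fun T => Sh j ⊂ T) = ∅ := by
      apply Finset.filter_eq_empty_iff.2
      intro T hT hTS
      have := hlt T hT hTS
      have := g_range h hT
      omega
    rw [succS, e1, fL, if_pos (legs_out h (by simp)).1, hg.top]
    rfl
  · have hj' : j + 1 ∈ Finset.Icc 1 k := by rw [Finset.mem_Icc] at *; omega
    have hm := fL_mem h hj'
    apply le_antisymm
    · exact succS_le hm.1 (diag_lt h hS.1 hm.1 (by rw [hm.2, hS.2]; omega))
    · apply Finset.le_inf
      intro T hT
      obtain ⟨hT, hTS⟩ := Finset.mem_filter.1 hT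
      rcases (hlt T hT hTS).lt_or_eq with h' | h'
      · exact (diag_lt h hm.1 hT (by rw [hm.2]; exact h')).1
      · exact fL_le h hj' hT h'.symm

end diag

lemma prod_one_factor {ι : Type*} [DecidableEq ι] (s : Finset ι) (j : ι) (hj : j ∈ s)
    (f f' : ι → ℚ) (r : ℚ) (h1 : ∀ i ∈ s, i ≠ j → f i = f' i) (h2 : f j = f' j * r) :
    ∏ i ∈ s, f i = (∏ i ∈ s, f' i) * r := by
  rw [← Finset.mul_prod_erase s f hj, ← Finset.mul_prod_erase s f' hj, h2]
  rw [Finset.prod_congr rfl (g := f')]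
  · ring
  · intro i hi
    exact h1 i (Finset.mem_of_mem_erase hi) (Finset.mem_erase.1 hi).1

section ins

variable {d k : ℕ} {Sh : ℕ → Subs d} {Ch : Finset (Subs d)} {g : Subs d → Fin (d + 2)}

lemma proper_between {A B T : Subs d} (h1 : A ⊂ T) (h2 : T ⊂ B) : isProper d T := by
  refine ⟨?_, ?_⟩
  · rintro rfl; exact Finset.not_ssubset_empty _ h1
  · rintro rfl; exact h2.2 (Finset.subset_univ _)

lemma insL_notMem {S T : Subs d} (h1 : pred d Ch S ⊂ T) (h2 : T ⊂ S) : T ∉ Ch :=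
  fun h => h1.2 (le_pred h h2)

lemma insR_notMem {S T : Subs d} (h1 : S ⊂ T) (h2 : T ⊂ succS d Ch S) : T ∉ Ch :=
  fun h => h2.2 (succS_le h h1)

lemma insL_diag (h : IsDiagram d k Sh Ch g) {j : ℕ} (hj : j ∈ Finset.Icc 1 k) {T : Subs d}
    (h1 : pred d Ch (Sh j) ⊂ T) (h2 : T ⊂ Sh j) :
    IsDiagram d k Sh (insert T Ch) (Function.update g T (g (Sh j))) := by
  have hS := h.2.2.2.2.2 j hj
  have hr := g_range h hS.1
  have key : ∀ T' ∈ Ch, (T' ⊂ T ∧ T' ⊂ Sh j) ∨ (T ⊂ T' ∧ Sh j ⊆ T') := by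
    intro T' hT'
    by_cases hlt : T' ⊂ Sh j
    · left; exact ⟨lt_of_le_of_lt (le_pred hT' hlt) h1, hlt⟩
    · right
      have : Sh j ⊆ T' := by
        rcases h.2.1 T' hT' _ hS.1 with h' | h'
        · by_contra hn; exact hlt ⟨h', hn⟩
        · exact h'
      exact ⟨lt_of_lt_of_le h2 this, this⟩
  refine diag_insert h (insL_notMem h1 h2) (proper_between h1 h2) ?_ hr.1 hr.2 ?_ ?_
  · intro T' hT'
    rcases key T' hT' with h' | h'
    · exact Or.inl h'.1.1
    · exact Or.inr h'.1.1
  · intro T' hT' hs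
    rcases key T' hT' with h' | h'
    · exact h.2.2.2.2.1 T' hT' _ hS.1 h'.2.1
    · exact absurd hs h'.1.2
  · intro T' hT' hs
    rcases key T' hT' with h' | h'
    · exact absurd hs h'.1.2
    · exact h.2.2.2.2.1 _ hS.1 T' hT' h'.2

lemma insR_diag (h : IsDiagram d k Sh Ch g) {j : ℕ} (hj : j ∈ Finset.Icc 1 k) {T : Subs d}
    (h1 : Sh j ⊂ T) (h2 : T ⊂ succS d Ch (Sh j)) :
    IsDiagram d k Sh (insert T Ch) (Function.update g T (g (Sh j))) := by
  have hS := h.2.2.2.2.2 j hj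
  have hr := g_range h hS.1
  have key : ∀ T' ∈ Ch, (T' ⊂ T ∧ T' ⊆ Sh j) ∨ (T ⊂ T' ∧ Sh j ⊂ T') := by
    intro T' hT'
    by_cases hlt : Sh j ⊂ T'
    · right; exact ⟨lt_of_lt_of_le h2 (succS_le hT' hlt), hlt⟩
    · left
      have : T' ⊆ Sh j := by
        rcases h.2.1 T' hT' _ hS.1 with h' | h'
        · exact h'
        · by_contra hn; exact hlt ⟨h', hn⟩
      exact ⟨lt_of_le_of_lt this h1, this⟩
  refine diag_insert h (insR_notMem h1 h2) (proper_between h1 h2) ?_ hr.1 hr.2 ?_ ?_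
  · intro T' hT'
    rcases key T' hT' with h' | h'
    · exact Or.inl h'.1.1
    · exact Or.inr h'.1.1
  · intro T' hT' hs
    rcases key T' hT' with h' | h'
    · exact h.2.2.2.2.1 T' hT' _ hS.1 h'.2
    · exact absurd hs h'.1.2
  · intro T' hT' hs
    rcases key T' hT' with h' | h'
    · exact absurd hs h'.1.2
    · exact h.2.2.2.2.1 _ hS.1 T' hT' h'.2.1

lemma insL_legsL (h : IsDiagram d k Sh Ch g) {j : ℕ} (hj : j ∈ Finset.Icc 1 k) {T : Subs d}
    (h1 : pred d Ch (Sh j) ⊂ T) (h2 : T ⊂ Sh j) (i : ℕ) :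
    legsL d Sh (insert T Ch) (Function.update g T (g (Sh j))) i =
      if i = j then insert T (legsL d Sh Ch g j) else legsL d Sh Ch g i := by
  rw [legsL_insert (insL_notMem h1 h2), (h.2.2.2.2.2 j hj).2]
  by_cases e : i = j
  · subst e; simp [h2]
  · simp [e, Ne.symm e]

lemma insL_legsR (h : IsDiagram d k Sh Ch g) {j : ℕ} (hj : j ∈ Finset.Icc 1 k) {T : Subs d}
    (h1 : pred d Ch (Sh j) ⊂ T) (h2 : T ⊂ Sh j) (i : ℕ) :
    legsR d Sh (insert T Ch) (Function.update g T (g (Sh j))) i = legsR d Sh Ch g i := by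
  rw [legsR_insert (insL_notMem h1 h2), (h.2.2.2.2.2 j hj).2, if_neg]
  rintro ⟨rfl, hh⟩
  exact hh.2 h2.1

lemma insR_legsR (h : IsDiagram d k Sh Ch g) {j : ℕ} (hj : j ∈ Finset.Icc 1 k) {T : Subs d}
    (h1 : Sh j ⊂ T) (h2 : T ⊂ succS d Ch (Sh j)) (i : ℕ) :
    legsR d Sh (insert T Ch) (Function.update g T (g (Sh j))) i =
      if i = j then insert T (legsR d Sh Ch g j) else legsR d Sh Ch g i := by
  rw [legsR_insert (insR_notMem h1 h2), (h.2.2.2.2.2 j hj).2]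
  by_cases e : i = j
  · subst e; simp [h1]
  · simp [e, Ne.symm e]

lemma insR_legsL (h : IsDiagram d k Sh Ch g) {j : ℕ} (hj : j ∈ Finset.Icc 1 k) {T : Subs d}
    (h1 : Sh j ⊂ T) (h2 : T ⊂ succS d Ch (Sh j)) (i : ℕ) :
    legsL d Sh (insert T Ch) (Function.update g T (g (Sh j))) i = legsL d Sh Ch g i := by
  rw [legsL_insert (insR_notMem h1 h2), (h.2.2.2.2.2 j hj).2, if_neg]
  rintro ⟨rfl, hh⟩
  exact hh.2 h1.1

/-- adding a maximum to the left legs -/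
lemma prodL_insert (H : Finset (Subs d)) (S T : Subs d) (hT : ∀ A ∈ H, A ⊂ T) :
    (∏ A ∈ insert T H, if ((insert T H).filter (fun T' => T' ⊂ A)) = ∅ then (1 : ℚ)
      else ((A \ ((insert T H).filter (fun T' => T' ⊂ A)).sup id).card : ℚ) /
        ((S \ ((insert T H).filter (fun T' => T' ⊂ A)).sup id).card : ℚ)) =
    (∏ A ∈ H, if (H.filter (fun T' => T' ⊂ A)) = ∅ then (1 : ℚ)
      else ((A \ (H.filter (fun T' => T' ⊂ A)).sup id).card : ℚ) /
        ((S \ (H.filter (fun T' => T' ⊂ A)).sup id).card : ℚ)) *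
      (if H = ∅ then 1 else ((T \ H.sup id).card : ℚ) / ((S \ H.sup id).card : ℚ)) := by
  have hn : T ∉ H := fun hh => (hT T hh).2 subset_rfl
  have e0 : (insert T H).filter (fun T' => T' ⊂ T) = H := by
    rw [Finset.filter_insert, if_neg (fun hh => hh.2 subset_rfl)]
    exact Finset.filter_true_of_mem hT
  have e1 : ∀ A ∈ H, (insert T H).filter (fun T' => T' ⊂ A) = H.filter (fun T' => T' ⊂ A) := by
    intro A hA
    rw [Finset.filter_insert, if_neg (fun hh => hh.2 (hT A hA).1)]
  rw [Finset.prod_insert hn, e0, mul_comm]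
  congr 1
  apply Finset.prod_congr rfl
  intro A hA
  rw [e1 A hA]

lemma prodR_insert (H : Finset (Subs d)) (S T : Subs d) (hT : ∀ A ∈ H, T ⊂ A) :
    (∏ A ∈ insert T H, if ((insert T H).filter (fun T' => A ⊂ T')) = ∅ then (1 : ℚ)
      else (((((insert T H).filter (fun T' => A ⊂ T')).inf id) \ A).card : ℚ) /
        (((((insert T H).filter (fun T' => A ⊂ T')).inf id) \ S).card : ℚ)) =
    (∏ A ∈ H, if (H.filter (fun T' => A ⊂ T')) = ∅ then (1 : ℚ)
      else ((((H.filter (fun T' => A ⊂ T')).inf id) \ A).card : ℚ) /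
        ((((H.filter (fun T' => A ⊂ T')).inf id) \ S).card : ℚ)) *
      (if H = ∅ then 1 else ((H.inf id \ T).card : ℚ) / ((H.inf id \ S).card : ℚ)) := by
  have hn : T ∉ H := fun hh => (hT T hh).2 subset_rfl
  have e0 : (insert T H).filter (fun T' => T ⊂ T') = H := by
    rw [Finset.filter_insert, if_neg (fun hh => hh.2 subset_rfl)]
    exact Finset.filter_true_of_mem hT
  have e1 : ∀ A ∈ H, (insert T H).filter (fun T' => A ⊂ T') = H.filter (fun T' => A ⊂ T') := by
    intro A hA
    rw [Finset.filter_insert, if_neg (fun hh => hh.2 (hT A hA).1)]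
  rw [Finset.prod_insert hn, e0, mul_comm]
  congr 1
  apply Finset.prod_congr rfl
  intro A hA
  rw [e1 A hA]

lemma legsL_lt_insL {j : ℕ} {T : Subs d} (h1 : pred d Ch (Sh j) ⊂ T) :
    ∀ A ∈ legsL d Sh Ch g j, A ⊂ T := by
  intro A hA
  obtain ⟨hA, _, hAS⟩ := Finset.mem_filter.1 hA
  exact lt_of_le_of_lt (le_pred hA hAS) h1

lemma legsR_lt_insR {j : ℕ} {T : Subs d} (h2 : T ⊂ succS d Ch (Sh j)) :
    ∀ A ∈ legsR d Sh Ch g j, T ⊂ A := by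
  intro A hA
  obtain ⟨hA, _, hAS⟩ := Finset.mem_filter.1 hA
  exact lt_of_lt_of_le h2 (succS_le hA hAS)

lemma card_sdiff_ne {A B : Subs d} (h : A ⊂ B) : ((B \ A).card : ℚ) ≠ 0 := by
  have := (Finset.sdiff_nonempty.2 h.2).card_pos
  positivity

lemma insL_wt (hG : GoodHead d k Sh) (h : IsDiagram d k Sh Ch g) {j : ℕ} (hjk : j < k)
    {T : Subs d} (h1 : pred d Ch (Sh (j + 1)) ⊂ T) (h2 : T ⊂ Sh (j + 1)) :
    wtD d k Sh (insert T Ch) (Function.update g T (g (Sh (j + 1)))) =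
      wtD d k Sh Ch g * (((T \ pred d Ch (Sh (j + 1))).card : ℚ) /
        ((Sh (j + 1) \ pred d Ch (Sh (j + 1))).card : ℚ)) := by
  have hj : j + 1 ∈ Finset.Icc 1 k := by rw [Finset.mem_Icc]; omega
  have hL := insL_legsL h hj h1 h2
  have hR := insL_legsR h hj h1 h2
  have hlt := legsL_lt_insL (g := g) h1
  have hS0 := card_sdiff_ne (h1.trans h2)
  set r : ℚ := (((T \ pred d Ch (Sh (j + 1))).card : ℚ) /
        ((Sh (j + 1) \ pred d Ch (Sh (j + 1))).card : ℚ)) with hr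
  set g' := Function.update g T (g (Sh (j + 1)))
  set Ch' := insert T Ch
  have hlR : ∀ i, lR d Sh Ch' g' i = lR d Sh Ch g i := by
    intro i; simp only [lR, hR]
  have hfL : ∀ i, i ≠ j + 1 → fL d Sh Ch' g' i = fL d Sh Ch g i := by
    intro i hi; simp only [fL, hL, if_neg hi]
  have hb : bdwt d k Sh Ch' g' = bdwt d k Sh Ch g * (if legsL d Sh Ch g (j + 1) = ∅ then r else 1) := by
    unfold bdwt
    apply prod_one_factor _ j (by simp; omega)
    · intro i _ hi
      rw [hlR, hfL (i + 1) (by omega)]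
    · rw [hlR]
      split_ifs with he
      · have e1 : fL d Sh Ch' g' (j + 1) = T := by
          rw [fL, hL, if_pos rfl, he, if_neg (by simp)]; simp
        have e2 : fL d Sh Ch g (j + 1) = Sh (j + 1) := by
          rw [fL, if_pos he]
        rw [e1, e2, hr, ← pred_of_no_legsL hG h hj he]
        field_simp
      · have e1 : fL d Sh Ch' g' (j + 1) = fL d Sh Ch g (j + 1) := by
          rw [fL, fL, hL, if_pos rfl, if_neg he, if_neg (by simp), Finset.inf_insert]
          apply inf_eq_right.2
          obtain ⟨A, hA⟩ := Finset.nonempty_iff_ne_empty.2 he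
          exact le_trans (Finset.inf_le (f := id) hA) (hlt A hA).1
        rw [e1, mul_one]
  have hi : ∏ i ∈ Finset.range k, intwt d Sh Ch' g' (i + 1) =
      (∏ i ∈ Finset.range k, intwt d Sh Ch g (i + 1)) *
        (if legsL d Sh Ch g (j + 1) = ∅ then 1 else r) := by
    apply prod_one_factor _ j (by simp; omega)
    · intro i _ hi
      have hL' := hL (i + 1)
      rw [if_neg (by omega)] at hL'
      rw [intwt, intwt, hL', hR]
    · have hL' := hL (j + 1)
      rw [if_pos rfl] at hL'
      rw [intwt, intwt, hL', hR, prodL_insert _ _ _ hlt]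
      split_ifs with he
      · ring
      · rw [hr, pred_of_legsL h hj (Finset.nonempty_iff_ne_empty.2 he)]
        ring
  rw [wtD, wtD, hb, hi]
  split_ifs <;> ring

lemma insR_wt (hG : GoodHead d k Sh) (h : IsDiagram d k Sh Ch g) {j : ℕ} (hjk : j < k)
    {T : Subs d} (h1 : Sh (j + 1) ⊂ T) (h2 : T ⊂ succS d Ch (Sh (j + 1))) :
    wtD d k Sh (insert T Ch) (Function.update g T (g (Sh (j + 1)))) =
      wtD d k Sh Ch g * (((succS d Ch (Sh (j + 1)) \ T).card : ℚ) /
        ((succS d Ch (Sh (j + 1)) \ Sh (j + 1)).card : ℚ)) := by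
  have hj : j + 1 ∈ Finset.Icc 1 k := by rw [Finset.mem_Icc]; omega
  have hL := insR_legsL h hj h1 h2
  have hR := insR_legsR h hj h1 h2
  have hlt := legsR_lt_insR (g := g) h2
  have hS0 := card_sdiff_ne (h1.trans h2)
  set r : ℚ := (((succS d Ch (Sh (j + 1)) \ T).card : ℚ) /
        ((succS d Ch (Sh (j + 1)) \ Sh (j + 1)).card : ℚ)) with hr
  set g' := Function.update g T (g (Sh (j + 1)))
  set Ch' := insert T Ch
  have hfL : ∀ i, fL d Sh Ch' g' i = fL d Sh Ch g i := by
    intro i; simp only [fL, hL]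
  have hlR : ∀ i, i ≠ j + 1 → lR d Sh Ch' g' i = lR d Sh Ch g i := by
    intro i hi; simp only [lR, hR, if_neg hi]
  have hb : bdwt d k Sh Ch' g' = bdwt d k Sh Ch g * (if legsR d Sh Ch g (j + 1) = ∅ then r else 1) := by
    unfold bdwt
    apply prod_one_factor _ (j + 1) (by simp; omega)
    · intro i _ hi
      rw [hfL, hlR i hi]
    · rw [hfL]
      split_ifs with he
      · have e1 : lR d Sh Ch' g' (j + 1) = T := by
          rw [lR, hR, if_pos rfl, he, if_neg (by simp)]; simp
        have e2 : lR d Sh Ch g (j + 1) = Sh (j + 1) := by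
          rw [lR, if_pos he]
        rw [e1, e2, hr, ← succ_of_no_legsR hG h hj he]
        field_simp
      · have e1 : lR d Sh Ch' g' (j + 1) = lR d Sh Ch g (j + 1) := by
          rw [lR, lR, hR, if_pos rfl, if_neg he, if_neg (by simp), Finset.sup_insert]
          apply sup_eq_right.2
          obtain ⟨A, hA⟩ := Finset.nonempty_iff_ne_empty.2 he
          exact le_trans (hlt A hA).1 (Finset.le_sup (f := id) hA)
        rw [e1, mul_one]
  have hi : ∏ i ∈ Finset.range k, intwt d Sh Ch' g' (i + 1) =
      (∏ i ∈ Finset.range k, intwt d Sh Ch g (i + 1)) *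
        (if legsR d Sh Ch g (j + 1) = ∅ then 1 else r) := by
    apply prod_one_factor _ j (by simp; omega)
    · intro i _ hi
      have hR' := hR (i + 1)
      rw [if_neg (by omega)] at hR'
      rw [intwt, intwt, hR', hL]
    · have hR' := hR (j + 1)
      rw [if_pos rfl] at hR'
      rw [intwt, intwt, hR', hL, prodR_insert _ _ _ hlt]
      split_ifs with he
      · ring
      · rw [hr, succ_of_legsR h hj (Finset.nonempty_iff_ne_empty.2 he)]
        ring
  rw [wtD, wtD, hb, hi]
  split_ifs <;> ring

lemma ins_blk (h : IsDiagram d k Sh Ch g) {j : ℕ} (hj : j ∈ Finset.Icc 1 k) {T : Subs d}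
    (hT : T ∉ Ch) (i : ℕ) :
    (blkF d (insert T Ch) (Function.update g T (g (Sh j))) i).card =
      if i = j then (blkF d Ch g j).card + 1 else (blkF d Ch g i).card := by
  rw [blkF_insert hT, (h.2.2.2.2.2 j hj).2]
  by_cases e : i = j
  · subst e
    rw [if_pos rfl, if_pos rfl, Finset.card_insert_of_notMem]
    exact fun hh => hT (Finset.mem_filter.1 hh).1
  · rw [if_neg (Ne.symm e), if_neg e]

lemma insL_binom (h : IsDiagram d k Sh Ch g) {j : ℕ} (hjk : j < k)
    {T : Subs d} (h1 : pred d Ch (Sh (j + 1)) ⊂ T) (h2 : T ⊂ Sh (j + 1)) :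
    binomD d k Sh (insert T Ch) (Function.update g T (g (Sh (j + 1)))) *
      ((legsL d Sh (insert T Ch) (Function.update g T (g (Sh (j + 1)))) (j + 1)).card /
        (blkF d Ch g (j + 1)).card) = binomD d k Sh Ch g := by
  have hj : j + 1 ∈ Finset.Icc 1 k := by rw [Finset.mem_Icc]; omega
  have hT := insL_notMem h1 h2
  have hL := insL_legsL h hj h1 h2
  have hR := insL_legsR h hj h1 h2
  have hB := ins_blk h hj hT
  have hcb := card_blk h hj
  have hn : T ∉ legsL d Sh Ch g (j + 1) := fun hh => hT (Finset.mem_filter.1 hh).1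
  symm
  unfold binomD
  rw [hL, if_pos rfl, Finset.card_insert_of_notMem hn]
  apply prod_one_factor _ j (by simp; omega)
  · intro i _ hi
    rw [hL, hR, hB, if_neg (by omega), if_neg (by omega)]
  · rw [hL, hR, hB, if_pos rfl, if_pos rfl, Finset.card_insert_of_notMem hn, hcb]
    simp only [Nat.add_sub_cancel, Nat.factorial_succ]
    push_cast
    have p1 : ((legsL d Sh Ch g (j + 1)).card.factorial : ℚ) ≠ 0 := by positivity
    have p2 : ((legsR d Sh Ch g (j + 1)).card.factorial : ℚ) ≠ 0 := by positivity
    have p3 : ((legsL d Sh Ch g (j + 1)).card : ℚ) + (legsR d Sh Ch g (j + 1)).card + 1 ≠ 0 := by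
      positivity
    have p4 : ((legsL d Sh Ch g (j + 1)).card : ℚ) + 1 ≠ 0 := by positivity
    field_simp

lemma insR_binom (h : IsDiagram d k Sh Ch g) {j : ℕ} (hjk : j < k)
    {T : Subs d} (h1 : Sh (j + 1) ⊂ T) (h2 : T ⊂ succS d Ch (Sh (j + 1))) :
    binomD d k Sh (insert T Ch) (Function.update g T (g (Sh (j + 1)))) *
      ((legsR d Sh (insert T Ch) (Function.update g T (g (Sh (j + 1)))) (j + 1)).card /
        (blkF d Ch g (j + 1)).card) = binomD d k Sh Ch g := by
  have hj : j + 1 ∈ Finset.Icc 1 k := by rw [Finset.mem_Icc]; omega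
  have hT := insR_notMem h1 h2
  have hL := insR_legsL h hj h1 h2
  have hR := insR_legsR h hj h1 h2
  have hB := ins_blk h hj hT
  have hcb := card_blk h hj
  have hn : T ∉ legsR d Sh Ch g (j + 1) := fun hh => hT (Finset.mem_filter.1 hh).1
  symm
  unfold binomD
  rw [hR, if_pos rfl, Finset.card_insert_of_notMem hn]
  apply prod_one_factor _ j (by simp; omega)
  · intro i _ hi
    rw [hL, hR, hB, if_neg (by omega), if_neg (by omega)]
  · rw [hL, hR, hB, if_pos rfl, if_pos rfl, Finset.card_insert_of_notMem hn, hcb]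
    simp only [Nat.add_sub_cancel, Nat.factorial_succ]
    push_cast
    have p1 : ((legsL d Sh Ch g (j + 1)).card.factorial : ℚ) ≠ 0 := by positivity
    have p2 : ((legsR d Sh Ch g (j + 1)).card.factorial : ℚ) ≠ 0 := by positivity
    have p3 : ((legsL d Sh Ch g (j + 1)).card : ℚ) + (legsR d Sh Ch g (j + 1)).card + 1 ≠ 0 := by
      positivity
    have p4 : ((legsR d Sh Ch g (j + 1)).card : ℚ) + 1 ≠ 0 := by positivity
    field_simp

end ins

section step

variable {d k : ℕ} {Sh : ℕ → Subs d}

lemma eraseL {Ch : Finset (Subs d)} {g : Subs d → Fin (d + 2)}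
    (h : IsDiagram d k Sh Ch g) {j : ℕ} (hj : j ∈ Finset.Icc 1 k)
    (hne : legsL d Sh Ch g j ≠ ∅) (T : Subs d) (hTd : T = (legsL d Sh Ch g j).sup id) :
    IsDiagram d k Sh (Ch.erase T) (Function.update g T 0) ∧
    pred d (Ch.erase T) (Sh j) ⊂ T ∧ T ⊂ Sh j ∧ insert T (Ch.erase T) = Ch ∧
    Function.update (Function.update g T 0) T ((Function.update g T 0) (Sh j)) = g := by
  have hS := h.2.2.2.2.2 j hj
  have hmem : T ∈ legsL d Sh Ch g j := by
    rw [hTd]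
    exact sup_mem_chain (legsL d Sh Ch g j) (Finset.nonempty_iff_ne_empty.2 hne)
      (fun A hA B hB => h.2.1 A (Finset.mem_filter.1 hA).1 B (Finset.mem_filter.1 hB).1)
  obtain ⟨hT, hgT, hTS⟩ := Finset.mem_filter.1 hmem
  have hheads : ∀ i ∈ Finset.Icc 1 k, Sh i ≠ T := by
    intro i hi e
    have h6 := h.2.2.2.2.2 i hi
    rw [e, hgT] at h6
    have : j = i := h6.2
    subst this
    rw [e] at hTS
    exact hTS.2 subset_rfl
  have hD := diag_erase h hheads
  refine ⟨hD, ?_, hTS, Finset.insert_erase hT, ?_⟩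
  · have hle : pred d (Ch.erase T) (Sh j) ⊆ T := by
      have : pred d (Ch.erase T) (Sh j) ⊆ pred d Ch (Sh j) :=
        Finset.sup_mono (Finset.filter_subset_filter _ (Finset.erase_subset _ _))
      rw [pred_of_legsL h hj (Finset.nonempty_iff_ne_empty.2 hne), ← hTd] at this
      exact this
    refine lt_of_le_of_ne hle ?_
    rcases pred_cases (Ch.erase T) (Sh j) hD.2.1 with h' | h'
    · rw [h']; exact (h.1 T hT).1.symm
    · exact (Finset.mem_erase.1 h'.1).1
  · rw [Function.update_of_ne (hheads j hj), Function.update_idem, Function.update_eq_self_iff]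
    apply Fin.ext
    rw [hgT, hS.2]

lemma eraseR {Ch : Finset (Subs d)} {g : Subs d → Fin (d + 2)}
    (h : IsDiagram d k Sh Ch g) {j : ℕ} (hj : j ∈ Finset.Icc 1 k)
    (hne : legsR d Sh Ch g j ≠ ∅) (T : Subs d) (hTd : T = (legsR d Sh Ch g j).inf id) :
    IsDiagram d k Sh (Ch.erase T) (Function.update g T 0) ∧
    Sh j ⊂ T ∧ T ⊂ succS d (Ch.erase T) (Sh j) ∧ insert T (Ch.erase T) = Ch ∧
    Function.update (Function.update g T 0) T ((Function.update g T 0) (Sh j)) = g := by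
  have hS := h.2.2.2.2.2 j hj
  have hmem : T ∈ legsR d Sh Ch g j := by
    rw [hTd]
    exact inf_mem_chain (legsR d Sh Ch g j) (Finset.nonempty_iff_ne_empty.2 hne)
      (fun A hA B hB => h.2.1 A (Finset.mem_filter.1 hA).1 B (Finset.mem_filter.1 hB).1)
  obtain ⟨hT, hgT, hTS⟩ := Finset.mem_filter.1 hmem
  have hheads : ∀ i ∈ Finset.Icc 1 k, Sh i ≠ T := by
    intro i hi e
    have h6 := h.2.2.2.2.2 i hi
    rw [e, hgT] at h6
    have : j = i := h6.2
    subst this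
    rw [e] at hTS
    exact hTS.2 subset_rfl
  have hD := diag_erase h hheads
  refine ⟨hD, hTS, ?_, Finset.insert_erase hT, ?_⟩
  · have hle : T ⊆ succS d (Ch.erase T) (Sh j) := by
      have : succS d Ch (Sh j) ⊆ succS d (Ch.erase T) (Sh j) :=
        Finset.inf_mono (Finset.filter_subset_filter _ (Finset.erase_subset _ _))
      rw [succ_of_legsR h hj (Finset.nonempty_iff_ne_empty.2 hne), ← hTd] at this
      exact this
    refine lt_of_le_of_ne hle ?_
    rcases succS_cases (Ch.erase T) (Sh j) hD.2.1 with h' | h'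
    · rw [h']; exact (h.1 T hT).2
    · exact (Finset.mem_erase.1 h'.1).1.symm
  · rw [Function.update_of_ne (hheads j hj), Function.update_idem, Function.update_eq_self_iff]
    apply Fin.ext
    rw [hgT, hS.2]

noncomputable def dset (d k : ℕ) (Sh : ℕ → Subs d) (m : Fin k → ℕ) :
    Finset (Finset (Subs d) × (Subs d → Fin (d + 2))) :=
  (diagrams d k Sh).filter (fun Dg => ∀ i : Fin k, (blkF d Dg.1 Dg.2 ((i : ℕ) + 1)).card = m i)

lemma mem_dset {m : Fin k → ℕ} {Dg : Finset (Subs d) × (Subs d → Fin (d + 2))} :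
    Dg ∈ dset d k Sh m ↔ IsDiagram d k Sh Dg.1 Dg.2 ∧
      ∀ i : Fin k, (blkF d Dg.1 Dg.2 ((i : ℕ) + 1)).card = m i := by
  simp [dset, diagrams]

lemma upd_erase {T : Subs d} {Ch : Finset (Subs d)} {g : Subs d → Fin (d + 2)}
    (h : IsDiagram d k Sh Ch g) (hT : T ∉ Ch) (v : Fin (d + 2)) :
    ((insert T Ch).erase T, Function.update (Function.update g T v) T 0) = (Ch, g) := by
  rw [Finset.erase_insert hT, Function.update_idem, Function.update_eq_self_iff.2 (h.2.2.1 T hT).symm]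

lemma ins_dset {m : Fin k → ℕ} {i : Fin k} {T : Subs d} {Ch : Finset (Subs d)}
    {g : Subs d → Fin (d + 2)} (h : IsDiagram d k Sh Ch g) (hT : T ∉ Ch) :
    (∀ a : Fin k, (blkF d Ch g ((a : ℕ) + 1)).card = m a) ↔
    ∀ a : Fin k, (blkF d (insert T Ch) (Function.update g T (g (Sh ((i : ℕ) + 1)))) ((a : ℕ) + 1)).card
      = Function.update m i (m i + 1) a := by
  have hj : (i : ℕ) + 1 ∈ Finset.Icc 1 k := by rw [Finset.mem_Icc]; omega
  apply forall_congr'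
  intro a
  rw [ins_blk h hj hT]
  by_cases e : a = i
  · subst e; simp
  · rw [if_neg (by intro e'; apply e; apply Fin.ext; omega), Function.update_of_ne e]

lemma left_sum (hG : GoodHead d k Sh) (m : Fin k → ℕ) (i : Fin k) :
    ∑ D ∈ dset d k Sh (Function.update m i (m i + 1)),
      (binomD d k Sh D.1 D.2 * ((legsL d Sh D.1 D.2 ((i : ℕ) + 1)).card / (m i : ℚ)) *
        sgnD d k D.1 * wtD d k Sh D.1 D.2) • phiA d (chainMon d D.1) =
    ∑ D ∈ dset d k Sh m, (binomD d k Sh D.1 D.2 * sgnD d k D.1 * wtD d k Sh D.1 D.2) •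
      ∑ T ∈ Finset.univ.filter (fun T => pred d D.1 (Sh ((i : ℕ) + 1)) ⊂ T ∧ T ⊂ Sh ((i : ℕ) + 1)),
        (-(((T \ pred d D.1 (Sh ((i : ℕ) + 1))).card : ℚ) /
          ((Sh ((i : ℕ) + 1) \ pred d D.1 (Sh ((i : ℕ) + 1))).card : ℚ))) •
          phiA d (chainMon d (insert T D.1)) := by
  have hj : (i : ℕ) + 1 ∈ Finset.Icc 1 k := by rw [Finset.mem_Icc]; omega
  simp_rw [Finset.smul_sum]
  rw [Finset.sum_sigma']
  rw [← Finset.sum_filter_of_ne (p := fun D => legsL d Sh D.1 D.2 ((i : ℕ) + 1) ≠ ∅)]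
  swap
  · intro D _ hne he
    apply hne
    rw [he]; simp
  symm
  refine Finset.sum_bij'
    (fun x _ => (insert x.2 x.1.1, Function.update x.1.2 x.2 (x.1.2 (Sh ((i : ℕ) + 1)))))
    (fun D _ => ⟨(D.1.erase ((legsL d Sh D.1 D.2 ((i : ℕ) + 1)).sup id),
      Function.update D.2 ((legsL d Sh D.1 D.2 ((i : ℕ) + 1)).sup id) 0),
      (legsL d Sh D.1 D.2 ((i : ℕ) + 1)).sup id⟩) ?_ ?_ ?_ ?_ ?_
  · rintro ⟨⟨Ch, g⟩, T⟩ hx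
    simp only [Finset.mem_sigma, Finset.mem_filter, Finset.mem_univ, true_and, mem_dset] at hx ⊢
    obtain ⟨⟨hd, hm⟩, h1, h2⟩ := hx
    refine ⟨⟨insL_diag hd hj h1 h2, (ins_dset hd (insL_notMem h1 h2)).1 hm⟩, ?_⟩
    rw [insL_legsL hd hj h1 h2, if_pos rfl]
    simp
  · rintro ⟨Ch, g⟩ hx
    simp only [Finset.mem_sigma, Finset.mem_filter, Finset.mem_univ, true_and, mem_dset] at hx ⊢
    obtain ⟨⟨hd, hm⟩, hne⟩ := hx
    obtain ⟨e1, e2, e3, e4, e5⟩ := eraseL hd hj hne _ rfl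
    refine ⟨⟨e1, (ins_dset (i := i) e1 (Finset.notMem_erase _ _)).2 ?_⟩, e2, e3⟩
    rw [e4, e5]; exact hm
  · rintro ⟨⟨Ch, g⟩, T⟩ hx
    simp only [Finset.mem_sigma, Finset.mem_filter, Finset.mem_univ, true_and, mem_dset] at hx ⊢
    obtain ⟨⟨hd, hm⟩, h1, h2⟩ := hx
    have hsup : (legsL d Sh (insert T Ch) (Function.update g T (g (Sh ((i : ℕ) + 1)))) ((i : ℕ) + 1)).sup id = T := by
      rw [insL_legsL hd hj h1 h2, if_pos rfl, Finset.sup_insert]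
      apply sup_eq_left.2
      apply Finset.sup_le
      intro A hA
      exact (legsL_lt_insL h1 A hA).1
    rw [hsup, upd_erase hd (insL_notMem h1 h2)]
  · rintro ⟨Ch, g⟩ hx
    simp only [Finset.mem_sigma, Finset.mem_filter, Finset.mem_univ, true_and, mem_dset] at hx ⊢
    obtain ⟨⟨hd, hm⟩, hne⟩ := hx
    obtain ⟨e1, e2, e3, e4, e5⟩ := eraseL hd hj hne _ rfl
    rw [e4, e5]
  · rintro ⟨⟨Ch, g⟩, T⟩ hx
    simp only [Finset.mem_sigma, Finset.mem_filter, Finset.mem_univ, true_and, mem_dset] at hx ⊢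
    obtain ⟨⟨hd, hm⟩, h1, h2⟩ := hx
    rw [smul_smul, insL_wt hG hd i.2 h1 h2, sgn_insert hd (insL_notMem h1 h2), ← hm i,
      insL_binom hd i.2 h1 h2]
    congr 1
    ring

lemma right_sum (hG : GoodHead d k Sh) (m : Fin k → ℕ) (i : Fin k) :
    ∑ D ∈ dset d k Sh (Function.update m i (m i + 1)),
      (binomD d k Sh D.1 D.2 * ((legsR d Sh D.1 D.2 ((i : ℕ) + 1)).card / (m i : ℚ)) *
        sgnD d k D.1 * wtD d k Sh D.1 D.2) • phiA d (chainMon d D.1) =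
    ∑ D ∈ dset d k Sh m, (binomD d k Sh D.1 D.2 * sgnD d k D.1 * wtD d k Sh D.1 D.2) •
      ∑ T ∈ Finset.univ.filter (fun T => Sh ((i : ℕ) + 1) ⊂ T ∧ T ⊂ succS d D.1 (Sh ((i : ℕ) + 1))),
        (-(((succS d D.1 (Sh ((i : ℕ) + 1)) \ T).card : ℚ) /
          ((succS d D.1 (Sh ((i : ℕ) + 1)) \ Sh ((i : ℕ) + 1)).card : ℚ))) •
          phiA d (chainMon d (insert T D.1)) := by
  have hj : (i : ℕ) + 1 ∈ Finset.Icc 1 k := by rw [Finset.mem_Icc]; omega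
  simp_rw [Finset.smul_sum]
  rw [Finset.sum_sigma']
  rw [← Finset.sum_filter_of_ne (p := fun D => legsR d Sh D.1 D.2 ((i : ℕ) + 1) ≠ ∅)]
  swap
  · intro D _ hne he
    apply hne
    rw [he]; simp
  symm
  refine Finset.sum_bij'
    (fun x _ => (insert x.2 x.1.1, Function.update x.1.2 x.2 (x.1.2 (Sh ((i : ℕ) + 1)))))
    (fun D _ => ⟨(D.1.erase ((legsR d Sh D.1 D.2 ((i : ℕ) + 1)).inf id),
      Function.update D.2 ((legsR d Sh D.1 D.2 ((i : ℕ) + 1)).inf id) 0),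
      (legsR d Sh D.1 D.2 ((i : ℕ) + 1)).inf id⟩) ?_ ?_ ?_ ?_ ?_
  · rintro ⟨⟨Ch, g⟩, T⟩ hx
    simp only [Finset.mem_sigma, Finset.mem_filter, Finset.mem_univ, true_and, mem_dset] at hx ⊢
    obtain ⟨⟨hd, hm⟩, h1, h2⟩ := hx
    refine ⟨⟨insR_diag hd hj h1 h2, (ins_dset hd (insR_notMem h1 h2)).1 hm⟩, ?_⟩
    rw [insR_legsR hd hj h1 h2, if_pos rfl]
    simp
  · rintro ⟨Ch, g⟩ hx
    simp only [Finset.mem_sigma, Finset.mem_filter, Finset.mem_univ, true_and, mem_dset] at hx ⊢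
    obtain ⟨⟨hd, hm⟩, hne⟩ := hx
    obtain ⟨e1, e2, e3, e4, e5⟩ := eraseR hd hj hne _ rfl
    refine ⟨⟨e1, (ins_dset (i := i) e1 (Finset.notMem_erase _ _)).2 ?_⟩, e2, e3⟩
    rw [e4, e5]; exact hm
  · rintro ⟨⟨Ch, g⟩, T⟩ hx
    simp only [Finset.mem_sigma, Finset.mem_filter, Finset.mem_univ, true_and, mem_dset] at hx ⊢
    obtain ⟨⟨hd, hm⟩, h1, h2⟩ := hx
    have hinf : (legsR d Sh (insert T Ch) (Function.update g T (g (Sh ((i : ℕ) + 1)))) ((i : ℕ) + 1)).inf id = T := by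
      rw [insR_legsR hd hj h1 h2, if_pos rfl, Finset.inf_insert]
      apply inf_eq_left.2
      apply Finset.le_inf
      intro A hA
      exact (legsR_lt_insR h2 A hA).1
    rw [hinf, upd_erase hd (insR_notMem h1 h2)]
  · rintro ⟨Ch, g⟩ hx
    simp only [Finset.mem_sigma, Finset.mem_filter, Finset.mem_univ, true_and, mem_dset] at hx ⊢
    obtain ⟨⟨hd, hm⟩, hne⟩ := hx
    obtain ⟨e1, e2, e3, e4, e5⟩ := eraseR hd hj hne _ rfl
    rw [e4, e5]
  · rintro ⟨⟨Ch, g⟩, T⟩ hx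
    simp only [Finset.mem_sigma, Finset.mem_filter, Finset.mem_univ, true_and, mem_dset] at hx ⊢
    obtain ⟨⟨hd, hm⟩, h1, h2⟩ := hx
    rw [smul_smul, insR_wt hG hd i.2 h1 h2, sgn_insert hd (insR_notMem h1 h2), ← hm i,
      insR_binom hd i.2 h1 h2]
    congr 1
    ring

noncomputable def FF (d k : ℕ) (Sh : ℕ → Subs d) (m : Fin k → ℕ) : Rd d ⧸ Itot d :=
  ∑ D ∈ dset d k Sh m, (binomD d k Sh D.1 D.2 * sgnD d k D.1 * wtD d k Sh D.1 D.2) •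
    phiA d (chainMon d D.1)

lemma FF_step (hG : GoodHead d k Sh) (m : Fin k → ℕ) (i : Fin k) (hm : 1 ≤ m i) :
    FF d k Sh (Function.update m i (m i + 1)) = phiA d (X (Sh ((i : ℕ) + 1))) * FF d k Sh m := by
  have hj : (i : ℕ) + 1 ∈ Finset.Icc 1 k := by rw [Finset.mem_Icc]; omega
  have hR : phiA d (X (Sh ((i : ℕ) + 1))) * FF d k Sh m =
      ∑ D ∈ dset d k Sh m, (binomD d k Sh D.1 D.2 * sgnD d k D.1 * wtD d k Sh D.1 D.2) •
        phiA d (X (Sh ((i : ℕ) + 1)) * chainMon d D.1) := by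
    rw [FF, Finset.mul_sum]
    apply Finset.sum_congr rfl
    intro D _
    rw [map_mul, mul_smul_comm]
  rw [hR, Finset.sum_congr rfl (fun D hD => by
    have h := (mem_dset.1 hD).1
    rw [chow_rel D.1 h.1 h.2.1 _ (h.2.2.2.2.2 _ hj).1, smul_add])]
  rw [Finset.sum_add_distrib, ← left_sum hG, ← right_sum hG, ← Finset.sum_add_distrib, FF]
  apply Finset.sum_congr rfl
  intro D hD
  obtain ⟨hd, hD⟩ := mem_dset.1 hD
  have hc := card_blk hd hj
  rw [hD i, Function.update_self] at hc
  have hc' : ((legsL d Sh D.1 D.2 ((i : ℕ) + 1)).card : ℚ) +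
      ((legsR d Sh D.1 D.2 ((i : ℕ) + 1)).card : ℚ) = m i := by
    have : (legsL d Sh D.1 D.2 ((i : ℕ) + 1)).card + (legsR d Sh D.1 D.2 ((i : ℕ) + 1)).card = m i := by
      omega
    exact_mod_cast this
  have hm0 : (m i : ℚ) ≠ 0 := by positivity
  rw [← add_smul]
  congr 1
  rw [← add_mul, ← add_mul, ← mul_add, ← add_div, hc', div_self hm0, mul_one]

lemma card_head (hG : GoodHead d k Sh) (j : ℕ) (hj : j ≤ k + 1) : j ≤ (Sh j).card := by
  induction j with
  | zero => simp
  | succ n ih =>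
    have := ih (by omega)
    have := Finset.card_lt_card (hG.strict n (n + 1) (by omega) hj)
    omega

lemma head_inj (hG : GoodHead d k Sh) {i j : ℕ} (hi : i ≤ k + 1) (hj : j ≤ k + 1)
    (e : Sh i = Sh j) : i = j := by
  rcases lt_trichotomy i j with h | h | h
  · have := hG.strict i j h hj
    rw [e] at this; exact absurd subset_rfl this.2
  · exact h
  · have := hG.strict j i h hi
    rw [e] at this; exact absurd subset_rfl this.2

open Classical in
noncomputable def g0 (d k : ℕ) (Sh : ℕ → Subs d) (T : Subs d) : Fin (d + 2) :=
  if h : ∃ j ∈ Finset.Icc 1 k, Sh j = T then Fin.ofNat (d + 2) h.choose else 0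

lemma g0_head (hG : GoodHead d k Sh) {j : ℕ} (hj : j ∈ Finset.Icc 1 k) :
    (g0 d k Sh (Sh j) : ℕ) = j := by
  have hex : ∃ i ∈ Finset.Icc 1 k, Sh i = Sh j := ⟨j, hj, rfl⟩
  rw [g0, dif_pos hex]
  have hs := hex.choose_spec
  have hi := Finset.mem_Icc.1 hs.1
  have hj' := Finset.mem_Icc.1 hj
  have e := head_inj hG (by omega) (by omega) hs.2
  rw [e]
  have h1 := card_head hG j (by omega)
  have h2 := Finset.card_le_univ (Sh j)
  simp only [Fintype.card_fin] at h2
  simp only [Fin.ofNat]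
  exact Nat.mod_eq_of_lt (by omega)

lemma dset_one (hG : GoodHead d k Sh) :
    dset d k Sh (fun _ => 1) = {((Finset.Icc 1 k).image Sh, g0 d k Sh)} := by
  ext ⟨Ch, g⟩
  rw [mem_dset, Finset.mem_singleton]
  constructor
  · rintro ⟨h, hb⟩
    simp only at h hb
    have key : ∀ T ∈ Ch, T = Sh (g T) := by
      intro T hT
      have hr := g_range h hT
      have hb' := hb ⟨(g T : ℕ) - 1, by omega⟩
      simp only [Nat.sub_add_cancel hr.1] at hb'
      obtain ⟨A, hA⟩ := Finset.card_eq_one.1 hb'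
      have hS := h.2.2.2.2.2 (g T) (Finset.mem_Icc.2 hr)
      have m1 : T ∈ blkF d Ch g (g T) := Finset.mem_filter.2 ⟨hT, rfl⟩
      have m2 : Sh (g T) ∈ blkF d Ch g (g T) := Finset.mem_filter.2 hS
      rw [hA, Finset.mem_singleton] at m1 m2
      rw [m2, ← m1]
    have hCh : Ch = (Finset.Icc 1 k).image Sh := by
      ext T
      rw [Finset.mem_image]
      constructor
      · intro hT
        exact ⟨g T, Finset.mem_Icc.2 (g_range h hT), (key T hT).symm⟩
      · rintro ⟨j, hj, rfl⟩
        exact (h.2.2.2.2.2 j hj).1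
    have hg : g = g0 d k Sh := by
      funext T
      apply Fin.ext
      by_cases hT : T ∈ Ch
      · rw [hCh, Finset.mem_image] at hT
        obtain ⟨j, hj, rfl⟩ := hT
        rw [g0_head hG hj, (h.2.2.2.2.2 j hj).2]
      · rw [h.2.2.1 T hT, g0, dif_neg]
        rintro ⟨j, hj, rfl⟩
        exact hT (h.2.2.2.2.2 j hj).1
    rw [hCh, hg]
  · intro e
    rw [Prod.mk.injEq] at e
    obtain ⟨rfl, rfl⟩ := e
    simp only
    refine ⟨⟨?_, ?_, ?_, ?_, ?_, ?_⟩, ?_⟩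
    · intro T hT
      obtain ⟨j, hj, rfl⟩ := Finset.mem_image.1 hT
      rw [Finset.mem_Icc] at hj
      exact proper_between (hG.strict (j - 1) j (by omega) (by omega))
        (hG.strict j (j + 1) (by omega) (by omega))
    · intro A hA B hB
      obtain ⟨a, ha, rfl⟩ := Finset.mem_image.1 hA
      obtain ⟨b, hb, rfl⟩ := Finset.mem_image.1 hB
      rw [Finset.mem_Icc] at ha hb
      rcases lt_trichotomy a b with h | h | h
      · exact Or.inl (hG.strict a b h (by omega)).1
      · rw [h]; exact Or.inl subset_rfl
      · exact Or.inr (hG.strict b a h (by omega)).1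
    · intro T hT
      rw [g0, dif_neg]
      rintro ⟨j, hj, rfl⟩
      exact hT (Finset.mem_image_of_mem _ hj)
    · intro T hT
      obtain ⟨j, hj, rfl⟩ := Finset.mem_image.1 hT
      rw [g0_head hG hj]
      exact Finset.mem_Icc.1 hj
    · intro A hA B hB hAB
      obtain ⟨a, ha, rfl⟩ := Finset.mem_image.1 hA
      obtain ⟨b, hb, rfl⟩ := Finset.mem_image.1 hB
      rw [g0_head hG ha, g0_head hG hb]
      rw [Finset.mem_Icc] at ha hb
      by_contra hlt
      exact (hG.strict b a (by omega) (by omega)).2 hAB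
    · intro j hj
      exact ⟨Finset.mem_image_of_mem _ hj, g0_head hG hj⟩
    · intro i
      have hj : (i : ℕ) + 1 ∈ Finset.Icc 1 k := by rw [Finset.mem_Icc]; omega
      rw [Finset.card_eq_one]
      refine ⟨Sh ((i : ℕ) + 1), ?_⟩
      ext T
      rw [blkF, Finset.mem_filter, Finset.mem_singleton]
      constructor
      · rintro ⟨hT, hg⟩
        obtain ⟨j, hj', rfl⟩ := Finset.mem_image.1 hT
        rw [g0_head hG hj'] at hg
        rw [hg]
      · rintro rfl
        exact ⟨Finset.mem_image_of_mem _ hj, g0_head hG hj⟩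

lemma FF_one (hG : GoodHead d k Sh) :
    FF d k Sh (fun _ => 1) = ∏ i : Fin k, phiA d (X (Sh ((i : ℕ) + 1))) := by
  have hmem : ((Finset.Icc 1 k).image Sh, g0 d k Sh) ∈ dset d k Sh (fun _ => 1) := by
    rw [dset_one hG]; simp
  obtain ⟨h, hb⟩ := mem_dset.1 hmem
  rw [FF, dset_one hG, Finset.sum_singleton]
  simp only at h hb ⊢
  have hinj : Set.InjOn Sh (Finset.Icc 1 k : Finset ℕ) := by
    intro a ha b hb e
    rw [Finset.mem_coe, Finset.mem_Icc] at ha hb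
    exact head_inj hG (by omega) (by omega) e
  have hlegs : ∀ j, legsL d Sh ((Finset.Icc 1 k).image Sh) (g0 d k Sh) j = ∅ ∧
      legsR d Sh ((Finset.Icc 1 k).image Sh) (g0 d k Sh) j = ∅ := by
    intro j
    by_cases hj : j ∈ Finset.Icc 1 k
    · have hc := card_blk h hj
      have hj' := Finset.mem_Icc.1 hj
      have hb' := hb ⟨j - 1, by omega⟩
      simp only [Nat.sub_add_cancel hj'.1] at hb'
      rw [hb'] at hc
      exact ⟨Finset.card_eq_zero.1 (by omega), Finset.card_eq_zero.1 (by omega)⟩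
    · exact legs_out h hj
  have hbin : binomD d k Sh ((Finset.Icc 1 k).image Sh) (g0 d k Sh) = 1 := by
    unfold binomD
    apply Finset.prod_eq_one
    intro j hj
    have hb' := hb ⟨j, by simpa using hj⟩
    simp only at hb'
    rw [(hlegs _).1, (hlegs _).2, hb']
    simp
  have hsgn : sgnD d k ((Finset.Icc 1 k).image Sh) = 1 := by
    rw [sgnD, Finset.card_image_of_injOn hinj]; simp
  have hwt : wtD d k Sh ((Finset.Icc 1 k).image Sh) (g0 d k Sh) = 1 := by
    unfold wtD bdwt
    rw [Finset.prod_eq_one, Finset.prod_eq_one, mul_one]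
    · intro j _
      rw [intwt, (hlegs _).1, (hlegs _).2]; simp
    · intro j hj
      rw [fL, lR, if_pos (hlegs _).1, if_pos (hlegs _).2]
      exact div_self (card_sdiff_ne (hG.strict j (j + 1) (by omega)
        (by have := Finset.mem_range.1 hj; omega)))
  rw [hbin, hsgn, hwt, mul_one, mul_one, one_smul, chainMon, Finset.prod_image hinj, map_prod,
    ← Finset.prod_range (fun i => phiA d (X (Sh (i + 1))))]
  symm
  refine Finset.prod_bij (fun i _ => i + 1) ?_ ?_ ?_ ?_
  · intro a ha
    rw [Finset.mem_range] at ha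
    rw [Finset.mem_Icc]; omega
  · intro a _ b _ e
    omega
  · intro b hb
    rw [Finset.mem_Icc] at hb
    exact ⟨b - 1, Finset.mem_range.2 (by omega), by omega⟩
  · intro a _
    rfl

lemma FF_eq (hG : GoodHead d k Sh) (m : Fin k → ℕ) (hm : ∀ i, 1 ≤ m i) :
    FF d k Sh m = ∏ i : Fin k, phiA d (X (Sh ((i : ℕ) + 1))) ^ m i := by
  induction hN : ∑ i, m i using Nat.strong_induction_on generalizing m with
  | _ N ih =>
    by_cases hall : ∀ i, m i = 1
    · have : m = fun _ => 1 := funext hall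
      subst this
      rw [FF_one hG]; simp
    · push Not at hall
      obtain ⟨i, hi⟩ := hall
      have hi2 : 2 ≤ m i := by have := hm i; omega
      set m' := Function.update m i (m i - 1) with hm'
      have e : m = Function.update m' i (m' i + 1) := by
        rw [hm', Function.update_self, Function.update_idem, Nat.sub_add_cancel (hm i),
          Function.update_eq_self]
      have hm1 : ∀ a, 1 ≤ m' a := by
        intro a
        by_cases ha : a = i
        · subst ha; rw [hm', Function.update_self]; omega
        · rw [hm', Function.update_of_ne ha]; exact hm a
      have hlt : ∑ a, m' a < N := by
        rw [← hN]
        apply Finset.sum_lt_sum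
        · intro a _
          by_cases ha : a = i
          · subst ha; rw [hm', Function.update_self]; omega
          · rw [hm', Function.update_of_ne ha]
        · exact ⟨i, Finset.mem_univ _, by rw [hm', Function.update_self]; omega⟩
      have := ih _ hlt m' hm1 rfl
      rw [e, FF_step hG m' i (hm1 i), this]
      rw [← Finset.mul_prod_erase _ _ (Finset.mem_univ i),
        ← Finset.mul_prod_erase _ _ (Finset.mem_univ i), Function.update_self, pow_succ]
      rw [Finset.prod_congr rfl (g := fun a : Fin k => phiA d (X (Sh ((a : ℕ) + 1))) ^
        (Function.update m' i (m' i + 1) a))]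
      · ring
      · intro a ha
        rw [Function.update_of_ne (Finset.mem_erase.1 ha).1]

end step

lemma Shat_succ {d k : ℕ} (S : Fin k → Subs d) (i : Fin k) : Shat d k S ((i : ℕ) + 1) = S i := by
  rw [Shat, dif_pos (by omega)]
  simp

lemma Shat_good {d k : ℕ} (S : Fin k → Subs d) (hproper : ∀ i, isProper d (S i))
    (hmono : StrictMono S) : GoodHead d k (Shat d k S) := by
  refine ⟨by simp [Shat], by simp [Shat], ?_⟩
  intro i j hij hj
  have hmid : ∀ a, (_ : 1 ≤ a) → (_ : a ≤ k) → Shat d k S a = S ⟨a - 1, by omega⟩ := by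
    intro a h1 h2
    rw [Shat, dif_pos ⟨h1, h2⟩]
  have h0 : Shat d k S 0 = ∅ := by simp [Shat]
  have ht : Shat d k S (k + 1) = Finset.univ := by simp [Shat]
  by_cases hi0 : i = 0
  · subst hi0
    rw [h0, Finset.empty_ssubset, Finset.nonempty_iff_ne_empty]
    by_cases hjk : j ≤ k
    · rw [hmid j (by omega) hjk]; exact (hproper _).1
    · have : j = k + 1 := by omega
      rw [this, ht]
      exact Finset.univ_nonempty.ne_empty
  · rw [hmid i (by omega) (by omega)]
    by_cases hjk : j ≤ k
    · rw [hmid j (by omega) hjk]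
      apply hmono
      rw [Fin.lt_def]
      simp only
      omega
    · have : j = k + 1 := by omega
      subst this
      rw [ht]
      exact Finset.ssubset_univ_iff.2 (hproper _).2

/-- Proposition `prop:expanding`: for a chain `S₁ ⊊ ⋯ ⊊ S_k` in `B̄`
and exponents `m_i ≥ 1`, in `A_d`:
`∏_i x_{S_i}^{m_i} = ∑_D Binom(D)·sgn(D)·wt(D)·x_{T_•(D)}`,
the sum over all spider diagrams `D` with head chain `S_•` whose `i`-th block has
exactly `m_i` elements, `x_{T_•(D)}` being the square-free monomial of the underlying
chain of `D`. -/
theorem stmt2 (d k : ℕ) (hd : 1 ≤ d)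
    (S : Fin k → Subs d) (hproper : ∀ i, isProper d (S i)) (hmono : StrictMono S)
    (m : Fin k → ℕ) (hm : ∀ i, 1 ≤ m i) :
    (∏ i, X (S i) ^ m i : Rd d) -
      ∑ Dg ∈ (diagrams d k (Shat d k S)).filter
          (fun Dg => ∀ i : Fin k, (blkF d Dg.1 Dg.2 ((i : ℕ) + 1)).card = m i),
        C (binomD d k (Shat d k S) Dg.1 Dg.2 * sgnD d k Dg.1 *
            wtD d k (Shat d k S) Dg.1 Dg.2) * chainMon d Dg.1
      ∈ Itot d := by
  have hG := Shat_good S hproper hmono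
  rw [← phiA_eq_zero, map_sub, sub_eq_zero, map_prod, map_sum]
  have := FF_eq hG m hm
  rw [FF, dset] at this
  simp_rw [Shat_succ] at this
  simp_rw [map_pow]
  rw [← this]
  apply Finset.sum_congr rfl
  intro D _
  rw [← smul_eq_C_mul, map_smul]
end

section
/- Let d ≥ 1, and let r and r' be two functions assigning a rational number to each chain in B̄ (including the empty chain), both symmetric in the sense that their value on a chain (S_1,…,S_k) depends only on the sequence of cardinalities (|S_1|,…,|S_k|). If ∑_{S_•} r(S_•)·x_{S_•} and ∑_{S_•} r'(S_•)·x_{S_•} (sums over all chains S_• in B̄) are both congruent to the Todd polynomial Td_d modulo I_1 + I_2, then r = r'. In other words, the Todd class of the permutohedral variety has a unique symmetric square-free representation in A_d. -/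
open MvPolynomial

section PermAux

/-- prefix of size `k` of the permutation -/
def Pf (d : ℕ) (σ : Equiv.Perm (Fin (d+1))) (k : ℕ) : Subs d :=
  Finset.univ.filter (fun a => (σ.symm a : ℕ) < k)

noncomputable def fw (d : ℕ) (σ : Equiv.Perm (Fin (d+1))) (k : ℕ) : ℚ :=
  if h : k < d + 1 then ((σ ⟨k, h⟩ : ℕ) : ℚ) else 0

noncomputable def wt (d : ℕ) (σ : Equiv.Perm (Fin (d+1))) (k : ℕ) : ℚ :=
  fw d σ (k-1) - fw d σ k

noncomputable def vv (d : ℕ) (σ : Equiv.Perm (Fin (d+1))) (S : Subs d) : ℚ :=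
  if isProper d S ∧ S = Pf d σ S.card then wt d σ S.card else 0

noncomputable def Wt (d : ℕ) (σ : Equiv.Perm (Fin (d+1))) : ℚ :=
  ∏ k ∈ Finset.Icc 1 d, wt d σ k

noncomputable def Phi (d : ℕ) (H : Finset (Subs d)) (e : Multiset (Subs d)) : ℚ :=
  ∑ σ : Equiv.Perm (Fin (d+1)), (∏ T ∈ H, vv d σ T) * (e.map (vv d σ)).prod / Wt d σ

theorem proper_card {d : ℕ} {S : Subs d} : isProper d S ↔ S.card ∈ Finset.Icc 1 d := by
  unfold isProper
  rw [Finset.mem_Icc, ← Finset.nonempty_iff_ne_empty, ← Finset.card_pos, Ne,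
    ← Finset.card_eq_iff_eq_univ, Fintype.card_fin]
  have := Finset.card_le_univ S
  rw [Fintype.card_fin] at this
  omega

theorem card_Pf {d : ℕ} (σ : Equiv.Perm (Fin (d+1))) {k : ℕ} (hk : k ≤ d + 1) :
    (Pf d σ k).card = k := by
  have : Pf d σ k = (Finset.univ.filter (fun i : Fin (d+1) => (i : ℕ) < k)).map σ.toEmbedding := by
    ext a
    simp [Pf, Finset.mem_map_equiv]
  rw [this, Finset.card_map, Fin.card_filter_val_lt]
  omega

theorem wt_ne {d : ℕ} (σ : Equiv.Perm (Fin (d+1))) {k : ℕ} (hk : k ∈ Finset.Icc 1 d) :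
    wt d σ k ≠ 0 := by
  rw [Finset.mem_Icc] at hk
  unfold wt fw
  rw [dif_pos (by omega), dif_pos (by omega), sub_ne_zero]
  intro h
  have h2 : ((σ ⟨k-1, by omega⟩ : ℕ)) = (σ ⟨k, by omega⟩ : ℕ) := by exact_mod_cast h
  have h3 := σ.injective (Fin.ext h2)
  rw [Fin.mk.injEq] at h3
  omega

theorem Wt_ne {d : ℕ} (σ : Equiv.Perm (Fin (d+1))) : Wt d σ ≠ 0 :=
  Finset.prod_ne_zero_iff.2 fun _ hk => wt_ne σ hk

theorem sum_card_vv {d : ℕ} (σ : Equiv.Perm (Fin (d+1))) {k : ℕ} (hk : k ∈ Finset.Icc 1 d)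
    (g : Subs d → ℚ) :
    ∑ S ∈ Finset.univ.filter (fun S : Subs d => S.card = k), g S * vv d σ S
      = g (Pf d σ k) * wt d σ k := by
  have hk' := Finset.mem_Icc.1 hk
  have hc := card_Pf σ (k := k) (by omega)
  rw [Finset.sum_eq_single_of_mem (Pf d σ k) (by simp [hc])]
  · congr 1
    unfold vv
    rw [if_pos, hc]
    rw [proper_card, hc]
    exact ⟨hk, rfl⟩
  · intro S hS hne
    rw [Finset.mem_filter] at hS
    unfold vv
    rw [if_neg, mul_zero]
    rintro ⟨_, h⟩
    rw [hS.2] at h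
    exact hne h

theorem sum_all_vv {d : ℕ} (σ : Equiv.Perm (Fin (d+1))) (g : Subs d → ℚ) :
    ∑ S : Subs d, g S * vv d σ S = ∑ k ∈ Finset.Icc 1 d, g (Pf d σ k) * wt d σ k := by
  rw [← Finset.sum_congr rfl (fun k hk => sum_card_vv σ hk g)]
  rw [Finset.sum_fiberwise_eq_sum_filter]
  symm
  apply Finset.sum_subset (Finset.subset_univ _)
  intro S _ hS
  have : ¬ isProper d S := by
    rw [proper_card]
    simpa using hS
  unfold vv
  rw [if_neg (fun h => this h.1), mul_zero]

theorem tele {d : ℕ} (σ : Equiv.Perm (Fin (d+1))) (p : ℕ) (hp : p ≤ d) :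
    ∑ k ∈ Finset.Icc 1 d, (if p < k then (1:ℚ) else 0) * wt d σ k = fw d σ p - fw d σ d := by
  have : ∀ m, p ≤ m → ∑ k ∈ Finset.Icc 1 m, (if p < k then (1:ℚ) else 0) * wt d σ k
      = fw d σ p - fw d σ m := by
    intro m hm
    induction m, hm using Nat.le_induction with
    | base =>
      rw [sub_self]
      apply Finset.sum_eq_zero
      intro k hk
      rw [Finset.mem_Icc] at hk
      rw [if_neg (by omega), zero_mul]
    | succ m hm ih =>
      rw [Finset.sum_Icc_succ_top (by omega), ih, if_pos (by omega)]
      unfold wt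
      rw [Nat.add_sub_cancel]
      ring
  exact this d hp

noncomputable def ind {d : ℕ} (a b : Fin (d+1)) (T : Subs d) : ℚ :=
  (if a ∈ T then 1 else 0) - (if b ∈ T then 1 else 0)

theorem sum_a_vv {d : ℕ} (σ : Equiv.Perm (Fin (d+1))) (a : Fin (d+1)) :
    ∑ S : Subs d, (if a ∈ S then (1:ℚ) else 0) * vv d σ S = ((a : ℕ) : ℚ) - fw d σ d := by
  rw [sum_all_vv]
  have := tele σ (σ.symm a : ℕ) (by have := (σ.symm a).2; omega)
  simp only [Pf, Finset.mem_filter, Finset.mem_univ, true_and]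
  rw [this]
  congr 1
  unfold fw
  rw [dif_pos (σ.symm a).2]
  simp

theorem sum_ind_vv {d : ℕ} (σ : Equiv.Perm (Fin (d+1))) (a b : Fin (d+1)) :
    ∑ S : Subs d, ind a b S * vv d σ S = ((a : ℕ) : ℚ) - ((b:ℕ):ℚ) := by
  simp only [ind, sub_mul, Finset.sum_sub_distrib, sum_a_vv]
  ring

theorem Phi_rel {d : ℕ} (a b : Fin (d+1)) (H : Finset (Subs d)) (e : Multiset (Subs d)) :
    (((a : ℕ) : ℚ) - ((b:ℕ):ℚ)) * Phi d H e = ∑ T : Subs d, ind a b T * Phi d H (T ::ₘ e) := by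
  unfold Phi
  simp only [Finset.mul_sum]
  rw [Finset.sum_comm]
  apply Finset.sum_congr rfl
  intro σ _
  rw [← sum_ind_vv σ a b, Finset.sum_mul]
  apply Finset.sum_congr rfl
  intro T _
  rw [Multiset.map_cons, Multiset.prod_cons]
  ring

theorem Phi_insert {d : ℕ} (H : Finset (Subs d)) (e : Multiset (Subs d)) (T : Subs d)
    (hT : T ∉ H) : Phi d H (T ::ₘ e) = Phi d (insert T H) e := by
  unfold Phi
  apply Finset.sum_congr rfl
  intro σ _
  rw [Multiset.map_cons, Multiset.prod_cons, Finset.prod_insert hT]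
  ring

theorem vv_ne {d : ℕ} {σ : Equiv.Perm (Fin (d+1))} {S : Subs d} (h : vv d σ S ≠ 0) :
    isProper d S ∧ S = Pf d σ S.card := by
  unfold vv at h
  by_contra h2
  rw [if_neg h2] at h
  exact h rfl

theorem Pf_mono {d : ℕ} (σ : Equiv.Perm (Fin (d+1))) {j k : ℕ} (h : j ≤ k) :
    Pf d σ j ⊆ Pf d σ k := by
  intro a
  simp only [Pf, Finset.mem_filter, Finset.mem_univ, true_and]
  omega

theorem vv_comp {d : ℕ} {σ : Equiv.Perm (Fin (d+1))} {S T : Subs d} (h : vv d σ S ≠ 0)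
    (h' : vv d σ T ≠ 0) : S ⊆ T ∨ T ⊆ S := by
  have h1 := (vv_ne h).2
  have h2 := (vv_ne h').2
  rw [h1, h2]
  rcases le_total S.card T.card with h | h
  · exact Or.inl (Pf_mono σ h)
  · exact Or.inr (Pf_mono σ h)

theorem prod_chain {d : ℕ} {σ : Equiv.Perm (Fin (d+1))} {H : Finset (Subs d)}
    (h : ∏ T ∈ H, vv d σ T ≠ 0) : IsProperChain d H := by
  rw [Finset.prod_ne_zero_iff] at h
  exact ⟨fun T hT => (vv_ne (h T hT)).1, fun T hT T' hT' => vv_comp (h T hT) (h T' hT')⟩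

theorem Phi_nonchain {d : ℕ} {H : Finset (Subs d)} (e : Multiset (Subs d))
    (h : ¬ IsProperChain d H) : Phi d H e = 0 := by
  unfold Phi
  apply Finset.sum_eq_zero
  intro σ _
  have : ∏ T ∈ H, vv d σ T = 0 := by
    by_contra h2
    exact h (prod_chain h2)
  rw [this]; simp

theorem prodH {d : ℕ} {σ : Equiv.Perm (Fin (d+1))} {H : Finset (Subs d)}
    (h : ∀ T ∈ H, isProper d T ∧ T = Pf d σ T.card) :
    ∏ T ∈ H, vv d σ T = ∏ k ∈ H.image Finset.card, wt d σ k := by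
  rw [Finset.prod_image]
  · apply Finset.prod_congr rfl
    intro T hT
    unfold vv
    rw [if_pos (h T hT)]
  · intro T hT T' hT' hc
    rw [(h T hT).2, (h T' hT').2, hc]

theorem prodH_zero {d : ℕ} {σ : Equiv.Perm (Fin (d+1))} {H : Finset (Subs d)}
    (h : ¬ ∀ T ∈ H, isProper d T ∧ T = Pf d σ T.card) :
    ∏ T ∈ H, vv d σ T = 0 := by
  by_contra h2
  rw [← Ne, Finset.prod_ne_zero_iff] at h2
  exact h fun T hT => vv_ne (h2 T hT)

theorem image_card_sub {d : ℕ} {H : Finset (Subs d)} (h : ∀ T ∈ H, isProper d T) :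
    H.image Finset.card ⊆ Finset.Icc 1 d := by
  intro k hk
  rw [Finset.mem_image] at hk
  obtain ⟨T, hT, rfl⟩ := hk
  exact proper_card.1 (h T hT)

theorem Phi_top {d : ℕ} {H : Finset (Subs d)} (hH : H.card = d) :
    Phi d H 0 = ∑ σ : Equiv.Perm (Fin (d+1)),
      if ∀ T ∈ H, isProper d T ∧ T = Pf d σ T.card then 1 else 0 := by
  unfold Phi
  apply Finset.sum_congr rfl
  intro σ _
  rw [Multiset.map_zero, Multiset.prod_zero, mul_one]
  split_ifs with h
  · rw [prodH h]
    have : H.image Finset.card = Finset.Icc 1 d := by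
      apply Finset.eq_of_subset_of_card_le (image_card_sub fun T hT => (h T hT).1)
      rw [Nat.card_Icc, Finset.card_image_of_injOn, hH]
      · omega
      · intro T hT T' hT' hc
        rw [(h T hT).2, (h T' hT').2, hc]
    rw [this]
    exact div_self (Wt_ne σ)
  · rw [prodH_zero h, zero_div]

theorem Pf_mul {d : ℕ} (s σ : Equiv.Perm (Fin (d+1))) (k : ℕ) :
    Pf d (s * σ) k = (Pf d σ k).map s.toEmbedding := by
  ext a
  rw [Finset.mem_map_equiv]
  simp only [Pf, Finset.mem_filter, Finset.mem_univ, true_and]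
  rfl

theorem Phi_top_perm {d : ℕ} {H : Finset (Subs d)} (hH : H.card = d)
    (s : Equiv.Perm (Fin (d+1))) :
    Phi d (H.image (fun T => T.map s.toEmbedding)) 0 = Phi d H 0 := by
  have hinj : Function.Injective (fun T : Subs d => T.map s.toEmbedding) :=
    Finset.map_injective _
  rw [Phi_top hH, Phi_top (by rw [Finset.card_image_of_injective _ hinj, hH])]
  rw [← (Equiv.mulLeft s).sum_comp]
  apply Finset.sum_congr rfl
  intro σ _
  congr 1
  simp only [Finset.forall_mem_image, Finset.card_map, proper_card, Equiv.coe_mulLeft, Pf_mul,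
    hinj.eq_iff]
  simp

theorem exists_pair {d : ℕ} {H : Finset (Subs d)} (hH : IsProperChain d H) (hc : H.card < d) :
    ∃ a b : Fin (d+1), a ≠ b ∧ ∀ T ∈ H, (a ∈ T ↔ b ∈ T) := by
  obtain ⟨a, -, b, -, hab, heq⟩ := Finset.exists_ne_map_eq_of_card_lt_of_maps_to
    (s := (Finset.univ : Finset (Fin (d+1)))) (t := Finset.range (H.card + 1))
    (f := fun a => (H.filter (fun T => a ∈ T)).card) (by simp; omega)
    (by
      intro a _
      simp only [Finset.coe_range, Set.mem_Iio]
      exact Nat.lt_succ_of_le (Finset.card_filter_le _ _))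
  refine ⟨a, b, hab, ?_⟩
  have key : H.filter (fun T => a ∈ T) = H.filter (fun T => b ∈ T) := by
    by_cases h : H.filter (fun T => a ∈ T) ⊆ H.filter (fun T => b ∈ T)
    · exact Finset.eq_of_subset_of_card_le h heq.ge
    · symm
      apply Finset.eq_of_subset_of_card_le _ heq.le
      rw [Finset.not_subset] at h
      obtain ⟨T, hT, hT'⟩ := h
      simp only [Finset.mem_filter, not_and] at hT hT'
      intro T' h'
      simp only [Finset.mem_filter] at h' ⊢
      refine ⟨h'.1, ?_⟩
      rcases hH.2 T hT.1 T' h'.1 with h | h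
      · exact h hT.2
      · exact absurd (h h'.2) (hT' hT.1)
  intro T hT
  have := Finset.ext_iff.1 key T
  simpa [hT] using this

theorem exists_low {d : ℕ} {H : Finset (Subs d)} (hH : IsProperChain d H) {S : Subs d}
    (hS : S ∈ H) : ∃ a ∈ S, ∀ T ∈ H, a ∈ T → S ⊆ T := by
  have hne : S.Nonempty := Finset.nonempty_iff_ne_empty.2 (hH.1 S hS).1
  obtain ⟨a, haS, hmin⟩ := Finset.exists_min_image S
    (fun a => (H.filter (fun T => a ∈ T)).card) hne
  refine ⟨a, haS, fun T hT haT x hxS => ?_⟩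
  by_contra hxT
  have := hmin x hxS
  apply absurd this
  rw [not_le]
  apply Finset.card_lt_card
  rw [Finset.ssubset_iff_of_subset]
  · exact ⟨T, by simp [hT, haT], by simp [hxT]⟩
  · intro T' h'
    simp only [Finset.mem_filter] at h' ⊢
    refine ⟨h'.1, ?_⟩
    rcases hH.2 T hT T' h'.1 with h | h
    · exact h haT
    · exact absurd (h h'.2) hxT

theorem exists_high {d : ℕ} {H : Finset (Subs d)} (hH : IsProperChain d H) {S : Subs d}
    (hS : S ∈ H) : ∃ b, b ∉ S ∧ ∀ T ∈ H, b ∉ T → T ⊆ S := by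
  have hne : (Sᶜ).Nonempty := by
    rw [Finset.nonempty_iff_ne_empty, Ne, Finset.compl_eq_empty_iff]
    exact (hH.1 S hS).2
  obtain ⟨b, hbS, hmax⟩ := Finset.exists_max_image Sᶜ
    (fun a => (H.filter (fun T => a ∈ T)).card) hne
  rw [Finset.mem_compl] at hbS
  refine ⟨b, hbS, fun T hT hbT x hxT => ?_⟩
  by_contra hxS
  have := hmax x (by simpa using hxS)
  apply absurd this
  rw [not_le]
  apply Finset.card_lt_card
  rw [Finset.ssubset_iff_of_subset]
  · exact ⟨T, by simp [hT, hxT], by simp [hbT]⟩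
  · intro T' h'
    simp only [Finset.mem_filter] at h' ⊢
    refine ⟨h'.1, ?_⟩
    rcases hH.2 T hT T' h'.1 with h | h
    · exact h hxT
    · exact absurd (h h'.2) hbT

theorem ind_eq_zero {d : ℕ} {a b : Fin (d+1)} {T : Subs d} (h : a ∈ T ↔ b ∈ T) :
    ind a b T = 0 := by
  unfold ind
  by_cases hb : b ∈ T <;> simp [h, hb]

theorem vanish0 {d : ℕ} (m : ℕ) : ∀ H : Finset (Subs d), H.card + m + 1 = d → Phi d H 0 = 0 := by
  induction m with
  | zero =>
    intro H hc
    by_cases hH : IsProperChain d H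
    swap
    · exact Phi_nonchain _ hH
    obtain ⟨a, b, hab, hT⟩ := exists_pair hH (by omega)
    have hne : ((a : ℕ) : ℚ) - ((b:ℕ):ℚ) ≠ 0 := by
      rw [sub_ne_zero]
      intro h
      exact hab (Fin.ext (by exact_mod_cast h))
    have hrel := Phi_rel a b H 0
    set s : Equiv.Perm (Fin (d+1)) := Equiv.swap a b with hs
    have hfix : ∀ T : Subs d, (a ∈ T ↔ b ∈ T) → T.map s.toEmbedding = T := by
      intro T h
      ext x
      rw [Finset.mem_map_equiv, hs, Equiv.symm_swap]
      by_cases hxa : x = a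
      · subst hxa; simp [h]
      · by_cases hxb : x = b
        · subst hxb; simp [h]
        · rw [Equiv.swap_apply_of_ne_of_ne hxa hxb]
    have hind : ∀ T : Subs d, ind a b (T.map s.toEmbedding) = - ind a b T := by
      intro T
      unfold ind
      simp only [Finset.mem_map_equiv, hs, Equiv.symm_swap, Equiv.swap_apply_left,
        Equiv.swap_apply_right, neg_sub]
    have hsum : ∑ T : Subs d, ind a b T * Phi d H (T ::ₘ 0)
        = - ∑ T : Subs d, ind a b T * Phi d H (T ::ₘ 0) := by
      conv_lhs => rw [← (Equiv.finsetCongr s).sum_comp]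
      rw [← Finset.sum_neg_distrib]
      apply Finset.sum_congr rfl
      intro T _
      rw [Equiv.finsetCongr_apply, hind]
      by_cases h : a ∈ T ↔ b ∈ T
      · rw [ind_eq_zero h]; simp
      · have h1 : T ∉ H := fun h' => h (hT T h')
        have h2 : T.map s.toEmbedding ∉ H := by
          intro h'
          have h3 := hT _ h'
          rw [Finset.mem_map_equiv, Finset.mem_map_equiv, hs, Equiv.symm_swap] at h3
          simp at h3
          exact h h3.symm
        rw [Phi_insert _ _ _ h1, Phi_insert _ _ _ h2]
        rw [← Phi_top_perm (H := insert T H) (by rw [Finset.card_insert_of_notMem h1]; omega) s]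
        rw [Finset.image_insert]
        have : H.image (fun T => T.map s.toEmbedding) = H := by
          conv_rhs => rw [← Finset.image_id (s := H)]
          apply Finset.image_congr
          intro T hTH
          exact hfix T (hT T hTH)
        rw [this]
        ring
    have h0 : ∑ T : Subs d, ind a b T * Phi d H (T ::ₘ 0) = 0 := by linarith
    rw [h0] at hrel
    exact (mul_eq_zero.1 hrel).resolve_left hne
  | succ m ih =>
    intro H hc
    by_cases hH : IsProperChain d H
    swap
    · exact Phi_nonchain _ hH
    obtain ⟨a, b, hab, hT⟩ := exists_pair hH (by omega)
    have hne : ((a : ℕ) : ℚ) - ((b:ℕ):ℚ) ≠ 0 := by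
      rw [sub_ne_zero]
      intro h
      exact hab (Fin.ext (by exact_mod_cast h))
    have hrel := Phi_rel a b H 0
    have h0 : ∑ T : Subs d, ind a b T * Phi d H (T ::ₘ 0) = 0 := by
      apply Finset.sum_eq_zero
      intro T _
      by_cases h : T ∈ H
      · rw [ind_eq_zero (hT T h), zero_mul]
      · rw [Phi_insert _ _ _ h, ih _ (by rw [Finset.card_insert_of_notMem h]; omega), mul_zero]
    rw [h0] at hrel
    exact (mul_eq_zero.1 hrel).resolve_left hne

theorem vanish {d : ℕ} (e : Multiset (Subs d)) : ∀ H : Finset (Subs d), (∀ T ∈ e, T ∈ H) →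
    H.card + e.card < d → Phi d H e = 0 := by
  induction e using Multiset.induction with
  | empty =>
    intro H _ hc
    exact vanish0 (d - 1 - H.card) H (by simp at hc; omega)
  | cons S e ih =>
    intro H hsub hc
    by_cases hH : IsProperChain d H
    swap
    · exact Phi_nonchain _ hH
    have hS : S ∈ H := hsub S (Multiset.mem_cons_self _ _)
    have hsub' : ∀ T ∈ e, T ∈ H := fun T hT => hsub T (Multiset.mem_cons_of_mem hT)
    rw [Multiset.card_cons] at hc
    obtain ⟨a, haS, ha⟩ := exists_low hH hS
    obtain ⟨b, hbS, hb⟩ := exists_high hH hS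
    have hrel := Phi_rel a b H e
    rw [ih H hsub' (by omega), mul_zero, Finset.sum_eq_single_of_mem S (Finset.mem_univ _)] at hrel
    · have : ind a b S = 1 := by simp [ind, haS, hbS]
      rw [this, one_mul] at hrel
      exact hrel.symm
    · intro T _ hne
      by_cases h : T ∈ H
      · rw [ind_eq_zero, zero_mul]
        constructor
        · intro haT
          by_contra hbT
          exact hne (Finset.Subset.antisymm (hb T h hbT) (ha T h haT))
        · intro hbT
          rcases hH.2 S hS T h with h' | h'
          · exact h' haS
          · exact absurd (h' hbT) hbS
      · rw [Phi_insert _ _ _ h, ih _ (fun T' h' => Finset.mem_insert_of_mem (hsub' T' h'))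
          (by rw [Finset.card_insert_of_notMem h]; omega), mul_zero]

theorem vanishM {d : ℕ} (M : Multiset (Subs d)) (hM : M.card < d) :
    ∑ σ : Equiv.Perm (Fin (d+1)), (M.map (vv d σ)).prod / Wt d σ = 0 := by
  have hle : M.toFinset.val ≤ M := by rw [Multiset.toFinset_val]; exact Multiset.dedup_le M
  obtain ⟨e, he⟩ := Multiset.le_iff_exists_add.1 hle
  have hcard : M.card = M.toFinset.card + e.card := by
    conv_lhs => rw [he]
    rw [Multiset.card_add]; rfl
  have := vanish e M.toFinset (fun T hT => by
    rw [Multiset.mem_toFinset, he]; exact Multiset.mem_add.2 (Or.inr hT)) (by omega)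
  rw [← this]
  unfold Phi
  apply Finset.sum_congr rfl
  intro σ _
  congr 1
  conv_lhs => rw [he]
  rw [Multiset.map_add, Multiset.prod_add]
  rfl

end PermAux
section FunctionalAux

noncomputable def PhiL (d : ℕ) : Rd d →ₗ[ℚ] ℚ :=
  ∑ σ : Equiv.Perm (Fin (d+1)), (Wt d σ)⁻¹ • (aeval (vv d σ) : Rd d →ₐ[ℚ] ℚ).toLinearMap

noncomputable def psi (d : ℕ) : Rd d →ₗ[ℚ] ℚ := (PhiL d).comp (homogeneousComponent d)

theorem PhiL_apply {d : ℕ} (p : Rd d) :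
    PhiL d p = ∑ σ : Equiv.Perm (Fin (d+1)), aeval (vv d σ) p / Wt d σ := by
  unfold PhiL
  rw [LinearMap.sum_apply]
  apply Finset.sum_congr rfl
  intro σ _
  rw [LinearMap.smul_apply, AlgHom.toLinearMap_apply, smul_eq_mul]
  ring

theorem PhiL_mon {d : ℕ} (m : Subs d →₀ ℕ) (c : ℚ) (hm : m.degree < d) :
    PhiL d (monomial m c) = 0 := by
  have h := vanishM (Finsupp.toMultiset m) (by rwa [Finsupp.card_toMultiset])
  rw [PhiL_apply, ← mul_zero c, ← h, Finset.mul_sum]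
  apply Finset.sum_congr rfl
  intro σ _
  rw [aeval_monomial, Finsupp.toMultiset_map, Finsupp.prod_toMultiset, Finsupp.prod_mapDomain_index]
  · simp [mul_div_assoc]
  · simp
  · intros; rw [pow_add]

theorem psi_hom {d : ℕ} {p : Rd d} {n : ℕ} (hp : p.IsHomogeneous n) :
    psi d p = if d = n then PhiL d p else 0 := by
  unfold psi
  rw [LinearMap.comp_apply, homogeneousComponent_of_mem ((mem_homogeneousSubmodule _ _).2 hp)]
  split_ifs <;> simp

theorem aeval_ell {d : ℕ} (σ : Equiv.Perm (Fin (d+1))) (a : Fin (d+1)) :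
    aeval (vv d σ) (ell d a) = ((a : ℕ) : ℚ) - fw d σ d := by
  rw [← sum_a_vv, ell, map_sum, Finset.sum_filter]
  apply Finset.sum_congr rfl
  intro S _
  rw [aeval_X]
  by_cases h : isProper d S
  · by_cases h2 : a ∈ S <;> simp [h, h2]
  · have : vv d σ S = 0 := by
      unfold vv; rw [if_neg (fun h' => h h'.1)]
    simp [h, this]

theorem ell_hom {d : ℕ} (a : Fin (d+1)) : (ell d a).IsHomogeneous 1 :=
  IsHomogeneous.sum _ _ _ fun S _ => isHomogeneous_X _ S

theorem psi_gen {d : ℕ} (q g : Rd d) (h : (∃ S S' : Subs d, isProper d S ∧ isProper d S' ∧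
    ¬ S ⊆ S' ∧ ¬ S' ⊆ S ∧ g = X S * X S') ∨ ∃ a b : Fin (d + 1), g = ell d a - ell d b) :
    psi d (q * g) = 0 := by
  induction q using MvPolynomial.induction_on' with
  | monomial u c =>
    rcases h with ⟨S, S', -, -, h1, h2, rfl⟩ | ⟨a, b, rfl⟩
    · rw [psi_hom ((isHomogeneous_monomial c rfl).mul
        ((isHomogeneous_X ℚ S).mul (isHomogeneous_X ℚ S')))]
      split_ifs
      · rw [PhiL_apply]
        apply Finset.sum_eq_zero
        intro σ _
        have : vv d σ S * vv d σ S' = 0 := by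
          by_contra h
          rw [mul_eq_zero, not_or] at h
          rcases vv_comp h.1 h.2 with h | h
          · exact h1 h
          · exact h2 h
        rw [map_mul, map_mul, aeval_X, aeval_X, this]
        simp
      · rfl
    · rw [psi_hom ((isHomogeneous_monomial c rfl).mul ((ell_hom a).sub (ell_hom b)))]
      split_ifs with hd
      · have := PhiL_mon u c (by omega)
        rw [PhiL_apply] at this ⊢
        rw [← mul_zero (((a : ℕ) : ℚ) - ((b:ℕ):ℚ)), ← this, Finset.mul_sum]
        apply Finset.sum_congr rfl
        intro σ _
        rw [map_mul, map_sub, aeval_ell, aeval_ell]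
        ring
      · rfl
  | add p q hp hq => rw [add_mul, map_add, hp, hq, add_zero]

theorem psi_Itot {d : ℕ} {p : Rd d} (hp : p ∈ Itot d) : psi d p = 0 := by
  unfold Itot I1 I2 at hp
  rw [Ideal.add_eq_sup, ← Ideal.span_union] at hp
  have : ∀ q, psi d (q * p) = 0 := by
    induction hp using Submodule.span_induction with
    | mem x h => exact fun q => psi_gen q x h
    | zero => simp
    | add x y _ _ hx hy => intro q; rw [mul_add, map_add, hx, hy, add_zero]
    | smul a x _ hx => intro q; rw [smul_eq_mul, ← mul_assoc]; exact hx _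
  simpa using this 1

noncomputable def esum (d k : ℕ) : Rd d :=
  ∑ S ∈ Finset.univ.filter (fun S : Subs d => S.card = k), X S

theorem aeval_esum {d : ℕ} (σ : Equiv.Perm (Fin (d+1))) {k : ℕ} (hk : k ∈ Finset.Icc 1 d) :
    aeval (vv d σ) (esum d k) = wt d σ k := by
  have := sum_card_vv σ hk (fun _ => 1)
  simp only [one_mul] at this
  rw [← this, esum, map_sum]
  simp

theorem psi_val {d : ℕ} {H : Finset (Subs d)} (hH : IsProperChain d H) :
    psi d (chainMon d H * ∏ k ∈ Finset.Icc 1 d \ H.image Finset.card, esum d k)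
      = ∑ σ : Equiv.Perm (Fin (d+1)),
      if ∀ T ∈ H, T = Pf d σ T.card then (1 : ℚ) else 0 := by
  have hinj : Set.InjOn Finset.card (H : Set (Subs d)) := by
    intro T hT T' hT' hc
    rcases hH.2 T hT T' hT' with h | h
    · exact Finset.eq_of_subset_of_card_le h hc.ge
    · exact (Finset.eq_of_subset_of_card_le h hc.le).symm
  have hsub := image_card_sub hH.1
  have hh : (chainMon d H * ∏ k ∈ Finset.Icc 1 d \ H.image Finset.card, esum d k).IsHomogeneous
      (∑ T ∈ H, 1 + ∑ k ∈ Finset.Icc 1 d \ H.image Finset.card, 1) := by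
    apply IsHomogeneous.mul
    · exact IsHomogeneous.prod _ _ _ fun T _ => isHomogeneous_X _ T
    · exact IsHomogeneous.prod _ _ _ fun k _ =>
        IsHomogeneous.sum _ _ _ fun S _ => isHomogeneous_X _ S
  rw [psi_hom hh, if_pos, PhiL_apply]
  · apply Finset.sum_congr rfl
    intro σ _
    have h2 : aeval (vv d σ) (∏ k ∈ Finset.Icc 1 d \ H.image Finset.card, esum d k)
        = ∏ k ∈ Finset.Icc 1 d \ H.image Finset.card, wt d σ k := by
      rw [map_prod]
      exact Finset.prod_congr rfl fun k hk => aeval_esum σ (Finset.mem_sdiff.1 hk).1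
    have h1 : aeval (vv d σ) (chainMon d H) = ∏ T ∈ H, vv d σ T := by
      rw [chainMon, map_prod]; simp
    rw [map_mul, h1, h2]
    split_ifs with h
    · rw [prodH fun T hT => ⟨hH.1 T hT, h T hT⟩, mul_comm, Finset.prod_sdiff hsub]
      exact div_self (Wt_ne σ)
    · rw [prodH_zero (fun h' => h fun T hT => (h' T hT).2)]; simp
  · rw [Finset.sum_const, Finset.sum_const, Finset.card_sdiff_of_subset hsub,
      Finset.card_image_of_injOn hinj, Nat.card_Icc]
    have := Finset.card_le_card hsub
    rw [Finset.card_image_of_injOn hinj, Nat.card_Icc] at this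
    simp only [smul_eq_mul, mul_one]
    omega

end FunctionalAux

section TentAux

noncomputable def cc (n i k : ℕ) : ℚ :=
  if k ≤ i then (k:ℚ) * ((n:ℚ) - i) else (i:ℚ) * ((n:ℚ) - k)

theorem tent_low {n a j b k : ℕ} (h1 : a < j) (h2 : j < b) (hk : k ≤ a) :
    ((b:ℚ) - a) * cc n j k - ((b:ℚ)-j) * cc n a k - ((j:ℚ)-a) * cc n b k = 0 := by
  unfold cc
  rw [if_pos (by omega), if_pos (by omega), if_pos (by omega)]
  ring

theorem tent_high {n a j b k : ℕ} (h1 : a < j) (h2 : j < b) (hk : b ≤ k) :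
    ((b:ℚ) - a) * cc n j k - ((b:ℚ)-j) * cc n a k - ((j:ℚ)-a) * cc n b k = 0 := by
  unfold cc
  rw [if_neg (by omega), if_neg (by omega)]
  split_ifs with h
  · obtain rfl : k = b := by omega
    ring
  · ring

theorem tent_mid {n a j b : ℕ} (h1 : a < j) (h2 : j < b) (hb : b ≤ n) :
    0 < ((b:ℚ) - a) * cc n j j - ((b:ℚ)-j) * cc n a j - ((j:ℚ)-a) * cc n b j := by
  unfold cc
  rw [if_pos (by omega), if_neg (by omega), if_pos (by omega)]
  have e1 : (0:ℚ) < (j:ℚ) - a := by rw [sub_pos]; exact_mod_cast h1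
  have e2 : (0:ℚ) < (b:ℚ) - j := by rw [sub_pos]; exact_mod_cast h2
  have e3 : (0:ℚ) < n := by exact_mod_cast (by omega : 0 < n)
  have := mul_pos (mul_pos e1 e2) e3
  linarith [this]

theorem indU {A : Type*} [CommRing A] [Algebra ℚ A] (d : ℕ) (e U : ℕ → A)
    (hU : ∀ i, U i = ∑ k ∈ Finset.Icc 1 d, cc (d+1) i k • e k)
    (heU : ∀ k ∈ Finset.Icc 1 d, e k * U k = 0) (L : Finset ℕ) :
    L ⊆ Finset.Icc 1 d → ∀ y : A, (∀ i ∈ Finset.Icc 1 d, i ∉ L → y * U i = 0) →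
      ∃ c : ℚ, 0 < c ∧ y * ∏ i ∈ L, U i = c • (y * ∏ i ∈ L, e i) := by
  induction L using Finset.induction_on with
  | empty => intro _ y _; exact ⟨1, one_pos, by simp⟩
  | insert j L hj ih =>
    intro hL y hy
    have hjd := Finset.mem_Icc.1 (hL (Finset.mem_insert_self _ _))
    have hU0 : U 0 = 0 := by
      rw [hU]
      apply Finset.sum_eq_zero
      intro k hk
      rw [Finset.mem_Icc] at hk
      rw [cc, if_neg (by omega)]
      simp
    have hUn : U (d+1) = 0 := by
      rw [hU]
      apply Finset.sum_eq_zero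
      intro k hk
      rw [Finset.mem_Icc] at hk
      rw [cc, if_pos (by omega)]
      simp
    have hUa : ∀ k, k ∈ Finset.range (d+2) \ insert j L → y * U k = 0 := by
      intro k hk
      rw [Finset.mem_sdiff, Finset.mem_range] at hk
      by_cases h0 : k = 0
      · rw [h0, hU0, mul_zero]
      by_cases hn : k = d + 1
      · rw [hn, hUn, mul_zero]
      exact hy k (Finset.mem_Icc.2 (by omega)) hk.2
    have hL0 : ∀ k ∈ insert j L, 1 ≤ k ∧ k ≤ d := fun k hk => Finset.mem_Icc.1 (hL hk)
    obtain ⟨a, ha, hamax⟩ := Finset.exists_max_image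
      ((Finset.range (d+2) \ insert j L).filter (· < j)) id
      ⟨0, by
        simp only [Finset.mem_filter, Finset.mem_sdiff, Finset.mem_range]
        exact ⟨⟨by omega, fun h => by have := hL0 0 h; omega⟩, by omega⟩⟩
    obtain ⟨b, hb, hbmin⟩ := Finset.exists_min_image
      ((Finset.range (d+2) \ insert j L).filter (j < ·)) id
      ⟨d+1, by
        simp only [Finset.mem_filter, Finset.mem_sdiff, Finset.mem_range]
        exact ⟨⟨by omega, fun h => by have := hL0 (d+1) h; omega⟩, by omega⟩⟩
    rw [Finset.mem_filter] at ha hb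
    have hbn : b ≤ d + 1 := by
      have := Finset.mem_range.1 (Finset.mem_sdiff.1 hb.1).1
      omega
    set f : ℕ → ℚ := fun k => ((b:ℚ) - a) * cc (d+1) j k - ((b:ℚ)-j) * cc (d+1) a k
      - ((j:ℚ)-a) * cc (d+1) b k with hf
    have hfj : 0 < f j := tent_mid ha.2 hb.2 hbn
    have hα : (0:ℚ) < (b:ℚ) - a := by
      rw [sub_pos]; exact_mod_cast (ha.2.trans hb.2)
    have hsum : ((b:ℚ) - a) • (y * U j) = y * ∑ k ∈ Finset.Icc 1 d, f k • e k := by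
      have h1 : ∑ k ∈ Finset.Icc 1 d, f k • e k
          = ((b:ℚ) - a) • U j - ((b:ℚ)-j) • U a - ((j:ℚ)-a) • U b := by
        rw [hU j, hU a, hU b, Finset.smul_sum, Finset.smul_sum, Finset.smul_sum,
          ← Finset.sum_sub_distrib, ← Finset.sum_sub_distrib]
        apply Finset.sum_congr rfl
        intro k _
        simp only [hf, sub_smul, mul_smul]
      rw [h1, mul_sub, mul_sub, mul_smul_comm, mul_smul_comm, mul_smul_comm, hUa a ha.1,
        hUa b hb.1]
      simp
    have hsum2 : ((b:ℚ) - a) • (y * U j * ∏ i ∈ L, U i) = f j • (y * e j * ∏ i ∈ L, U i) := by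
      rw [← smul_mul_assoc, hsum, Finset.mul_sum, Finset.sum_mul,
        Finset.sum_eq_single_of_mem j (Finset.mem_Icc.2 hjd)]
      · rw [mul_smul_comm, smul_mul_assoc]
      · intro k hk hkj
        rw [mul_smul_comm, smul_mul_assoc]
        by_cases hkL : k ∈ L
        · rw [← Finset.mul_prod_erase L U hkL]
          have : y * e k * (U k * ∏ i ∈ L.erase k, U i)
              = (e k * U k) * (y * ∏ i ∈ L.erase k, U i) := by ring
          rw [this, heU k hk, zero_mul, smul_zero]
        · have hk' : k ∈ Finset.range (d+2) \ insert j L := by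
            rw [Finset.mem_Icc] at hk
            simp only [Finset.mem_sdiff, Finset.mem_range, Finset.mem_insert, not_or]
            exact ⟨by omega, hkj, hkL⟩
          have : f k = 0 := by
            rcases lt_or_gt_of_ne hkj with h | h
            · exact tent_low ha.2 hb.2 (hamax k (Finset.mem_filter.2 ⟨hk', h⟩))
            · exact tent_high ha.2 hb.2 (hbmin k (Finset.mem_filter.2 ⟨hk', h⟩))
          rw [this, zero_smul]
    obtain ⟨c, hc, hce⟩ := ih ((Finset.subset_insert _ _).trans hL) (y * e j) (by
      intro i hi hiL
      by_cases hij : i = j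
      · rw [hij, mul_assoc, heU j (Finset.mem_Icc.2 hjd), mul_zero]
      · have := hy i hi (by simp [hij, hiL])
        rw [mul_right_comm, this, zero_mul])
    refine ⟨((b:ℚ) - a)⁻¹ * f j * c, by positivity, ?_⟩
    rw [Finset.prod_insert hj, Finset.prod_insert hj, ← mul_assoc, ← mul_assoc]
    rw [mul_smul, mul_smul, ← hce, ← hsum2, smul_smul, inv_mul_cancel₀ hα.ne', one_smul]

end TentAux
section FinalAux

noncomputable def Upoly (d i : ℕ) : Rd d := ∑ k ∈ Finset.Icc 1 d, cc (d+1) i k • esum d k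

theorem Upoly_eq {d i : ℕ} : Upoly d i
    = ∑ T ∈ Finset.univ.filter (fun T : Subs d => isProper d T), cc (d+1) i T.card • X T := by
  have h : ∀ k ∈ Finset.Icc 1 d, cc (d+1) i k • esum d k
      = ∑ T ∈ Finset.univ.filter (fun S : Subs d => S.card = k),
        cc (d+1) i T.card • (X T : Rd d) := by
    intro k _
    rw [esum, Finset.smul_sum]
    apply Finset.sum_congr rfl
    intro T hT
    rw [(Finset.mem_filter.1 hT).2]
  rw [Upoly, Finset.sum_congr rfl h, Finset.sum_fiberwise_eq_sum_filter]
  apply Finset.sum_congr _ fun _ _ => rfl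
  ext T
  simp only [Finset.mem_filter, proper_card]

theorem sum_ell {d : ℕ} (S : Subs d) : ∑ a ∈ S, ell d a
    = ∑ T ∈ Finset.univ.filter (fun T : Subs d => isProper d T),
      ((S ∩ T).card : ℚ) • (X T : Rd d) := by
  have h : ∀ a ∈ S, ell d a = ∑ T ∈ Finset.univ.filter (fun T : Subs d => isProper d T),
      if a ∈ T then (X T : Rd d) else 0 := by
    intro a _
    rw [ell, ← Finset.filter_filter, Finset.sum_filter]
  rw [Finset.sum_congr rfl h, Finset.sum_comm]
  apply Finset.sum_congr rfl
  intro T _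
  rw [← Finset.sum_filter, Finset.sum_const, Finset.filter_mem_eq_inter, Nat.cast_smul_eq_nsmul]

theorem X_U {d : ℕ} {S : Subs d} (hS : isProper d S) : X S * Upoly d S.card ∈ Itot d := by
  have hd' : S.card ≤ d := (Finset.mem_Icc.1 (proper_card.1 hS)).2
  have h2 : ∑ a ∈ S, ∑ b ∈ Sᶜ, (ell d a - ell d b) ∈ Itot d := by
    apply Ideal.sum_mem
    intro a _
    apply Ideal.sum_mem
    intro b _
    exact Ideal.mem_sup_right (Ideal.subset_span ⟨a, b, rfl⟩)
  have h3 : ∑ a ∈ S, ∑ b ∈ Sᶜ, (ell d a - ell d b)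
      = ∑ T ∈ Finset.univ.filter (fun T : Subs d => isProper d T),
        ((Sᶜ.card : ℚ) * (S ∩ T).card - (S.card : ℚ) * (Sᶜ ∩ T).card) • (X T : Rd d) := by
    simp only [Finset.sum_sub_distrib, Finset.sum_const, ← Finset.smul_sum]
    rw [sum_ell, sum_ell, ← Nat.cast_smul_eq_nsmul ℚ, ← Nat.cast_smul_eq_nsmul ℚ,
      Finset.smul_sum, Finset.smul_sum, ← Finset.sum_sub_distrib]
    apply Finset.sum_congr rfl
    intro T _
    rw [sub_smul, mul_smul, mul_smul]
  have h4 : X S * Upoly d S.card - X S * ∑ a ∈ S, ∑ b ∈ Sᶜ, (ell d a - ell d b) ∈ Itot d := by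
    rw [h3, Upoly_eq, ← mul_sub, ← Finset.sum_sub_distrib, Finset.mul_sum]
    apply Ideal.sum_mem
    intro T hT
    have hT' := (Finset.mem_filter.1 hT).2
    rw [← sub_smul, mul_smul_comm]
    have hc : (Sᶜ.card : ℚ) = ((d + 1 : ℕ) : ℚ) - S.card := by
      rw [Finset.card_compl, Fintype.card_fin, Nat.cast_sub (by omega)]
    by_cases h1 : S ⊆ T
    · have e1 : S ∩ T = S := Finset.inter_eq_left.2 h1
      have e2 : ((Sᶜ ∩ T).card : ℚ) = (T.card : ℚ) - S.card := by
        have : Sᶜ ∩ T = T \ S := by ext; simp [and_comm]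
        rw [this, Finset.card_sdiff_of_subset h1, Nat.cast_sub (Finset.card_le_card h1)]
      have : cc (d+1) S.card T.card
          - ((Sᶜ.card : ℚ) * (S ∩ T).card - (S.card : ℚ) * (Sᶜ ∩ T).card) = 0 := by
        rw [e1, e2, hc, cc]
        have := Finset.card_le_card h1
        split_ifs with h
        · have : T.card = S.card := by omega
          rw [this]; ring
        · ring
      rw [this, zero_smul]
      exact Ideal.zero_mem _
    by_cases h1' : T ⊆ S
    · have e1 : S ∩ T = T := Finset.inter_eq_right.2 h1'
      have e2 : Sᶜ ∩ T = ∅ := by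
        ext x
        simp only [Finset.mem_inter, Finset.mem_compl, Finset.notMem_empty, iff_false, not_and]
        exact fun h h' => h (h1' h')
      have : cc (d+1) S.card T.card
          - ((Sᶜ.card : ℚ) * (S ∩ T).card - (S.card : ℚ) * (Sᶜ ∩ T).card) = 0 := by
        rw [e1, e2, hc, cc, if_pos (Finset.card_le_card h1')]
        simp only [Finset.card_empty, Nat.cast_zero]
        ring
      rw [this, zero_smul]
      exact Ideal.zero_mem _
    · rw [smul_eq_C_mul]
      apply Ideal.mul_mem_left
      exact Ideal.mem_sup_left (Ideal.subset_span ⟨S, T, hS, hT', h1, h1', rfl⟩)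
  have := Ideal.add_mem _ h4 (Ideal.mul_mem_left _ (X S) h2)
  simpa using this

theorem e_U {d k : ℕ} (hk : k ∈ Finset.Icc 1 d) : esum d k * Upoly d k ∈ Itot d := by
  rw [esum, Finset.sum_mul]
  apply Ideal.sum_mem
  intro S hS
  have hS' := (Finset.mem_filter.1 hS).2
  have := X_U (S := S) (proper_card.2 (by rwa [hS']))
  rwa [hS'] at this

theorem chain_U {d : ℕ} {H : Finset (Subs d)} (hH : IsProperChain d H) {k : ℕ}
    (hk : k ∈ H.image Finset.card) : chainMon d H * Upoly d k ∈ Itot d := by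
  obtain ⟨S, hS, rfl⟩ := Finset.mem_image.1 hk
  rw [chainMon, ← Finset.prod_erase_mul H _ hS, mul_assoc]
  exact Ideal.mul_mem_left _ _ (X_U (hH.1 S hS))

theorem psi_U {d : ℕ} {H : Finset (Subs d)} (hH : IsProperChain d H) :
    ∃ c : ℚ, 0 < c ∧
      psi d (chainMon d H * ∏ k ∈ Finset.Icc 1 d \ H.image Finset.card, Upoly d k)
      = c * ∑ σ : Equiv.Perm (Fin (d+1)),
      if ∀ T ∈ H, T = Pf d σ T.card then (1 : ℚ) else 0 := by
  let π := Ideal.Quotient.mkₐ ℚ (Itot d)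
  have hπ : ∀ p, π p = 0 ↔ p ∈ Itot d := fun p => Ideal.Quotient.eq_zero_iff_mem
  obtain ⟨c, hc, he⟩ := indU d (fun k => π (esum d k)) (fun k => π (Upoly d k))
    (by
      intro i
      simp only [Upoly, map_sum, map_smul])
    (by
      intro k hk
      simp only [← map_mul]
      exact (hπ _).2 (e_U hk))
    (Finset.Icc 1 d \ H.image Finset.card) Finset.sdiff_subset (π (chainMon d H))
    (by
      intro i hi hi2
      rw [Finset.mem_sdiff, not_and, not_not] at hi2
      simp only [← map_mul]
      exact (hπ _).2 (chain_U hH (hi2 hi)))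
  refine ⟨c, hc, ?_⟩
  rw [← psi_val hH, ← smul_eq_mul (a := c), ← map_smul, ← sub_eq_zero, ← map_sub]
  apply psi_Itot
  rw [← hπ, map_sub, map_smul, map_mul, map_mul, map_prod, map_prod, he, sub_self]

theorem chain_inj {d : ℕ} {H : Finset (Subs d)} (hH : IsProperChain d H) :
    (H.image Finset.card).card = H.card := by
  apply Finset.card_image_of_injOn
  intro T hT T' hT' hc
  rcases hH.2 T hT T' hT' with h | h
  · exact Finset.eq_of_subset_of_card_le h hc.ge
  · exact (Finset.eq_of_subset_of_card_le h hc.le).symm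

theorem lin_indep (d : ℕ) (q : Finset (Subs d) → ℚ)
    (hsym : ∀ H H' : Finset (Subs d), IsProperChain d H → IsProperChain d H' →
      H.image Finset.card = H'.image Finset.card → q H = q H')
    (hq : (∑ H ∈ Finset.univ.filter (fun H : Finset (Subs d) => IsProperChain d H),
        C (q H) * chainMon d H) ∈ Itot d) :
    ∀ H : Finset (Subs d), IsProperChain d H → q H = 0 := by
  by_contra hcon
  push Not at hcon
  obtain ⟨Hx, hx1, hx2⟩ := hcon
  obtain ⟨H0, hH0, hmin⟩ := Finset.exists_min_image
    (Finset.univ.filter (fun H : Finset (Subs d) => IsProperChain d H ∧ q H ≠ 0)) Finset.card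
    ⟨Hx, by simp [hx1, hx2]⟩
  simp only [Finset.mem_filter, Finset.mem_univ, true_and] at hH0 hmin
  obtain ⟨hc0, hq0⟩ := hH0
  set K := H0.image Finset.card with hK
  have hKsub : K ⊆ Finset.Icc 1 d := image_card_sub hc0.1
  set UU : Rd d := ∏ k ∈ Finset.Icc 1 d \ K, Upoly d k with hUU
  have hz := psi_Itot (Ideal.mul_mem_right UU _ hq)
  rw [Finset.sum_mul, map_sum] at hz
  set t : Finset (Subs d) → ℚ := fun H =>
    if H.image Finset.card = K then psi d (chainMon d H * UU) else 0 with ht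
  have hterm : ∀ H ∈ Finset.univ.filter (fun H : Finset (Subs d) => IsProperChain d H),
      psi d (C (q H) * chainMon d H * UU) = q H0 * t H := by
    intro H hH
    have hH := (Finset.mem_filter.1 hH).2
    rw [mul_assoc, ← smul_eq_C_mul, map_smul, smul_eq_mul]
    simp only [ht]
    split_ifs with h
    · rw [hsym H H0 hH hc0 h]
    · rw [mul_zero]
      by_cases hsub : H.image Finset.card ⊆ K
      · have hlt : H.card < H0.card := by
          rw [← chain_inj hH, ← chain_inj hc0]
          exact Finset.card_lt_card (hsub.ssubset_of_ne h)
        have : q H = 0 := by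
          by_contra h'
          exact absurd (hmin H ⟨hH, h'⟩) (by omega)
        rw [this, zero_mul]
      · rw [Finset.not_subset] at hsub
        obtain ⟨k, hk, hkK⟩ := hsub
        have hk2 : k ∈ Finset.Icc 1 d \ K :=
          Finset.mem_sdiff.2 ⟨image_card_sub hH.1 hk, hkK⟩
        rw [psi_Itot, mul_zero]
        rw [hUU, ← Finset.mul_prod_erase _ _ hk2, ← mul_assoc]
        exact Ideal.mul_mem_right _ _ (chain_U hH hk)
  rw [Finset.sum_congr rfl hterm, ← Finset.mul_sum] at hz
  have hz' := (mul_eq_zero.1 hz).resolve_left hq0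
  have hval : ∀ H, IsProperChain d H → H.image Finset.card = K → ∃ c : ℚ, 0 < c ∧
      t H = c * ∑ σ : Equiv.Perm (Fin (d+1)),
      if ∀ T ∈ H, T = Pf d σ T.card then (1 : ℚ) else 0 := by
    intro H hH h
    obtain ⟨c, hc, he⟩ := psi_U hH
    refine ⟨c, hc, ?_⟩
    rw [← he, h]
    simp only [ht, if_pos h, hUU]
  have hnn : ∀ H ∈ Finset.univ.filter (fun H : Finset (Subs d) => IsProperChain d H),
      0 ≤ t H := by
    intro H hH
    have hH := (Finset.mem_filter.1 hH).2
    by_cases h : H.image Finset.card = K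
    · obtain ⟨c, hc, he⟩ := hval H hH h
      rw [he]
      exact mul_nonneg hc.le (Finset.sum_nonneg fun σ _ => by split_ifs <;> norm_num)
    · simp only [ht, if_neg h, le_refl]
  set H1 : Finset (Subs d) := K.image (Pf d 1) with hH1
  have hcard : ∀ k ∈ K, (Pf d 1 k).card = k := fun k hk =>
    card_Pf 1 (by have := Finset.mem_Icc.1 (hKsub hk); omega)
  have hch : IsProperChain d H1 := by
    constructor
    · intro T hT
      obtain ⟨k, hk, rfl⟩ := Finset.mem_image.1 hT
      rw [proper_card, hcard k hk]
      exact hKsub hk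
    · intro T hT T' hT'
      obtain ⟨k, hk, rfl⟩ := Finset.mem_image.1 hT
      obtain ⟨k', hk', rfl⟩ := Finset.mem_image.1 hT'
      rcases le_total k k' with h | h
      · exact Or.inl (Pf_mono _ h)
      · exact Or.inr (Pf_mono _ h)
  have him : H1.image Finset.card = K := by
    rw [hH1, Finset.image_image]
    conv_rhs => rw [← Finset.image_id (s := K)]
    exact Finset.image_congr fun k hk => hcard k hk
  have hpos : 0 < t H1 := by
    obtain ⟨c, hc, he⟩ := hval H1 hch him
    rw [he]
    apply mul_pos hc
    apply Finset.sum_pos'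
    · intro σ _
      split_ifs <;> norm_num
    · refine ⟨1, Finset.mem_univ _, ?_⟩
      rw [if_pos]
      · exact one_pos
      · intro T hT
        obtain ⟨k, hk, rfl⟩ := Finset.mem_image.1 hT
        rw [hcard k hk]
  have := Finset.sum_pos' hnn ⟨H1, by simp [hch], hpos⟩
  exact absurd hz' this.ne'

end FinalAux

/-- Theorem `thm:uniqueness`: the Todd class of the permutohedral
variety has a unique symmetric square-free representation in `A_d`: if `r` and `r'`
are symmetric functions on chains in `B̄` whose square-free polynomials are both
congruent to `Td_d` modulo `I₁+I₂`, then `r = r'` on chains. -/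
theorem stmt4 (d : ℕ) (hd : 1 ≤ d) (r r' : Finset (Subs d) → ℚ)
    (hsym : ∀ H H' : Finset (Subs d), IsProperChain d H → IsProperChain d H' →
      H.image Finset.card = H'.image Finset.card → r H = r H')
    (hsym' : ∀ H H' : Finset (Subs d), IsProperChain d H → IsProperChain d H' →
      H.image Finset.card = H'.image Finset.card → r' H = r' H')
    (hTd : (∑ H ∈ Finset.univ.filter (fun H : Finset (Subs d) => IsProperChain d H),
        C (r H) * chainMon d H) - Td d ∈ Itot d)
    (hTd' : (∑ H ∈ Finset.univ.filter (fun H : Finset (Subs d) => IsProperChain d H),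
        C (r' H) * chainMon d H) - Td d ∈ Itot d) :
    ∀ H : Finset (Subs d), IsProperChain d H → r H = r' H := by
  intro H hH
  have h := lin_indep d (fun H => r H - r' H)
    (fun H H' h h' he => by rw [hsym H H' h h' he, hsym' H H' h h' he]) (by
      have := Ideal.sub_mem _ hTd hTd'
      rw [sub_sub_sub_cancel_right, ← Finset.sum_sub_distrib] at this
      simpa only [map_sub, sub_mul] using this) H hH
  exact sub_eq_zero.1 h
end

section
/- Let d ≥ 2 and let r be a symmetric function on chains in B̄ (its value on a chain depends only on the sequence of cardinalities) such that ∑_{S_•} r(S_•)·x_{S_•} ≡ Td_d modulo I_1 + I_2. Then for every 2-chain S_1 ⊊ S_2 in B̄ with |S_1| = s_1 and |S_2| = s_2, one has r(S_1,S_2) = 1/4 − (1/12)·((d+1−s_2)/(d+1−s_1) + s_1/s_2). -/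
open MvPolynomial

/-- second order jet coefficient at the origin -/
noncomputable def jet2 (d : ℕ) (S T : Subs d) (p : Rd d) : ℚ :=
  eval (fun _ => (0:ℚ)) (pderiv S (pderiv T p))

noncomputable def jet1 (d : ℕ) (S : Subs d) (p : Rd d) : ℚ :=
  eval (fun _ => (0:ℚ)) (pderiv S p)

noncomputable def jet0 (d : ℕ) (p : Rd d) : ℚ := eval (fun _ => (0:ℚ)) p

lemma jet0_mul (d : ℕ) (p q : Rd d) : jet0 d (p * q) = jet0 d p * jet0 d q := by
  simp [jet0]

lemma jet1_mul (d : ℕ) (S : Subs d) (p q : Rd d) :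
    jet1 d S (p * q) = jet0 d p * jet1 d S q + jet1 d S p * jet0 d q := by
  simp [jet0, jet1, Derivation.leibniz]; ring

lemma jet2_mul (d : ℕ) (S T : Subs d) (p q : Rd d) :
    jet2 d S T (p * q) = jet0 d p * jet2 d S T q + jet1 d S p * jet1 d T q
      + jet1 d T p * jet1 d S q + jet2 d S T p * jet0 d q := by
  simp [jet0, jet1, jet2, Derivation.leibniz]; ring

lemma jet0_X (d : ℕ) (U : Subs d) : jet0 d (X U) = 0 := by simp [jet0]

lemma jet1_X (d : ℕ) (S U : Subs d) : jet1 d S (X U) = if U = S then 1 else 0 := by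
  by_cases h : U = S
  · subst h; simp [jet1]
  · simp [jet1, pderiv_X_of_ne h, h]

lemma jet2_X (d : ℕ) (S T U : Subs d) : jet2 d S T (X U) = 0 := by
  by_cases h : U = T
  · subst h; simp [jet2]
  · simp [jet2, pderiv_X_of_ne h]

/-- Functional attached to a weight. -/
noncomputable def fnl (d : ℕ) (W : Subs d → Subs d → ℚ) (p : Rd d) : ℚ :=
  ∑ S, ∑ T, W S T * jet2 d S T p

lemma fnl_add (d : ℕ) (W : Subs d → Subs d → ℚ) (p q : Rd d) :
    fnl d W (p + q) = fnl d W p + fnl d W q := by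
  simp [fnl, jet2, mul_add, Finset.sum_add_distrib]

lemma fnl_sub (d : ℕ) (W : Subs d → Subs d → ℚ) (p q : Rd d) :
    fnl d W (p - q) = fnl d W p - fnl d W q := by
  simp [fnl, jet2, mul_sub, Finset.sum_sub_distrib]

lemma fnl_I1 (d : ℕ) (W : Subs d → Subs d → ℚ) (hW : ∀ S T, W S T = W T S)
    (hinc : ∀ S T, ¬ S ⊆ T → ¬ T ⊆ S → W S T = 0) (p : Rd d) (hp : p ∈ I1 d) :
    fnl d W p = 0 := by
  unfold I1 at hp
  induction hp using Submodule.span_induction with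
  | mem x hx => 
    obtain ⟨U, V, -, -, h1, h2, rfl⟩ := hx
    unfold fnl
    refine Finset.sum_eq_zero fun S _ => Finset.sum_eq_zero fun T _ => ?_
    rw [jet2_mul]
    simp only [jet0_X, jet1_X, jet2_X]
    have := hinc U V h1 h2
    have := hinc V U h2 h1
    split_ifs <;> simp_all
  | zero => simp [fnl, jet2]
  | add x y _ _ hx hy => rw [fnl_add, hx, hy, add_zero]
  | smul a x hx ih => 
    have h01 : jet0 d x = 0 ∧ ∀ S, jet1 d S x = 0 := by
      clear ih
      induction hx using Submodule.span_induction with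
      | mem x hx =>
        obtain ⟨U, V, -, -, h1, h2, rfl⟩ := hx
        refine ⟨by simp [jet0_mul, jet0_X], fun S => by simp [jet1_mul, jet0_X]⟩
      | zero => simp [jet0, jet1]
      | add x y _ _ hx hy =>
        refine ⟨?_, fun S => ?_⟩
        · have := hx.1; have := hy.1; simp_all [jet0]
        · have := hx.2 S; have := hy.2 S; simp_all [jet1]
      | smul a x _ ih => 
        refine ⟨by simp [jet0_mul, ih.1], fun S => by simp [jet1_mul, ih.1, ih.2]⟩
    have : fnl d W (a • x) = jet0 d a * fnl d W x := by
      unfold fnl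
      simp only [smul_eq_mul, jet2_mul, h01.1, h01.2, Finset.mul_sum]
      refine Finset.sum_congr rfl fun S _ => Finset.sum_congr rfl fun T _ => ?_
      ring
    rw [this, ih, mul_zero]

lemma jet0_ell (d : ℕ) (a : Fin (d+1)) : jet0 d (ell d a) = 0 := by
  simp [jet0, ell]

lemma jet1_ell (d : ℕ) (a : Fin (d+1)) (S : Subs d) :
    jet1 d S (ell d a) = if isProper d S ∧ a ∈ S then 1 else 0 := by
  have : jet1 d S (ell d a) = ∑ U ∈ Finset.univ.filter
      (fun U : Subs d => isProper d U ∧ a ∈ U), jet1 d S (X U) := by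
    simp only [jet1, ell, map_sum]
  rw [this]
  simp [jet1_X]

lemma jet2_ell (d : ℕ) (a : Fin (d+1)) (S T : Subs d) :
    jet2 d S T (ell d a) = 0 := by
  have : jet2 d S T (ell d a) = ∑ U ∈ Finset.univ.filter
      (fun U : Subs d => isProper d U ∧ a ∈ U), jet2 d S T (X U) := by
    simp only [jet2, ell, map_sum]
  rw [this]
  simp [jet2_X]

lemma fnl_I2 (d : ℕ) (W : Subs d → Subs d → ℚ) (hW : ∀ S T, W S T = W T S)
    (hpr : ∀ S T, ¬ isProper d T → W S T = 0)
    (c : Subs d → ℚ)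
    (hbal : ∀ S a, ∑ T, (if a ∈ T then W S T else 0) = c S)
    (p : Rd d) (hp : p ∈ I2 d) :
    fnl d W p = 0 := by
  unfold I2 at hp
  refine Submodule.span_induction (p := fun x _ => ∀ q, fnl d W (q * x) = 0) ?_ ?_ ?_ ?_ hp
    |> fun h => by simpa using h 1
  · rintro x ⟨a, b, rfl⟩ q
    have key : ∀ a S, ∑ T, W S T * jet1 d T (ell d a) = c S := by
      intro a S
      rw [← hbal S a]
      refine Finset.sum_congr rfl fun T _ => ?_
      rw [jet1_ell]
      by_cases h : isProper d T
      · simp [h]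
      · simp [h, hpr S T h]
    have h : ∀ a, fnl d W (q * ell d a) = 2 * ∑ S, jet1 d S q * c S := by
      intro a
      unfold fnl
      simp only [jet2_mul, jet0_ell, jet2_ell, mul_zero, zero_add, add_zero, mul_add,
        Finset.sum_add_distrib]
      have e1 : ∑ S, ∑ T, W S T * (jet1 d S q * jet1 d T (ell d a)) = ∑ S, jet1 d S q * c S := by
        refine Finset.sum_congr rfl fun S _ => ?_
        rw [← key a S, Finset.mul_sum]
        exact Finset.sum_congr rfl fun T _ => by ring
      have e2 : ∑ S, ∑ T, W S T * (jet1 d T q * jet1 d S (ell d a)) = ∑ S, jet1 d S q * c S := by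
        rw [Finset.sum_comm, ← e1]
        refine Finset.sum_congr rfl fun S _ => Finset.sum_congr rfl fun T _ => ?_
        rw [hW]
      rw [e1, e2]; ring
    rw [mul_sub, fnl_sub, h, h, sub_self]
  · intro q; simp [fnl, jet2]
  · intro x y _ _ hx hy q
    rw [mul_add, fnl_add, hx, hy, add_zero]
  · intro a x _ hx q
    rw [smul_eq_mul, ← mul_assoc]; exact hx _

lemma jet0_fac (d : ℕ) (U : Subs d) :
    jet0 d (∑ m ∈ Finset.range (d + 1), C (tau m) * X U ^ m) = 1 := by
  simp only [jet0, map_sum, map_mul, eval_C, map_pow, eval_X]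
  rw [Finset.sum_range_succ']
  simp [tau]

lemma jet_pow (d : ℕ) (S T U : Subs d) (m : ℕ) :
    jet2 d S T (X U ^ (m+3)) = 0 ∧ jet1 d S (X U ^ (m+2)) = 0 := by
  have h1 : ∀ S m, jet1 d S (X U ^ (m+2)) = 0 := by
    intro S m
    rw [pow_succ, pow_succ, jet1_mul, jet0_mul]; simp [jet0_X]
  refine ⟨?_, h1 S m⟩
  rw [pow_succ, jet2_mul, h1, h1, jet2_X, jet0_X]; simp

lemma fac_split (d : ℕ) (hd : 2 ≤ d) (U : Subs d) :
    ∑ m ∈ Finset.range (d + 1), C (tau m) * X U ^ m =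
      ((∑ m ∈ Finset.range (d - 2), C (tau (m+3)) * X U ^ (m+3)) + C (1/12) * (X U * X U)
        + C (1/2) * X U + 1 : Rd d) := by
  obtain ⟨e, rfl⟩ := Nat.exists_eq_add_of_le' hd
  rw [Finset.sum_range_succ', Finset.sum_range_succ', Finset.sum_range_succ']
  have h2 : tau 2 = 1/12 := by simp [tau, bernoulli'_two]; norm_num
  have h1 : tau 1 = 1/2 := by simp [tau]
  have h0 : tau 0 = 1 := by simp [tau]
  simp [h0, h1, h2, pow_two]

lemma jet1_fac (d : ℕ) (hd : 2 ≤ d) (S U : Subs d) :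
    jet1 d S (∑ m ∈ Finset.range (d + 1), C (tau m) * X U ^ m) = if U = S then 1/2 else 0 := by
  have hC : ∀ q (p : Rd d), jet1 d S (C q * p) = q * jet1 d S p := by
    intro q p; simp [jet1]
  have ha : ∀ p q : Rd d, jet1 d S (p + q) = jet1 d S p + jet1 d S q := by
    intro q p; simp [jet1]
  have hs : jet1 d S (∑ m ∈ Finset.range (d - 2), C (tau (m+3)) * X U ^ (m+3)) = 0 := by
    have : jet1 d S (∑ m ∈ Finset.range (d - 2), C (tau (m+3)) * X U ^ (m+3))
      = ∑ m ∈ Finset.range (d - 2), jet1 d S (C (tau (m+3)) * X U ^ (m+3)) := by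
      simp [jet1]
    rw [this]
    refine Finset.sum_eq_zero fun m _ => ?_
    rw [hC, (jet_pow d S S U (m+1)).2, mul_zero]
  have h1 : jet1 d S 1 = 0 := by simp [jet1]
  rw [fac_split d hd, ha, ha, ha, hs, hC, hC, h1, jet1_mul, jet0_X, jet1_X]
  split_ifs <;> simp

lemma jet2_fac (d : ℕ) (hd : 2 ≤ d) (S T U : Subs d) :
    jet2 d S T (∑ m ∈ Finset.range (d + 1), C (tau m) * X U ^ m)
      = if U = S ∧ U = T then 1/6 else 0 := by
  have hC : ∀ q (p : Rd d), jet2 d S T (C q * p) = q * jet2 d S T p := by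
    intro q p; simp [jet2]
  have ha : ∀ p q : Rd d, jet2 d S T (p + q) = jet2 d S T p + jet2 d S T q := by
    intro q p; simp [jet2]
  have hs : jet2 d S T (∑ m ∈ Finset.range (d - 2), C (tau (m+3)) * X U ^ (m+3)) = 0 := by
    have : jet2 d S T (∑ m ∈ Finset.range (d - 2), C (tau (m+3)) * X U ^ (m+3))
      = ∑ m ∈ Finset.range (d - 2), jet2 d S T (C (tau (m+3)) * X U ^ (m+3)) := by
      simp [jet2]
    rw [this]
    refine Finset.sum_eq_zero fun m _ => ?_
    rw [hC, (jet_pow d S T U m).1, mul_zero]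
  have h1 : jet2 d S T 1 = 0 := by simp [jet2]
  rw [fac_split d hd, ha, ha, ha, hs, hC, hC, h1, jet2_mul, jet0_X, jet1_X, jet2_X, jet1_X]
  by_cases h : U = S <;> by_cases h' : U = T <;> simp only [h, h', if_true, if_false, true_and, and_true, and_false, false_and] <;> (try split_ifs) <;> simp_all <;> norm_num

lemma jet_prod (d : ℕ) (hd : 2 ≤ d) (A : Finset (Subs d)) :
    let p : Rd d := ∏ S ∈ A, ∑ m ∈ Finset.range (d + 1), C (tau m) * X S ^ m
    jet0 d p = 1 ∧ (∀ S, jet1 d S p = if S ∈ A then 1/2 else 0) ∧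
    ∀ S T, jet2 d S T p = if S ∈ A ∧ T ∈ A then (if S = T then 1/6 else 1/4) else 0 := by
  induction A using Finset.induction_on with
  | empty => simp [jet0, jet1, jet2]
  | insert U A hU ih =>
    obtain ⟨i0, i1, i2⟩ := ih
    simp only [Finset.prod_insert hU]
    refine ⟨?_, fun S => ?_, fun S T => ?_⟩
    · rw [jet0_mul, i0, jet0_fac, one_mul]
    · rw [jet1_mul, i0, i1, jet0_fac, jet1_fac d hd]
      by_cases h : U = S
      · subst h; simp [hU]
      · simp [h, Ne.symm h]
    · rw [jet2_mul, i0, i1, i1, i2, jet0_fac, jet1_fac d hd, jet1_fac d hd, jet2_fac d hd]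
      by_cases h : U = S
      · subst h
        by_cases h' : U = T
        · subst h'; simp [hU]
        · by_cases hT : T ∈ A <;> simp [hU, h', hT, Ne.symm h'] <;> norm_num
      · by_cases h' : U = T
        · subst h'
          by_cases hT : S ∈ A <;> simp [hU, h, hT, Ne.symm h] 
          norm_num
        · simp [h, h', Ne.symm h, Ne.symm h']

lemma jet2_Td (d : ℕ) (hd : 2 ≤ d) (S T : Subs d) (hS : isProper d S) (hT : isProper d T) :
    jet2 d S T (Td d) = if S = T then 1/6 else 1/4 := by
  have := (jet_prod d hd (Finset.univ.filter (fun S : Subs d => isProper d S))).2.2 S T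
  simpa [hS, hT, Td] using this

lemma pderiv_chainMon (d : ℕ) (S : Subs d) (H : Finset (Subs d)) :
    pderiv S (chainMon d H) = if S ∈ H then chainMon d (H.erase S) else 0 := by
  have h0 : ∀ H : Finset (Subs d), S ∉ H → pderiv S (chainMon d H) = 0 := by
    intro H
    induction H using Finset.induction_on with
    | empty => simp [chainMon]
    | insert U A hU ih =>
      intro h
      simp only [Finset.mem_insert, not_or] at h
      have ih' := ih h.2
      unfold chainMon at ih' ⊢
      rw [Finset.prod_insert hU, Derivation.leibniz, ih', pderiv_X_of_ne (Ne.symm h.1)]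
      simp
  split_ifs with h
  · have : chainMon d H = X S * chainMon d (H.erase S) := by
      unfold chainMon; rw [Finset.mul_prod_erase _ _ h]
    rw [this, Derivation.leibniz, h0 _ (Finset.notMem_erase S H)]
    simp
  · exact h0 H h

lemma jet2_chainMon (d : ℕ) (S T : Subs d) (H : Finset (Subs d)) :
    jet2 d S T (chainMon d H) = if S ≠ T ∧ H = {S, T} then 1 else 0 := by
  have h0 : ∀ K : Finset (Subs d), eval (fun _ => (0:ℚ)) (chainMon d K) =
      if K = ∅ then 1 else 0 := by
    intro K
    split_ifs with h
    · subst h; simp [chainMon]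
    · obtain ⟨x, hx⟩ := Finset.nonempty_iff_ne_empty.mpr h
      simp only [chainMon, map_prod, eval_X]
      exact Finset.prod_eq_zero hx rfl
  unfold jet2
  rw [pderiv_chainMon]
  by_cases hT : T ∈ H
  · rw [if_pos hT, pderiv_chainMon]
    by_cases hS : S ∈ H.erase T
    · rw [if_pos hS, h0]
      congr 1
      rw [Finset.mem_erase] at hS
      simp only [eq_iff_iff]
      constructor
      · intro h
        refine ⟨hS.1, ?_⟩
        ext x
        have := Finset.ext_iff.mp h x
        simp only [Finset.mem_erase, Finset.notMem_empty, iff_false] at this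
        simp only [Finset.mem_insert, Finset.mem_singleton]
        constructor
        · intro hx; by_contra hh; push Not at hh; exact this ⟨hh.1, hh.2, hx⟩
        · rintro (rfl | rfl); exacts [hS.2, hT]
      · rintro ⟨_, rfl⟩
        ext x; simp; tauto
    · rw [if_neg hS, if_neg]; · simp
      rintro ⟨h, rfl⟩
      apply hS; simp [h]
  · rw [if_neg hT, if_neg]; · simp
    rintro ⟨h, rfl⟩
    simp at hT

lemma jet2_sum (d : ℕ) (r : Finset (Subs d) → ℚ) (S T : Subs d) :
    jet2 d S T (∑ H ∈ Finset.univ.filter (fun H : Finset (Subs d) => IsProperChain d H),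
        C (r H) * chainMon d H) = if S ≠ T ∧ IsProperChain d {S, T} then r {S, T} else 0 := by
  have : jet2 d S T (∑ H ∈ Finset.univ.filter (fun H : Finset (Subs d) => IsProperChain d H),
        C (r H) * chainMon d H) =
      ∑ H ∈ Finset.univ.filter (fun H : Finset (Subs d) => IsProperChain d H),
        r H * jet2 d S T (chainMon d H) := by
    simp [jet2]
  rw [this]
  simp only [jet2_chainMon]
  by_cases h : S = T
  · simp [h]
  · simp [h, Finset.sum_ite_eq, Finset.sum_filter]

section counting
variable (n : ℕ)

lemma cnt_sub {α : Type*} [Fintype α] [DecidableEq α] (T : Finset α) (k : ℕ) :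
    (Finset.univ.filter (fun S : Finset α => S ⊆ T ∧ S.card = k)).card = T.card.choose k := by
  rw [← Finset.card_powersetCard]
  congr 1; ext S; simp [Finset.mem_powersetCard]

lemma cnt_sub_mem {α : Type*} [Fintype α] [DecidableEq α] (T : Finset α) (k : ℕ) (hk : 1 ≤ k)
    (a : α) (ha : a ∈ T) :
    T.card * (Finset.univ.filter (fun S : Finset α => a ∈ S ∧ S ⊆ T ∧ S.card = k)).card
      = k * T.card.choose k := by
  obtain ⟨m, rfl⟩ := Nat.exists_eq_add_of_le' hk
  have h1 : (Finset.univ.filter (fun S : Finset α => a ∈ S ∧ S ⊆ T ∧ S.card = m + 1)).card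
      = (T.card - 1).choose m := by
    rw [← Finset.card_erase_of_mem ha, ← Finset.card_powersetCard]
    refine Finset.card_bij' (fun S _ => S.erase a) (fun S _ => insert a S) ?_ ?_ ?_ ?_
    · intro S hS
      simp only [Finset.mem_filter, Finset.mem_univ, true_and] at hS
      rw [Finset.mem_powersetCard]
      refine ⟨Finset.erase_subset_erase _ hS.2.1, ?_⟩
      rw [Finset.card_erase_of_mem hS.1, hS.2.2]; rfl
    · intro S hS
      rw [Finset.mem_powersetCard] at hS
      have haS : a ∉ S := fun h => by simpa using hS.1 h
      simp only [Finset.mem_filter, Finset.mem_univ, true_and]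
      refine ⟨by simp, ?_, by rw [Finset.card_insert_of_notMem haS, hS.2]⟩
      exact Finset.insert_subset ha (hS.1.trans (Finset.erase_subset _ _))
    · intro S hS
      simp only [Finset.mem_filter, Finset.mem_univ, true_and] at hS
      exact Finset.insert_erase hS.1
    · intro S hS
      rw [Finset.mem_powersetCard] at hS
      have haS : a ∉ S := fun h => by simpa using hS.1 h
      exact Finset.erase_insert haS
  rw [h1]
  have hpos : 0 < T.card := Finset.card_pos.mpr ⟨a, ha⟩
  obtain ⟨t, ht⟩ := Nat.exists_eq_add_of_le' hpos
  simp only [Nat.succ_eq_add_one, Nat.zero_add] at ht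
  rw [ht, Nat.add_sub_cancel, Nat.add_one_mul_choose_eq]
  ring

lemma cnt_compl {α : Type*} [Fintype α] [DecidableEq α] (Q : Finset α → Prop) [DecidablePred Q] :
    (Finset.univ.filter (fun S : Finset α => Q S)).card
      = (Finset.univ.filter (fun S : Finset α => Q Sᶜ)).card := by
  refine Finset.card_bij' (fun S _ => Sᶜ) (fun S _ => Sᶜ) ?_ ?_ ?_ ?_ <;> simp

lemma cnt_sup {α : Type*} [Fintype α] [DecidableEq α] (T : Finset α) (k : ℕ)
    (hk : k ≤ Fintype.card α) :
    (Finset.univ.filter (fun S : Finset α => T ⊆ S ∧ S.card = k)).card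
      = (Fintype.card α - T.card).choose (Fintype.card α - k) := by
  rw [cnt_compl, ← Finset.card_compl, ← cnt_sub]
  congr 1; ext S
  have := Finset.card_le_univ S
  simp only [Finset.mem_filter, Finset.mem_univ, true_and, Finset.card_compl]
  rw [Finset.subset_compl_comm]
  refine and_congr Iff.rfl ?_
  omega

lemma cnt_sup_mem {α : Type*} [Fintype α] [DecidableEq α] (T : Finset α) (k : ℕ)
    (hk : k < Fintype.card α) (a : α) (ha : a ∉ T) :
    (Fintype.card α - T.card) *
      (Finset.univ.filter (fun S : Finset α => a ∉ S ∧ T ⊆ S ∧ S.card = k)).card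
      = (Fintype.card α - k) * (Fintype.card α - T.card).choose (Fintype.card α - k) := by
  rw [cnt_compl, ← Finset.card_compl, ← cnt_sub_mem Tᶜ (Fintype.card α - k) (by omega) a (by simpa)]
  congr 2; ext S
  have := Finset.card_le_univ S
  simp only [Finset.mem_filter, Finset.mem_univ, true_and, Finset.card_compl]
  rw [Finset.subset_compl_comm]
  simp only [Finset.mem_compl, not_not]
  refine and_congr Iff.rfl (and_congr Iff.rfl ?_)
  omega

end counting

/-- incidence indicator -/
def Pw (d i j : ℕ) (S T : Subs d) : ℚ := if S ⊆ T ∧ S.card = i ∧ T.card = j then 1 else 0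

lemma Pw_row (d i j : ℕ) (hj : j < d + 1) (S : Subs d) :
    ∑ T, Pw d i j S T = if S.card = i then ((d+1-i).choose (d+1-j) : ℚ) else 0 := by
  split_ifs with h
  · have := cnt_sup S j (by simpa using hj.le)
    simp only [Fintype.card_fin, h] at this
    rw [← this]
    simp [Pw, h]
  · simp [Pw, h]

lemma Pw_col (d i j : ℕ) (T : Subs d) :
    ∑ S, Pw d i j S T = if T.card = j then (j.choose i : ℚ) else 0 := by
  split_ifs with h
  · have := cnt_sub T i
    rw [h] at this
    rw [← this]
    simp [Pw, h]
  · simp [Pw, h]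

lemma Pw_row_mem (d i j : ℕ) (hij : i < j) (hj : j < d + 1) (S : Subs d) (a : Fin (d+1)) :
    ∑ T, (if a ∈ T then Pw d i j S T else 0) = if S.card = i then
      ((d+1-i).choose (d+1-j) : ℚ) - (if a ∈ S then 0 else
        ((d+1-i).choose (d+1-j) : ℚ) * ((d + 1 - j) / (d + 1 - i))) else 0 := by
  have hsplit : ∑ T, (if a ∈ T then Pw d i j S T else 0) =
      ∑ T, Pw d i j S T - ∑ T, (if a ∉ T then Pw d i j S T else 0) := by
    rw [← Finset.sum_sub_distrib]
    refine Finset.sum_congr rfl fun T _ => ?_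
    by_cases h : a ∈ T <;> simp [h]
  rw [hsplit, Pw_row d i j hj]
  split_ifs with h ha
  · congr 1
    refine Finset.sum_eq_zero fun T _ => ?_
    by_cases hT : a ∈ T
    · simp [hT]
    · have : ¬ S ⊆ T := fun hh => hT (hh ha)
      simp [Pw, this]
  · congr 1
    have := cnt_sup_mem S j (by simpa using hj) a ha
    simp only [Fintype.card_fin, h] at this
    have h2 : ∑ T, (if a ∉ T then Pw d i j S T else 0) = 
      ((Finset.univ.filter (fun T : Subs d => a ∉ T ∧ S ⊆ T ∧ T.card = j)).card : ℚ) := by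
      rw [Finset.card_filter]
      push_cast
      refine Finset.sum_congr rfl fun T _ => ?_
      by_cases hT : a ∈ T <;> simp [Pw, h, hT]
    rw [h2]
    have h3 := congrArg (Nat.cast (R := ℚ)) this
    push_cast [Nat.cast_sub (show i ≤ d + 1 by omega), Nat.cast_sub hj.le] at h3
    have h4 : (d:ℚ) + 1 - i ≠ 0 := by
      have : (i:ℚ) < d + 1 := by exact_mod_cast (by omega : i < d + 1)
      linarith
    field_simp
    linarith
  · simp [Pw, h]

lemma Pw_col_mem (d i j : ℕ) (hi : 1 ≤ i) (hij : i < j) (T : Subs d) (a : Fin (d+1)) :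
    ∑ S, (if a ∈ S then Pw d i j S T else 0) = if T.card = j then
      (if a ∈ T then (j.choose i : ℚ) * (i / j) else 0) else 0 := by
  split_ifs with h ha
  · have := cnt_sub_mem T i hi a ha
    rw [h] at this
    have h2 : ∑ S, (if a ∈ S then Pw d i j S T else 0) = 
      ((Finset.univ.filter (fun S : Subs d => a ∈ S ∧ S ⊆ T ∧ S.card = i)).card : ℚ) := by
      rw [Finset.card_filter]
      push_cast
      refine Finset.sum_congr rfl fun S _ => ?_
      by_cases hT : a ∈ S <;> simp [Pw, h, hT]
    rw [h2]
    have h3 := congrArg (Nat.cast (R := ℚ)) this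
    push_cast at h3
    have h4 : (j:ℚ) ≠ 0 := by exact_mod_cast (by omega : j ≠ 0)
    field_simp
    linarith
  · refine Finset.sum_eq_zero fun S _ => ?_
    by_cases hS : a ∈ S
    · have : ¬ S ⊆ T := fun hh => ha (hh hS)
      simp [Pw, this]
    · simp [hS]
  · simp [Pw, h]

/-- diagonal weight -/
noncomputable def Dw (d i j : ℕ) (S : Subs d) : ℚ :=
  (if S.card = i then ((d+1-i).choose (d+1-j) : ℚ) * ((d + 1 - j) / (d + 1 - i)) else 0)
  + (if S.card = j then (j.choose i : ℚ) * (i / j) else 0)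

noncomputable def Ww (d i j : ℕ) (S T : Subs d) : ℚ :=
  Pw d i j S T + Pw d i j T S - if S = T then Dw d i j S else 0

lemma Ww_bal (d i j : ℕ) (hi : 1 ≤ i) (hij : i < j) (hj : j < d + 1) (S : Subs d)
    (a : Fin (d+1)) :
    ∑ T, (if a ∈ T then Ww d i j S T else 0) = if S.card = i then
      ((d+1-i).choose (d+1-j) : ℚ) - 
        ((d+1-i).choose (d+1-j) : ℚ) * ((d + 1 - j) / (d + 1 - i)) else 0 := by
  have : ∑ T, (if a ∈ T then Ww d i j S T else 0) =
      ∑ T, (if a ∈ T then Pw d i j S T else 0) + ∑ T, (if a ∈ T then Pw d i j T S else 0)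
      - if a ∈ S then Dw d i j S else 0 := by
    have hd : (if a ∈ S then Dw d i j S else 0)
        = ∑ T, if S = T then (if a ∈ T then Dw d i j S else 0) else 0 := by simp
    rw [hd, ← Finset.sum_add_distrib, ← Finset.sum_sub_distrib]
    refine Finset.sum_congr rfl fun T _ => ?_
    by_cases h : a ∈ T <;> simp [h, Ww]
  rw [this, Pw_row_mem d i j hij hj, Pw_col_mem d i j hi hij]
  unfold Dw
  by_cases ha : a ∈ S <;> by_cases h : S.card = i <;> by_cases h' : S.card = j <;> simp only [ha, h, h', if_true, if_false] <;> (try split_ifs) <;> first | omega | ring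

lemma main_count (d i j : ℕ) (hj : j < d + 1) :
    (∑ S, ∑ T, Pw d i j S T = ((d+1).choose i : ℚ) * ((d+1-i).choose (d+1-j) : ℚ)) ∧
    (∑ S, ∑ T, Pw d i j S T = ((d+1).choose j : ℚ) * (j.choose i : ℚ)) := by
  have hc : ∀ k, ((Finset.univ.filter (fun S : Subs d => S.card = k)).card : ℚ)
      = ((d+1).choose k : ℚ) := by
    intro k
    have := cnt_sub (Finset.univ : Subs d) k
    simp only [Finset.subset_univ, true_and, Finset.card_univ, Fintype.card_fin] at this
    rw [this]
  constructor
  · simp only [Pw_row d i j hj]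
    rw [← Finset.sum_filter, Finset.sum_const, nsmul_eq_mul, hc]
  · rw [Finset.sum_comm]
    simp only [Pw_col d i j]
    rw [← Finset.sum_filter, Finset.sum_const, nsmul_eq_mul, hc]

lemma Dw_sum (d i j : ℕ) :
    ∑ S, Dw d i j S = ((d+1).choose i : ℚ) *
      (((d+1-i).choose (d+1-j) : ℚ) * ((d + 1 - j) / (d + 1 - i)))
      + ((d+1).choose j : ℚ) * ((j.choose i : ℚ) * (i / j)) := by
  have hc : ∀ k, ((Finset.univ.filter (fun S : Subs d => S.card = k)).card : ℚ)
      = ((d+1).choose k : ℚ) := by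
    intro k
    have := cnt_sub (Finset.univ : Subs d) k
    simp only [Finset.subset_univ, true_and, Finset.card_univ, Fintype.card_fin] at this
    rw [this]
  unfold Dw
  rw [Finset.sum_add_distrib, ← Finset.sum_filter, ← Finset.sum_filter, Finset.sum_const,
    Finset.sum_const, nsmul_eq_mul, nsmul_eq_mul, hc, hc]

/-- codimension-2 values: if `r` is a symmetric square-free
representation of the Todd class, then for any 2-chain `S₁ ⊊ S₂` in `B̄` with
`|S₁| = s₁`, `|S₂| = s₂`:
`r(S₁,S₂) = 1/4 − (1/12)·((d+1−s₂)/(d+1−s₁) + s₁/s₂)`. -/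
theorem stmt6 (d : ℕ) (hd : 2 ≤ d) (r : Finset (Subs d) → ℚ)
    (hsym : ∀ H H' : Finset (Subs d), IsProperChain d H → IsProperChain d H' →
      H.image Finset.card = H'.image Finset.card → r H = r H')
    (hTd : (∑ H ∈ Finset.univ.filter (fun H : Finset (Subs d) => IsProperChain d H),
        C (r H) * chainMon d H) - Td d ∈ Itot d)
    (S1 S2 : Subs d) (h1 : isProper d S1) (h2 : isProper d S2) (h12 : S1 ⊂ S2) :
    r {S1, S2} = 1/4 - (1/12) *
      ((((d : ℚ) + 1 - (S2.card : ℚ)) / ((d : ℚ) + 1 - (S1.card : ℚ))) +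
        (S1.card : ℚ) / (S2.card : ℚ)) := by
  set i := S1.card with hi'
  set j := S2.card with hj'
  have hi : 1 ≤ i := Finset.card_pos.mpr (Finset.nonempty_iff_ne_empty.mpr h1.1)
  have hij : i < j := Finset.card_lt_card h12
  have hj : j < d + 1 := by
    have := Finset.card_lt_card (Finset.ssubset_univ_iff.mpr h2.2)
    simpa using this
  have hprop : ∀ S : Subs d, (S.card = i ∨ S.card = j) → isProper d S := by
    intro S hS
    constructor
    · rintro rfl; simp at hS; omega
    · rintro rfl; simp at hS; omega
  have hWsymm : ∀ S T, Ww d i j S T = Ww d i j T S := by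
    intro S T
    unfold Ww
    by_cases h : S = T
    · subst h; rfl
    · simp [h, Ne.symm h]; ring
  have hPpr : ∀ S T, Pw d i j S T ≠ 0 → S ⊆ T ∧ S.card = i ∧ T.card = j := by
    intro S T h
    by_contra hh
    exact h (by simp only [Pw, if_neg hh])
  have hWpr : ∀ S T, ¬ isProper d T → Ww d i j S T = 0 := by
    intro S T hT
    have a1 : Pw d i j S T = 0 := by
      by_contra h; exact hT (hprop T (Or.inr (hPpr _ _ h).2.2))
    have a2 : Pw d i j T S = 0 := by
      by_contra h; exact hT (hprop T (Or.inl (hPpr _ _ h).2.1))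
    have a3 : T.card ≠ i := fun h => hT (hprop T (Or.inl h))
    have a4 : T.card ≠ j := fun h => hT (hprop T (Or.inr h))
    unfold Ww
    rw [a1, a2]
    split_ifs with h
    · subst h; simp [Dw, a3, a4]
    · simp
  have hinc : ∀ S T, ¬ S ⊆ T → ¬ T ⊆ S → Ww d i j S T = 0 := by
    intro S T h h'
    have : S ≠ T := by rintro rfl; exact h subset_rfl
    simp [Ww, Pw, h, h', this]
  have hzero : fnl d (Ww d i j) ((∑ H ∈ Finset.univ.filter
      (fun H : Finset (Subs d) => IsProperChain d H), C (r H) * chainMon d H) - Td d) = 0 := by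
    obtain ⟨p, hp, q, hq, hpq⟩ := Submodule.mem_sup.mp hTd
    rw [← hpq, fnl_add, fnl_I1 d _ hWsymm hinc p hp,
      fnl_I2 d _ hWsymm hWpr _ (fun S a => Ww_bal d i j hi hij hj S a) q hq, add_zero]
  rw [fnl_sub, sub_eq_zero] at hzero
  have hPr : ∀ S T, Pw d i j S T ≠ 0 → S ≠ T ∧ IsProperChain d {S, T} ∧
      r {S, T} = r {S1, S2} := by
    intro S T h
    obtain ⟨b1, b2, b3⟩ := hPpr S T h
    have hch : ∀ A B : Subs d, A ⊆ B → isProper d A → isProper d B →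
        IsProperChain d {A, B} := by
      intro A B hAB hA hB
      refine ⟨by simp [hA, hB], ?_⟩
      simp [hAB]
    have c1 := hch S T b1 (hprop S (Or.inl b2)) (hprop T (Or.inr b3))
    refine ⟨by rintro rfl; omega, c1, ?_⟩
    refine hsym _ _ c1 (hch S1 S2 h12.1 h1 h2) ?_
    simp [Finset.image_insert, b2, b3, ← hi', ← hj']
  have hL : fnl d (Ww d i j) (∑ H ∈ Finset.univ.filter
      (fun H : Finset (Subs d) => IsProperChain d H), C (r H) * chainMon d H)
      = ∑ S, ∑ T, r {S1, S2} * (Pw d i j S T + Pw d i j T S) := by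
    unfold fnl
    refine Finset.sum_congr rfl fun S _ => Finset.sum_congr rfl fun T _ => ?_
    rw [jet2_sum]
    by_cases hP : Pw d i j S T = 0
    · by_cases hQ : Pw d i j T S = 0
      · by_cases hST : S = T
        · simp [hST]; right; rw [hST] at hP; exact hP
        · simp [Ww, hP, hQ, hST]
      · obtain ⟨e1, e2, e3⟩ := hPr T S hQ
        rw [Finset.pair_comm] at e2 e3
        rw [if_pos ⟨e1.symm, e2⟩, e3]
        simp [Ww, e1.symm]; ring
    · obtain ⟨e1, e2, e3⟩ := hPr S T hP
      rw [if_pos ⟨e1, e2⟩, e3]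
      simp [Ww, e1]; ring
  have hR : fnl d (Ww d i j) (Td d) = ∑ S, ∑ T, ((1/4) * (Pw d i j S T + Pw d i j T S)
      - (1/6) * if S = T then Dw d i j S else 0) := by
    unfold fnl
    refine Finset.sum_congr rfl fun S _ => Finset.sum_congr rfl fun T _ => ?_
    by_cases hT : isProper d T
    · by_cases hS : isProper d S
      · rw [jet2_Td d hd S T hS hT]
        by_cases hST : S = T
        · subst hST
          have : Pw d i j S S = 0 := by
            by_contra h; exact (hPr S S h).1 rfl
          simp [Ww, this]; ring
        · simp [Ww, hST]; ring
      · have hw := hWpr T S hS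
        rw [hWsymm] at hw
        have hne : S ≠ T := by rintro rfl; exact hS hT
        have : Pw d i j S T + Pw d i j T S = 0 := by simpa [Ww, hne] using hw
        rw [hw, this]; simp [hne]
    · have hw := hWpr S T hT
      have a1 : Pw d i j S T = 0 := by
        by_contra h; exact hT (hprop T (Or.inr (hPpr _ _ h).2.2))
      have a2 : Pw d i j T S = 0 := by
        by_contra h; exact hT (hprop T (Or.inl (hPpr _ _ h).2.1))
      have a3 : (if S = T then Dw d i j S else 0) = 0 := by
        simpa [Ww, a1, a2] using hw
      rw [hw, a1, a2, a3]; simp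
  rw [hL, hR] at hzero
  obtain ⟨n1, n2⟩ := main_count d i j hj
  have hsw : ∑ S, ∑ T, Pw d i j T S = ∑ S, ∑ T, Pw d i j S T := Finset.sum_comm
  simp only [Finset.sum_sub_distrib, ← Finset.mul_sum, Finset.sum_add_distrib, hsw,
    Finset.sum_ite_eq, Finset.mem_univ, if_true, Dw_sum] at hzero
  set N := ∑ S, ∑ T, Pw d i j S T with hN
  have hNpos : N ≠ 0 := by
    rw [n2]
    have := Nat.choose_pos hj.le
    have := Nat.choose_pos hij.le
    positivity
  rw [← mul_assoc, ← mul_assoc, ← n1, ← n2] at hzero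
  have : N * (r {S1, S2}) = N * (1/4 - (1/12) * ((((d : ℚ) + 1 - (j : ℚ)) / ((d : ℚ) + 1 - (i : ℚ))) + (i : ℚ) / (j : ℚ))) := by
    linarith
  exact mul_left_cancel₀ hNpos this
end
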